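/- arXiv:2108.10602 — 8 statements merged into one kernel-verified Lean document; each statement's English description precedes it below -/
import Mathlib

section
/- Let V be a real vector space and let ‖·‖ : V → [0,∞] satisfy ‖av + bw‖ ≤ |a|‖v‖ + |b|‖w‖ for all v,w ∈ V and a,b ∈ ℝ with ‖v‖ + ‖w‖ < ∞. Let T ∈ (0,∞), α ∈ (0,∞), m ∈ ℕ, and 0 = τ₀ < τ₁ < … < τ_m = T. Let x : [0,T] → V and let X : [0,T] → V be the piecewise affine linear interpolation of x on the grid, i.e. for all k ∈ {1,…,m} and t ∈ [τ_{k−1}, τ_k] it holds that X_t = (τ_k − τ_{k−1})⁻¹[(τ_k − t)x_{τ_{k−1}} + (t − τ_{k−1})x_{τ_k}]. Then sup_{t∈[0,T]} ‖X_t − x_t‖ ≤ 2^{−min{3,α}} · [max_{k∈{1,…,m}} |τ_k − τ_{k−1}|^α] · [sup_{r,s∈[0,T], r≠s} ‖x_r − x_s‖/|r−s|^α]. -/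
open scoped ENNReal

/-- Scalar estimate for the interpolation weights, small exponents. -/
theorem aux_small (l μ α : ℝ) (hl : 0 < l) (hμ : 0 < μ) (h1 : l + μ = 1)
    (hα : 0 < α) (hα1 : α ≤ 1) :
    μ * l ^ α + l * μ ^ α ≤ (2:ℝ) ^ (-α) := by
  have hc := (Real.concaveOn_rpow hα.le hα1).2 (x := l) (y := μ) hl.le hμ.le hμ.le hl.le
    (by linarith)
  simp only [smul_eq_mul] at hc
  refine hc.trans ?_
  rw [Real.rpow_neg (by norm_num), ← Real.inv_rpow (by norm_num)]
  apply Real.rpow_le_rpow (by positivity) _ hα.le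
  nlinarith [sq_nonneg (l - μ)]

/-- Scalar estimate for the interpolation weights, medium exponents. -/
theorem aux_mid (l μ α : ℝ) (hl : 0 < l) (hμ : 0 < μ) (h1 : l + μ = 1)
    (hα : 1 ≤ α) (hα3 : α ≤ 3) :
    μ * l ^ α + l * μ ^ α ≤ (2:ℝ) ^ (-α) := by
  have hc := (Real.concaveOn_rpow (p := (α - 1) / 2) (by linarith) (by linarith)).2
    (x := l ^ 2) (y := μ ^ 2) (sq_nonneg l) (sq_nonneg μ)
    (by norm_num : (0:ℝ) ≤ 1 / 2) (by norm_num : (0:ℝ) ≤ 1 / 2) (by norm_num)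
  simp only [smul_eq_mul] at hc
  have e : ∀ y : ℝ, 0 < y → (y ^ 2) ^ ((α - 1) / 2) = y ^ (α - 1) := by
    intro y hy
    rw [← Real.rpow_natCast, ← Real.rpow_mul hy.le]
    congr 1
    push_cast
    ring
  have e2 : ∀ y : ℝ, 0 < y → y ^ α = y * y ^ (α - 1) := by
    intro y hy
    nth_rewrite 2 [← Real.rpow_one y]
    rw [← Real.rpow_add hy]
    congr 1
    ring
  rw [e l hl, e μ hμ] at hc
  set q : ℝ := 2 * (l ^ 2 + μ ^ 2) with hq
  have hq1 : 1 ≤ q := by nlinarith [sq_nonneg (l - μ)]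
  have hqe : (1 / 2 * l ^ 2 + 1 / 2 * μ ^ 2 : ℝ) = q * ((2:ℝ)⁻¹) ^ 2 := by rw [hq]; ring
  rw [hqe, Real.mul_rpow (by linarith) (by positivity), e _ (by norm_num)] at hc
  have hqq : q ^ ((α - 1) / 2) ≤ q := by
    calc q ^ ((α - 1) / 2) ≤ q ^ (1:ℝ) :=
          Real.rpow_le_rpow_of_exponent_le hq1 (by linarith)
      _ = q := Real.rpow_one q
  have hP : 0 < (2⁻¹:ℝ) ^ (α - 1) := by positivity
  have hc2 : 1 / 2 * l ^ (α - 1) + 1 / 2 * μ ^ (α - 1) ≤ q * (2⁻¹:ℝ) ^ (α - 1) :=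
    hc.trans (mul_le_mul_of_nonneg_right hqq hP.le)
  rw [Real.rpow_neg (by norm_num), ← Real.inv_rpow (by norm_num), e2 _ (by norm_num : (0:ℝ) < 2⁻¹),
    e2 l hl, e2 μ hμ]
  have hlm : 0 < l * μ := by positivity
  have h4 : 2 * (l * μ) * q ≤ 2⁻¹ := by
    have : q = 2 * (1 - 2 * (l * μ)) := by
      rw [hq]
      have : (l + μ) ^ 2 = 1 := by rw [h1]; norm_num
      nlinarith
    rw [this]
    nlinarith [sq_nonneg (l * μ - 1 / 4)]
  calc μ * (l * l ^ (α - 1)) + l * (μ * μ ^ (α - 1))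
      = 2 * (l * μ) * (1 / 2 * l ^ (α - 1) + 1 / 2 * μ ^ (α - 1)) := by ring
    _ ≤ 2 * (l * μ) * (q * (2⁻¹:ℝ) ^ (α - 1)) := by gcongr
    _ = (2 * (l * μ) * q) * (2⁻¹:ℝ) ^ (α - 1) := by ring
    _ ≤ 2⁻¹ * (2⁻¹:ℝ) ^ (α - 1) := by gcongr

theorem aux_all (l μ α : ℝ) (hl : 0 ≤ l) (hμ : 0 ≤ μ) (h1 : l + μ = 1) (hα : 0 < α) :
    μ * l ^ α + l * μ ^ α ≤ (2:ℝ) ^ (-(min 3 α)) := by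
  rcases hl.eq_or_lt with h | hl
  · subst h
    rw [Real.zero_rpow hα.ne']
    simp only [mul_zero, zero_mul, add_zero]
    positivity
  rcases hμ.eq_or_lt with h | hμ
  · subst h
    rw [Real.zero_rpow hα.ne']
    simp only [mul_zero, zero_mul, add_zero]
    positivity
  rcases le_total α 1 with h | h
  · rw [min_eq_right (by linarith)]
    exact aux_small l μ α hl hμ h1 hα h
  rcases le_total α 3 with h3 | h3
  · rw [min_eq_right h3]
    exact aux_mid l μ α hl hμ h1 h h3
  · rw [min_eq_left h3]
    refine le_trans ?_ (aux_mid l μ 3 hl hμ h1 (by norm_num) le_rfl)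
    have a1 : l ^ α ≤ l ^ (3:ℝ) := Real.rpow_le_rpow_of_exponent_ge hl (by linarith) h3
    have a2 : μ ^ α ≤ μ ^ (3:ℝ) := Real.rpow_le_rpow_of_exponent_ge hμ (by linarith) h3
    gcongr

/-- Error estimate for piecewise affine linear interpolation: if `X` is the piecewise
affine linear interpolation of `x : [0,T] → V` on the grid `0 = τ₀ < τ₁ < … < τ_m = T`,
then `sup_{t∈[0,T]} ‖X_t − x_t‖ ≤ 2^{−min{3,α}} · [max_k |τ_k − τ_{k−1}|^α] ·
[sup_{r≠s} ‖x_r − x_s‖/|r−s|^α]`, where `‖·‖ : V → [0,∞]` is a generalized norm. -/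
theorem stmt_0 {V : Type*} [AddCommGroup V] [Module ℝ V]
    (N : V → ℝ≥0∞)
    (hN : ∀ (v w : V) (a b : ℝ), N v + N w < ⊤ →
      N (a • v + b • w) ≤ ENNReal.ofReal |a| * N v + ENNReal.ofReal |b| * N w)
    (T α : ℝ) (hT : 0 < T) (hα : 0 < α)
    (m : ℕ) (hm : 0 < m)
    (τ : ℕ → ℝ) (hτ0 : τ 0 = 0) (hτm : τ m = T)
    (hτmono : ∀ k, k < m → τ k < τ (k + 1))
    (x X : ℝ → V)
    (hX : ∀ k, 1 ≤ k → k ≤ m → ∀ t, τ (k - 1) ≤ t → t ≤ τ k →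
      X t = (τ k - τ (k - 1))⁻¹ • ((τ k - t) • x (τ (k - 1)) + (t - τ (k - 1)) • x (τ k))) :
    (⨆ t : Set.Icc (0:ℝ) T, N (X t - x t))
      ≤ ENNReal.ofReal ((2:ℝ) ^ (-(min 3 α)))
        * (⨆ k ∈ Finset.Icc 1 m, ENNReal.ofReal (|τ k - τ (k - 1)| ^ α))
        * ⨆ (r : Set.Icc (0:ℝ) T) (s : Set.Icc (0:ℝ) T) (_ : (r : ℝ) ≠ (s : ℝ)),
            N (x r - x s) / ENNReal.ofReal (|(r : ℝ) - (s : ℝ)| ^ α) := by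
  have hmono : ∀ i j, i ≤ j → j ≤ m → τ i ≤ τ j := by
    intro i j hij
    induction j, hij using Nat.le_induction with
    | base => intro _; exact le_rfl
    | succ n hn ih => intro hnm; exact (ih (by omega)).trans (hτmono n (by omega)).le
  set C : ℝ≥0∞ := ⨆ (r : Set.Icc (0:ℝ) T) (s : Set.Icc (0:ℝ) T) (_ : (r : ℝ) ≠ (s : ℝ)),
            N (x r - x s) / ENNReal.ofReal (|(r : ℝ) - (s : ℝ)| ^ α) with hC
  have hne : ∀ r s : ℝ, 0 ≤ r → r ≤ T → 0 ≤ s → s ≤ T → r ≠ s →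
      N (x r - x s) ≤ ENNReal.ofReal (|r - s| ^ α) * C := by
    intro r s hr0 hrT hs0 hsT hrs
    have hpos : 0 < |r - s| ^ α := Real.rpow_pos_of_pos (abs_pos.2 (sub_ne_zero.2 hrs)) _
    have h : N (x r - x s) / ENNReal.ofReal (|r - s| ^ α) ≤ C :=
      le_iSup_of_le (⟨r, hr0, hrT⟩ : Set.Icc (0:ℝ) T)
        (le_iSup_of_le (⟨s, hs0, hsT⟩ : Set.Icc (0:ℝ) T) (le_iSup_of_le hrs le_rfl))
    rw [mul_comm]
    exact (ENNReal.div_le_iff (ENNReal.ofReal_pos.2 hpos).ne' ENNReal.ofReal_ne_top).1 h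
  refine iSup_le ?_
  rintro ⟨t, ht0, htT⟩
  simp only
  obtain ⟨k, hk1, hkm, hka, hkb⟩ : ∃ k, 1 ≤ k ∧ k ≤ m ∧ τ (k - 1) ≤ t ∧ t ≤ τ k := by
    classical
    have hex : ∃ k, t ≤ τ k := ⟨m, by rw [hτm]; exact htT⟩
    have hle : Nat.find hex ≤ m := Nat.find_min' hex (by rw [hτm]; exact htT)
    have hsp := Nat.find_spec hex
    rcases Nat.eq_zero_or_pos (Nat.find hex) with h0 | h0
    · rw [h0] at hsp
      refine ⟨1, le_rfl, hm, ?_, hsp.trans (hmono 0 1 (by omega) hm)⟩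
      simpa [hτ0] using ht0
    · refine ⟨Nat.find hex, h0, hle, ?_, hsp⟩
      exact (not_le.1 (Nat.find_min hex (by omega : Nat.find hex - 1 < Nat.find hex))).le
  have hlt : τ (k - 1) < τ k := by
    have := hτmono (k - 1) (by omega)
    rwa [Nat.sub_add_cancel hk1] at this
  have ha0 : 0 ≤ τ (k - 1) := hτ0 ▸ hmono 0 (k - 1) (by omega) (by omega)
  have hbT : τ k ≤ T := hτm ▸ hmono k m hkm le_rfl
  have hXt := hX k hk1 hkm t hka hkb
  have hMk : ENNReal.ofReal (|τ k - τ (k - 1)| ^ α) ≤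
      (⨆ k ∈ Finset.Icc 1 m, ENNReal.ofReal (|τ k - τ (k - 1)| ^ α)) :=
    le_iSup₂_of_le (f := fun k (_ : k ∈ Finset.Icc 1 m) =>
      ENNReal.ofReal (|τ k - τ (k - 1)| ^ α)) k (Finset.mem_Icc.2 ⟨hk1, hkm⟩) le_rfl
  refine le_trans ?_ (mul_le_mul_left (mul_le_mul_right hMk _) _)
  generalize τ (k - 1) = a at *
  generalize τ k = b at *
  have hh : 0 < b - a := by linarith
  rw [abs_of_pos hh]
  have hhα : 0 < (b - a) ^ α := Real.rpow_pos_of_pos hh _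
  rw [← ENNReal.ofReal_mul (by positivity)]
  have hcpos : 0 < (2:ℝ) ^ (-(min 3 α)) * (b - a) ^ α := by positivity
  by_cases hCt : C = ⊤
  · rw [hCt, ENNReal.mul_top (ENNReal.ofReal_pos.2 hcpos).ne']
    exact le_top
  have hN0 : N 0 = 0 := by
    have h1 := hne a b ha0 (by linarith) (by linarith) hbT hlt.ne
    have hf : N (x a - x b) < ⊤ :=
      h1.trans_lt (ENNReal.mul_lt_top ENNReal.ofReal_lt_top (lt_top_iff_ne_top.2 hCt))
    have := hN (x a - x b) (x a - x b) 0 0 (ENNReal.add_lt_top.2 ⟨hf, hf⟩)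
    simpa using this
  have hall : ∀ r s : ℝ, 0 ≤ r → r ≤ T → 0 ≤ s → s ≤ T →
      N (x r - x s) ≤ ENNReal.ofReal (|r - s| ^ α) * C := by
    intro r s hr0 hrT hs0 hsT
    by_cases hrs : r = s
    · subst hrs
      rw [sub_self, hN0]
      exact zero_le
    · exact hne r s hr0 hrT hs0 hsT hrs
  have h1 := hall a t ha0 (by linarith) ht0 htT
  have h2 := hall b t (by linarith) hbT ht0 htT
  have hf1 := h1.trans_lt (ENNReal.mul_lt_top ENNReal.ofReal_lt_top (lt_top_iff_ne_top.2 hCt))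
  have hf2 := h2.trans_lt (ENNReal.mul_lt_top ENNReal.ofReal_lt_top (lt_top_iff_ne_top.2 hCt))
  obtain ⟨l, hl⟩ : ∃ l, l = (t - a) / (b - a) := ⟨_, rfl⟩
  obtain ⟨μ, hμ⟩ : ∃ μ, μ = (b - t) / (b - a) := ⟨_, rfl⟩
  have hl0 : 0 ≤ l := by rw [hl]; exact div_nonneg (by linarith) hh.le
  have hμ0 : 0 ≤ μ := by rw [hμ]; exact div_nonneg (by linarith) hh.le
  have hlμ : l + μ = 1 := by rw [hl, hμ]; field_simp; ring
  have hta : t - a = l * (b - a) := by rw [hl]; field_simp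
  have hbt : b - t = μ * (b - a) := by rw [hμ]; field_simp
  have hdec : X t - x t = μ • (x a - x t) + l • (x b - x t) := by
    have h3 : μ • (x a - x t) + l • (x b - x t) = μ • x a + l • x b - (l + μ) • x t := by
      module
    rw [h3, hlμ, one_smul, hXt, smul_add, smul_smul, smul_smul, hl, hμ, div_eq_inv_mul,
      div_eq_inv_mul]
  rw [hdec]
  refine (hN _ _ μ l (ENNReal.add_lt_top.2 ⟨hf1, hf2⟩)).trans ?_
  rw [abs_of_nonneg hl0, abs_of_nonneg hμ0]
  have e1 : |a - t| = l * (b - a) := by rw [abs_sub_comm, hta, abs_of_nonneg (by positivity)]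
  have e2 : |b - t| = μ * (b - a) := by rw [hbt, abs_of_nonneg (by positivity)]
  rw [e1, Real.mul_rpow hl0 hh.le] at h1
  rw [e2, Real.mul_rpow hμ0 hh.le] at h2
  calc ENNReal.ofReal μ * N (x a - x t) + ENNReal.ofReal l * N (x b - x t)
      ≤ ENNReal.ofReal μ * (ENNReal.ofReal (l ^ α * (b - a) ^ α) * C)
        + ENNReal.ofReal l * (ENNReal.ofReal (μ ^ α * (b - a) ^ α) * C) := by gcongr
    _ = ENNReal.ofReal ((μ * l ^ α + l * μ ^ α) * (b - a) ^ α) * C := by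
        rw [← mul_assoc, ← mul_assoc, ← ENNReal.ofReal_mul hμ0, ← ENNReal.ofReal_mul hl0,
          ← add_mul, ← ENNReal.ofReal_add (by positivity) (by positivity)]
        congr 2
        ring
    _ ≤ _ := by
        gcongr
        exact aux_all l μ α hl0 hμ0 hlμ hα
end

section
/- For every α ∈ (0,∞) it holds that sup_{z∈[0,1]} ( z(1−z)^α + (1−z)z^α ) ≤ 2^{−min{3,α}}. -/
/-- For every `α ∈ (0,∞)` it holds that
`sup_{z ∈ [0,1]} ( z(1−z)^α + (1−z)z^α ) ≤ 2^{−min{3,α}}`. -/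
theorem stmt_1 (α : ℝ) (hα : 0 < α) :
    (⨆ z : Set.Icc (0:ℝ) 1, ((z : ℝ) * (1 - (z : ℝ)) ^ α + (1 - (z : ℝ)) * (z : ℝ) ^ α))
      ≤ (2 : ℝ) ^ (-(min 3 α)) := by
  have : Nonempty (Set.Icc (0:ℝ) 1) := ⟨⟨0, by simp⟩⟩
  apply ciSup_le
  rintro ⟨z, hz0, hz1⟩
  simp only
  have hw0 : 0 ≤ 1 - z := by linarith
  have hm : 0 < min 3 α := lt_min (by norm_num) hα
  have hm3 : min 3 α ≤ 3 := min_le_left _ _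
  have hmα : min 3 α ≤ α := min_le_right _ _
  generalize min 3 α = m at hm hm3 hmα ⊢
  have key : z * (1 - z) ^ 3 + (1 - z) * z ^ 3 ≤ (1 / 8 : ℝ) := by
    nlinarith [sq_nonneg (z * (1 - z) - 1 / 4)]
  have e : ∀ x : ℝ, 0 ≤ x → x ^ m = (x ^ 3) ^ (m / 3) := by
    intro x hx
    rw [← Real.rpow_natCast, ← Real.rpow_mul hx]
    congr 1
    push_cast
    ring
  have mono : ∀ x : ℝ, 0 ≤ x → x ≤ 1 → x ^ α ≤ x ^ m := by
    intro x hx hx1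
    exact Real.rpow_le_rpow_of_exponent_ge_of_imp hx hx1 hmα (fun _ h => absurd h hα.ne')
  have conc := (Real.concaveOn_rpow (p := m / 3) (by positivity) (by linarith)).2
    (x := (1 - z) ^ 3) (Set.mem_Ici.2 (by positivity)) (y := z ^ 3)
    (Set.mem_Ici.2 (by positivity)) hz0 hw0 (by ring)
  simp only [smul_eq_mul] at conc
  calc z * (1 - z) ^ α + (1 - z) * z ^ α
      ≤ z * (1 - z) ^ m + (1 - z) * z ^ m := by
        gcongr z * ?_ + (1 - z) * ?_
        · exact mono _ hw0 (by linarith)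
        · exact mono _ hz0 hz1
    _ = z * ((1 - z) ^ 3) ^ (m / 3) + (1 - z) * (z ^ 3) ^ (m / 3) := by
        rw [e _ hw0, e _ hz0]
    _ ≤ (z * (1 - z) ^ 3 + (1 - z) * z ^ 3) ^ (m / 3) := conc
    _ ≤ (1 / 8 : ℝ) ^ (m / 3) := by
        apply Real.rpow_le_rpow (by positivity) key (by positivity)
    _ = (2 : ℝ) ^ (-m) := by
        rw [Real.rpow_neg (by norm_num), ← Real.inv_rpow (by norm_num), e _ (by norm_num)]
        norm_num
end

section
/- Let V be a real vector space and let ‖·‖ : V → [0,∞] satisfy ‖av + bw‖ ≤ |a|‖v‖ + |b|‖w‖ for all v,w ∈ V and a,b ∈ ℝ with ‖v‖ + ‖w‖ < ∞. Let T ∈ (0,∞), α ∈ (0,1], m ∈ ℕ, and 0 = τ₀ < τ₁ < … < τ_m = T. Let x : [0,T] → V and let X : [0,T] → V be the piecewise affine linear interpolation of x on the grid, i.e. for all k ∈ {1,…,m} and t ∈ [τ_{k−1}, τ_k] it holds that X_t = (τ_k − τ_{k−1})⁻¹[(τ_k − t)x_{τ_{k−1}} + (t − τ_{k−1})x_{τ_k}].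 Then sup_{s,t∈[0,T], s≠t} ‖X_s − X_t‖/|s−t|^α ≤ sup_{s,t∈[0,T], s≠t} ‖x_s − x_t‖/|s−t|^α. -/
open scoped ENNReal

/-- Hölder-seminorm stability of piecewise affine linear interpolation: if `X` is the
piecewise affine linear interpolation of `x : [0,T] → V` on the grid
`0 = τ₀ < τ₁ < … < τ_m = T` and `α ∈ (0,1]`, then the `α`-Hölder seminorm of `X` is
bounded by that of `x`, where `‖·‖ : V → [0,∞]` is a generalized norm. -/
theorem stmt_2 {V : Type*} [AddCommGroup V] [Module ℝ V]
    (N : V → ℝ≥0∞)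
    (hN : ∀ (v w : V) (a b : ℝ), N v + N w < ⊤ →
      N (a • v + b • w) ≤ ENNReal.ofReal |a| * N v + ENNReal.ofReal |b| * N w)
    (T α : ℝ) (hT : 0 < T) (hα0 : 0 < α) (hα1 : α ≤ 1)
    (m : ℕ) (hm : 0 < m)
    (τ : ℕ → ℝ) (hτ0 : τ 0 = 0) (hτm : τ m = T)
    (hτmono : ∀ k, k < m → τ k < τ (k + 1))
    (x X : ℝ → V)
    (hX : ∀ k, 1 ≤ k → k ≤ m → ∀ t, τ (k - 1) ≤ t → t ≤ τ k →
      X t = (τ k - τ (k - 1))⁻¹ • ((τ k - t) • x (τ (k - 1)) + (t - τ (k - 1)) • x (τ k))) :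
    (⨆ (s : Set.Icc (0:ℝ) T) (t : Set.Icc (0:ℝ) T) (_ : (s : ℝ) ≠ (t : ℝ)),
        N (X s - X t) / ENNReal.ofReal (|(s : ℝ) - (t : ℝ)| ^ α))
      ≤ ⨆ (s : Set.Icc (0:ℝ) T) (t : Set.Icc (0:ℝ) T) (_ : (s : ℝ) ≠ (t : ℝ)),
          N (x s - x t) / ENNReal.ofReal (|(s : ℝ) - (t : ℝ)| ^ α) := by
  set C := ⨆ (s : Set.Icc (0:ℝ) T) (t : Set.Icc (0:ℝ) T) (_ : (s : ℝ) ≠ (t : ℝ)),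
          N (x s - x t) / ENNReal.ofReal (|(s : ℝ) - (t : ℝ)| ^ α) with hC
  by_cases hCtop : C = ⊤
  · rw [hCtop]; exact le_top
  have hfin : ∀ u : ℝ, C * ENNReal.ofReal u < ⊤ := fun u =>
    ENNReal.mul_lt_top (lt_top_iff_ne_top.2 hCtop) ENNReal.ofReal_lt_top
  -- the bound for distinct points
  have hx1 : ∀ s t : ℝ, 0 ≤ s → s ≤ T → 0 ≤ t → t ≤ T → s < t →
      N (x t - x s) ≤ C * ENNReal.ofReal ((t - s) ^ α) := by
    intro s t hs0 hsT ht0 htT hst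
    have h1 : N (x t - x s) / ENNReal.ofReal (|t - s| ^ α) ≤ C := by
      rw [hC]
      exact le_iSup_of_le (⟨t, ht0, htT⟩ : Set.Icc (0:ℝ) T)
        (le_iSup_of_le (⟨s, hs0, hsT⟩ : Set.Icc (0:ℝ) T)
          (le_iSup_of_le (by simpa using hst.ne') le_rfl))
    have h2 : 0 < t - s := by linarith
    rw [abs_of_pos h2] at h1
    have h3 : 0 < (t - s) ^ α := Real.rpow_pos_of_pos h2 α
    rwa [ENNReal.div_le_iff (by simpa using h3) ENNReal.ofReal_ne_top] at h1
  have hN0 : N 0 = 0 := by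
    have h1 : N (x T - x 0) < ⊤ :=
      (hx1 0 T le_rfl hT.le hT.le le_rfl hT).trans_lt (hfin _)
    have h2 := hN (x T - x 0) (x T - x 0) 0 0 (ENNReal.add_lt_top.2 ⟨h1, h1⟩)
    simpa using h2
  have hx : ∀ s t : ℝ, 0 ≤ s → t ≤ T → s ≤ t →
      N (x t - x s) ≤ C * ENNReal.ofReal ((t - s) ^ α) := by
    intro s t hs0 htT hst
    rcases hst.eq_or_lt with h | h
    · subst h; simp [hN0]
    · exact hx1 s t hs0 (by linarith) (by linarith) htT h
  have comb : ∀ (v w : V) (u u' l : ℝ), 0 ≤ u → 0 ≤ u' → 0 ≤ l → l ≤ 1 →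
      N v ≤ C * ENNReal.ofReal (u ^ α) → N w ≤ C * ENNReal.ofReal (u' ^ α) →
      N ((1 - l) • v + l • w) ≤ C * ENNReal.ofReal (((1 - l) * u + l * u') ^ α) := by
    intro v w u u' l hu hu' hl0 hl1 hv hw
    have hl : 0 ≤ 1 - l := by linarith
    have h1 := hN v w (1 - l) l
      (ENNReal.add_lt_top.2 ⟨hv.trans_lt (hfin _), hw.trans_lt (hfin _)⟩)
    rw [abs_of_nonneg hl, abs_of_nonneg hl0] at h1
    have h2 : (1 - l) * u ^ α + l * u' ^ α ≤ ((1 - l) * u + l * u') ^ α := by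
      have := (Real.concaveOn_rpow hα0.le hα1).2 (Set.mem_Ici.2 hu) (Set.mem_Ici.2 hu') hl hl0
        (by ring)
      simpa [smul_eq_mul] using this
    have hp := Real.rpow_nonneg hu α
    have hp' := Real.rpow_nonneg hu' α
    calc _ ≤ _ := h1
      _ ≤ ENNReal.ofReal (1 - l) * (C * ENNReal.ofReal (u ^ α))
          + ENNReal.ofReal l * (C * ENNReal.ofReal (u' ^ α)) := by gcongr
      _ = C * ENNReal.ofReal ((1 - l) * u ^ α + l * u' ^ α) := by
          rw [ENNReal.ofReal_add (by positivity) (by positivity), ENNReal.ofReal_mul hl,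
            ENNReal.ofReal_mul hl0]
          ring
      _ ≤ _ := by gcongr
  have mono : ∀ i j, i ≤ j → j ≤ m → τ i ≤ τ j := by
    intro i j hij
    induction j, hij using Nat.le_induction with
    | base => intro _; exact le_rfl
    | succ n hn ih => intro h; exact (ih (by omega)).trans (hτmono n (by omega)).le
  have loc : ∀ n, n ≤ m → 0 < n → ∀ t, 0 ≤ t → t ≤ τ n → ∃ k, k < n ∧ τ k ≤ t ∧ t ≤ τ (k + 1) := by
    intro n
    induction n with
    | zero => intro _ h; omega
    | succ n ih =>
      intro hn _ t ht0 ht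
      by_cases h : τ n ≤ t
      · exact ⟨n, by omega, h, ht⟩
      · rcases Nat.eq_zero_or_pos n with h0 | h0
        · subst h0; rw [hτ0] at h; exact absurd ht0 h
        · obtain ⟨k, hk, h1⟩ := ih (by omega) h0 t ht0 (not_le.1 h).le
          exact ⟨k, by omega, h1⟩
  have form : ∀ k, k < m → ∀ t, τ k ≤ t → t ≤ τ (k + 1) → ∃ l : ℝ, 0 ≤ l ∧ l ≤ 1 ∧
      t = (1 - l) * τ k + l * τ (k + 1) ∧ X t = (1 - l) • x (τ k) + l • x (τ (k + 1)) := by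
    intro k hk t h1 h2
    have hd : 0 < τ (k + 1) - τ k := by linarith [hτmono k hk]
    refine ⟨(t - τ k) / (τ (k + 1) - τ k), div_nonneg (by linarith) hd.le,
      (div_le_one hd).2 (by linarith), ?_, ?_⟩
    · field_simp; ring
    · have := hX (k + 1) (by omega) (by omega) t (by simpa using h1) h2
      simp only [Nat.add_sub_cancel] at this
      rw [this, smul_add, smul_smul, smul_smul]
      congr 2
      · field_simp; ring
      · field_simp
  have main : ∀ s t : ℝ, 0 ≤ s → t ≤ T → s < t →
      N (X t - X s) ≤ C * ENNReal.ofReal ((t - s) ^ α) := by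
    intro s t hs0 htT hst
    obtain ⟨k, hk, hk1, hk2⟩ := loc m le_rfl hm s hs0 (by linarith)
    obtain ⟨j, hj, hj1, hj2⟩ := loc m le_rfl hm t (by linarith) (by linarith)
    obtain ⟨l, hl0, hl1, hsl, hXs⟩ := form k hk s hk1 hk2
    obtain ⟨r, hr0, hr1, htr, hXt⟩ := form j hj t hj1 hj2
    have hpos : ∀ i, i ≤ m → 0 ≤ τ i := fun i hi => hτ0 ▸ mono 0 i (by omega) hi
    have hle : ∀ i, i ≤ m → τ i ≤ T := fun i hi => hτm ▸ mono i m hi le_rfl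
    have hkk := hτmono k hk
    have hjj := hτmono j hj
    rcases lt_trichotomy k j with hkj | hkj | hkj
    · have hb : τ (k + 1) ≤ τ j := mono _ _ hkj hj.le
      have step : ∀ p, 0 ≤ p → p ≤ τ j → N (X t - x p) ≤ C * ENNReal.ofReal ((t - p) ^ α) := by
        intro p hp0 hp
        have := comb (x (τ j) - x p) (x (τ (j + 1)) - x p) (τ j - p) (τ (j + 1) - p) r
          (by linarith) (by linarith) hr0 hr1 (hx _ _ hp0 (hle _ hj.le) hp)
          (hx _ _ hp0 (hle _ hj) (by linarith))
        convert this using 2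
        · rw [hXt]; module
        · congr 2; rw [htr]; ring
      have := comb (X t - x (τ k)) (X t - x (τ (k + 1))) (t - τ k) (t - τ (k + 1)) l
          (by linarith) (by linarith) hl0 hl1 (step _ (hpos _ hk.le) (by linarith))
          (step _ (hpos _ hk) (by linarith))
      convert this using 2
      · rw [hXs]; module
      · congr 2; rw [hsl]; ring
    · subst hkj
      have hlr : l ≤ r := by
        by_contra h
        push Not at h
        nlinarith
      have := comb 0 (x (τ (k + 1)) - x (τ k)) 0 (τ (k + 1) - τ k) (r - l) le_rfl
        (by linarith) (by linarith) (by linarith) (by simp [hN0])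
        (hx _ _ (hpos _ hk.le) (hle _ hk) hkk.le)
      convert this using 2
      · rw [hXs, hXt]; module
      · congr 2; rw [hsl, htr]; ring
    · have := mono (j + 1) k hkj hk.le
      linarith
  refine iSup_le fun s => iSup_le fun t => iSup_le fun hne => ?_
  obtain ⟨s, hs0, hsT⟩ := s
  obtain ⟨t, ht0, htT⟩ := t
  simp only at hne ⊢
  have habs : 0 < |s - t| ^ α := Real.rpow_pos_of_pos (abs_pos.2 (sub_ne_zero.2 hne)) α
  rw [ENNReal.div_le_iff (by simpa using habs) ENNReal.ofReal_ne_top]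
  rcases lt_or_gt_of_ne hne with h | h
  · have h1 := main s t hs0 htT h
    have h2 := hN (X t - X s) (X t - X s) (-1) 0
      (ENNReal.add_lt_top.2 ⟨h1.trans_lt (hfin _), h1.trans_lt (hfin _)⟩)
    simp only [abs_neg, abs_one, ENNReal.ofReal_one, one_mul, abs_zero, ENNReal.ofReal_zero,
      zero_mul, add_zero, zero_smul, neg_smul, one_smul, neg_sub] at h2
    rw [abs_sub_comm, abs_of_pos (sub_pos.2 h)]
    exact h2.trans h1
  · rw [abs_of_pos (sub_pos.2 h)]
    exact main t s ht0 hsT h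
end

section
/- Let V be a real vector space and let ‖·‖ : V → [0,∞] satisfy ‖av + bw‖ ≤ |a|‖v‖ + |b|‖w‖ for all v,w ∈ V and a,b ∈ ℝ with ‖v‖ + ‖w‖ < ∞. Let T ∈ (0,∞), α ∈ (0,1], n ∈ ℕ, m₁,…,m_n ∈ ℕ, and let τ_{l,k} ∈ ℝ (k ∈ {0,…,m_l}, l ∈ {1,…,n}) be nested grids: for each l, 0 = τ_{l,0} < τ_{l,1} < … < τ_{l,m_l} = T, and {τ_{l,0},…,τ_{l,m_l}} ⊆ {τ_{l+1,0},…,τ_{l+1,m_{l+1}}}. For l ∈ {1,…,n} let 𝓛_l : V^{[0,T]} → V^{[0,T]} be the piecewise affine interpolation operator of the l-th grid, i.e. for k ∈ {1,…,m_l}, t ∈ [τ_{l,k−1}, τ_{l,k}] and y : [0,T] → V: (𝓛_l(y))(t) = (τ_{l,k} − τ_{l,k−1})⁻¹[(τ_{l,k} − t)y_{τ_{l,k−1}} + (t − τ_{l,k−1})y_{τ_{l,k}}]. Let Y⁰, Y¹, …, Yⁿ : [0,T] → V and define the multi-grid approximation 𝒴 = 𝓛₁(Yⁿ) + Σ_{ℓ=1}^{n−1}[𝓛_{ℓ+1}(Y^{n−ℓ})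 − 𝓛_ℓ(Y^{n−ℓ})]. Then sup_{t∈[0,T]} ‖𝒴_t − Y⁰_t‖ ≤ max_{k∈{0,…,m₁}} ‖Yⁿ_{τ_{1,k}} − Y⁰_{τ_{1,k}}‖ + 2^{−α}[max_{k∈{1,…,m_n}} |τ_{n,k} − τ_{n,k−1}|^α]·[sup_{t,s∈[0,T], t≠s} ‖Y⁰_t − Y⁰_s‖/|t−s|^α] + Σ_{l=1}^{n−1} 2^{−α}[max_{k∈{1,…,m_l}} |τ_{l,k} − τ_{l,k−1}|^α]·[sup_{t,s∈[0,T], t≠s} ‖(Y^{n−l}_t − Y⁰_t) − (Y^{n−l}_s − Y⁰_s)‖/|t−s|^α]. -/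
open scoped ENNReal

lemma aux_cell (σ : ℕ → ℝ) (M : ℕ) (hM : 0 < M) (t : ℝ) (h0 : σ 0 ≤ t) (h1 : t ≤ σ M) :
    ∃ k, 1 ≤ k ∧ k ≤ M ∧ σ (k - 1) ≤ t ∧ t ≤ σ k := by
  induction M with
  | zero => omega
  | succ M ih =>
    by_cases h : t ≤ σ M
    · rcases Nat.eq_zero_or_pos M with rfl | hp
      · exact ⟨1, le_refl _, by omega, by simpa using h0, by simpa using h1⟩
      · obtain ⟨k, a, b, c, d⟩ := ih hp h
        exact ⟨k, a, by omega, c, d⟩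
    · exact ⟨M + 1, by omega, le_refl _, by simpa using (not_le.mp h).le, h1⟩

lemma aux_mono (σ : ℕ → ℝ) (M : ℕ) (h : ∀ k, k < M → σ k < σ (k + 1)) (i j : ℕ)
    (hij : i ≤ j) (hj : j ≤ M) : σ i ≤ σ j := by
  induction j, hij using Nat.le_induction with
  | base => exact le_refl _
  | succ j hij ih => exact (ih (by omega)).trans (h j (by omega)).le

lemma aux_tele {V : Type*} [AddCommGroup V] (f : ℕ → V) (n : ℕ) (hn : 0 < n) :
    f 1 + ∑ l ∈ Finset.Icc 1 (n - 1), (f (l + 1) - f l) = f n := by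
  obtain ⟨k, rfl⟩ : ∃ k, n = k + 1 := ⟨n - 1, by omega⟩
  simp only [Nat.add_sub_cancel]
  clear hn
  induction k with
  | zero => simp
  | succ k ih =>
    rw [Finset.sum_Icc_succ_top (by omega), ← add_assoc, ih]
    abel

/-- The scalar estimate behind the factor `2^(-α)`. -/
lemma aux_scalar (α x y : ℝ) (hα0 : 0 < α) (hα1 : α ≤ 1) (hx : 0 ≤ x) (hy : 0 ≤ y)
    (hxy : 0 < x + y) :
    (y / (x + y)) * x ^ α + (x / (x + y)) * y ^ α ≤ (x + y) ^ α / (2:ℝ) ^ α := by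
  have p1 : 0 ≤ y / (x + y) := by positivity
  have p2 : 0 ≤ x / (x + y) := by positivity
  have p3 : y / (x + y) + x / (x + y) = 1 := by field_simp; ring
  have hc := (Real.concaveOn_rpow hα0.le hα1).2 (Set.mem_Ici.mpr hx) (Set.mem_Ici.mpr hy)
    p1 p2 p3
  simp only [smul_eq_mul] at hc
  refine hc.trans ?_
  rw [← Real.div_rpow hxy.le (by norm_num)]
  refine Real.rpow_le_rpow (by positivity) ?_ hα0.le
  rw [show y / (x + y) * x + x / (x + y) * y = 2 * x * y / (x + y) by field_simp; ring,
    div_le_div_iff₀ hxy (by norm_num)]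
  nlinarith [sq_nonneg (x - y)]

lemma aux_add {V : Type*} [AddCommGroup V] [Module ℝ V] (N : V → ℝ≥0∞)
    (hN : ∀ (v w : V) (a b : ℝ), N v + N w < ⊤ →
      N (a • v + b • w) ≤ ENNReal.ofReal |a| * N v + ENNReal.ofReal |b| * N w)
    (v w : V) : N (v + w) ≤ N v + N w := by
  by_cases h : N v + N w < ⊤
  · simpa using hN v w 1 1 h
  · rw [not_lt_top_iff.mp h]; exact le_top

lemma aux_neg {V : Type*} [AddCommGroup V] [Module ℝ V] (N : V → ℝ≥0∞)
    (hN : ∀ (v w : V) (a b : ℝ), N v + N w < ⊤ →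
      N (a • v + b • w) ≤ ENNReal.ofReal |a| * N v + ENNReal.ofReal |b| * N w)
    (v : V) : N (-v) ≤ N v := by
  by_cases h : N v < ⊤
  · simpa using hN v v (-1) 0 (by simp [h])
  · rw [not_lt_top_iff.mp h]; exact le_top

lemma aux_zero {V : Type*} [AddCommGroup V] [Module ℝ V] (N : V → ℝ≥0∞)
    (hN : ∀ (v w : V) (a b : ℝ), N v + N w < ⊤ →
      N (a • v + b • w) ≤ ENNReal.ofReal |a| * N v + ENNReal.ofReal |b| * N w)
    (v : V) (h : N v < ⊤) : N 0 = 0 := by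
  simpa using hN v v 0 0 (by simp [h])

/-- A convex combination is bounded by any common bound. -/
lemma aux_convex {V : Type*} [AddCommGroup V] [Module ℝ V] (N : V → ℝ≥0∞)
    (hN : ∀ (v w : V) (a b : ℝ), N v + N w < ⊤ →
      N (a • v + b • w) ≤ ENNReal.ofReal |a| * N v + ENNReal.ofReal |b| * N w)
    (v w : V) (a b : ℝ) (ha : 0 ≤ a) (hb : 0 ≤ b) (hab : a + b = 1) (C : ℝ≥0∞)
    (hv : N v ≤ C) (hw : N w ≤ C) : N (a • v + b • w) ≤ C := by
  by_cases hC : C = ⊤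
  · rw [hC]; exact le_top
  have h := hN v w a b (ENNReal.add_lt_top.mpr
    ⟨hv.trans_lt (lt_top_iff_ne_top.mpr hC), hw.trans_lt (lt_top_iff_ne_top.mpr hC)⟩)
  refine h.trans ?_
  rw [abs_of_nonneg ha, abs_of_nonneg hb]
  calc _ ≤ ENNReal.ofReal a * C + ENNReal.ofReal b * C := by gcongr
    _ = C := by rw [← add_mul, ← ENNReal.ofReal_add ha hb, hab]; simp

lemma aux_sum {V : Type*} [AddCommGroup V] [Module ℝ V] (N : V → ℝ≥0∞)
    (hN : ∀ (v w : V) (a b : ℝ), N v + N w < ⊤ →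
      N (a • v + b • w) ≤ ENNReal.ofReal |a| * N v + ENNReal.ofReal |b| * N w)
    {ι : Type*} [DecidableEq ι] (s : Finset ι) (v : V) (C : ℝ≥0∞) (f : ι → V)
    (g : ι → ℝ≥0∞) (hv : N v ≤ C) (hf : ∀ i ∈ s, N (f i) ≤ g i) :
    N (v + ∑ i ∈ s, f i) ≤ C + ∑ i ∈ s, g i := by
  induction s using Finset.induction_on with
  | empty => simpa using hv
  | insert a s ha ih =>
    rw [Finset.sum_insert ha, Finset.sum_insert ha, add_left_comm, add_left_comm C]
    refine (aux_add N hN _ _).trans (add_le_add (hf a (by simp)) (ih ?_))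
    intro i hi
    exact hf i (by simp [hi])

/-- Interpolation error on one cell. -/
lemma aux_interp {V : Type*} [AddCommGroup V] [Module ℝ V] (N : V → ℝ≥0∞)
    (hN : ∀ (v w : V) (a b : ℝ), N v + N w < ⊤ →
      N (a • v + b • w) ≤ ENNReal.ofReal |a| * N v + ENNReal.ofReal |b| * N w)
    (T α : ℝ) (hα0 : 0 < α) (hα1 : α ≤ 1) (y : ℝ → V)
    (a b t : ℝ) (h0 : 0 ≤ a) (hat : a ≤ t) (htb : t ≤ b) (hab : a < b) (hbT : b ≤ T) :
    N (y t - (b - a)⁻¹ • ((b - t) • y a + (t - a) • y b)) ≤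
      ENNReal.ofReal (|b - a| ^ α / (2:ℝ) ^ α) *
      ⨆ (t : Set.Icc (0:ℝ) T) (s : Set.Icc (0:ℝ) T) (_ : (t : ℝ) ≠ (s : ℝ)),
              N (y t - y s) / ENNReal.ofReal (|(t : ℝ) - (s : ℝ)| ^ α) := by
  set H := ⨆ (t : Set.Icc (0:ℝ) T) (s : Set.Icc (0:ℝ) T) (_ : (t : ℝ) ≠ (s : ℝ)),
              N (y t - y s) / ENNReal.ofReal (|(t : ℝ) - (s : ℝ)| ^ α) with hH
  have hba : 0 < b - a := sub_pos.mpr hab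
  have hp : 0 < |b - a| ^ α / (2:ℝ) ^ α := by
    have : 0 < |b - a| := abs_pos.mpr hba.ne'
    positivity
  by_cases hT : H = ⊤
  · rw [hT, ENNReal.mul_top (by simpa using hp)]; exact le_top
  have hol : ∀ s t, 0 ≤ s → s ≤ T → 0 ≤ t → t ≤ T → s ≠ t →
      N (y s - y t) ≤ H * ENNReal.ofReal (|s - t| ^ α) := by
    intro s t hs hs' ht ht' hst
    have hpos : 0 < |s - t| ^ α := Real.rpow_pos_of_pos (abs_pos.mpr (sub_ne_zero.mpr hst)) _
    rw [← ENNReal.div_le_iff (by simpa using hpos) (by simp)]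
    exact le_iSup_of_le ⟨s, hs, hs'⟩ (le_iSup_of_le ⟨t, ht, ht'⟩ (le_iSup_of_le hst le_rfl))
  have hfin : N (y a - y b) < ⊤ :=
    (hol a b h0 (by linarith) (by linarith) hbT hab.ne).trans_lt
      (ENNReal.mul_lt_top (lt_top_iff_ne_top.mpr hT) (by simp))
  have hz := aux_zero N hN _ hfin
  have hol2 : ∀ s t, 0 ≤ s → s ≤ T → 0 ≤ t → t ≤ T →
      N (y s - y t) ≤ H * ENNReal.ofReal (|s - t| ^ α) := by
    intro s t hs hs' ht ht'
    by_cases hst : s = t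
    · subst hst; simp [hz]
    · exact hol s t hs hs' ht ht' hst
  have e : y t - (b - a)⁻¹ • ((b - t) • y a + (t - a) • y b) =
      ((b - t) / (b - a)) • (y t - y a) + ((t - a) / (b - a)) • (y t - y b) := by
    have e1 : y t = ((b - t) / (b - a) + (t - a) / (b - a)) • y t := by
      rw [← add_div, show b - t + (t - a) = b - a by ring, div_self hba.ne', one_smul]
    conv_lhs => rw [e1]
    module
  have h1 := hol2 t a (by linarith) (by linarith) h0 (by linarith)
  have h2 := hol2 t b (by linarith) (by linarith) (by linarith) hbT
  have hft : ∀ x : ℝ, H * ENNReal.ofReal x < ⊤ := fun x =>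
    ENNReal.mul_lt_top (lt_top_iff_ne_top.mpr hT) (by simp)
  rw [e]
  refine (hN _ _ _ _ (ENNReal.add_lt_top.mpr
    ⟨h1.trans_lt (hft _), h2.trans_lt (hft _)⟩)).trans ?_
  have p1 : 0 ≤ (b - t) / (b - a) := div_nonneg (by linarith) hba.le
  have p2 : 0 ≤ (t - a) / (b - a) := div_nonneg (by linarith) hba.le
  rw [abs_of_nonneg p1, abs_of_nonneg p2]
  rw [abs_of_nonneg (show 0 ≤ t - a by linarith)] at h1
  rw [abs_of_nonpos (show t - b ≤ 0 by linarith), neg_sub] at h2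
  have q1 : 0 ≤ (t - a) ^ α := Real.rpow_nonneg (by linarith) _
  have q2 : 0 ≤ (b - t) ^ α := Real.rpow_nonneg (by linarith) _
  calc _ ≤ ENNReal.ofReal ((b - t) / (b - a)) * (H * ENNReal.ofReal ((t - a) ^ α)) +
        ENNReal.ofReal ((t - a) / (b - a)) * (H * ENNReal.ofReal ((b - t) ^ α)) := by gcongr
    _ = ENNReal.ofReal ((b - t) / (b - a) * (t - a) ^ α + (t - a) / (b - a) * (b - t) ^ α)
        * H := by
      rw [ENNReal.ofReal_add (by positivity) (by positivity), ENNReal.ofReal_mul p1,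
        ENNReal.ofReal_mul p2]
      ring
    _ ≤ _ := by
      gcongr
      rw [abs_of_pos hba]
      have := aux_scalar α (t - a) (b - t) hα0 hα1 (by linarith) (by linarith) (by linarith)
      rwa [show t - a + (b - t) = b - a by ring] at this

/-- Error analysis for multi-grid (multilevel) approximations: with nested grids
`τ_{l,·}`, interpolation operators `𝓛_l`, and the multi-grid approximation
`𝒴 = 𝓛₁(Yⁿ) + Σ_{ℓ=1}^{n−1}[𝓛_{ℓ+1}(Y^{n−ℓ}) − 𝓛_ℓ(Y^{n−ℓ})]`, the uniform distance
between `𝒴` and `Y⁰` is bounded by the grid errors and Hölder seminorms as stated. -/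
theorem stmt_3 {V : Type*} [AddCommGroup V] [Module ℝ V]
    (N : V → ℝ≥0∞)
    (hN : ∀ (v w : V) (a b : ℝ), N v + N w < ⊤ →
      N (a • v + b • w) ≤ ENNReal.ofReal |a| * N v + ENNReal.ofReal |b| * N w)
    (T α : ℝ) (hT : 0 < T) (hα0 : 0 < α) (hα1 : α ≤ 1)
    (n : ℕ) (hn : 0 < n)
    (m : ℕ → ℕ) (hm : ∀ l, 1 ≤ l → l ≤ n → 0 < m l)
    (τ : ℕ → ℕ → ℝ)
    (hτ0 : ∀ l, 1 ≤ l → l ≤ n → τ l 0 = 0)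
    (hτT : ∀ l, 1 ≤ l → l ≤ n → τ l (m l) = T)
    (hτmono : ∀ l, 1 ≤ l → l ≤ n → ∀ k, k < m l → τ l k < τ l (k + 1))
    (hnested : ∀ l, 1 ≤ l → l < n → ∀ k ≤ m l, ∃ j ≤ m (l + 1), τ (l + 1) j = τ l k)
    (L : ℕ → (ℝ → V) → ℝ → V)
    (hL : ∀ l, 1 ≤ l → l ≤ n → ∀ k, 1 ≤ k → k ≤ m l → ∀ y : ℝ → V,
      ∀ t, τ l (k - 1) ≤ t → t ≤ τ l k →
        L l y t = (τ l k - τ l (k - 1))⁻¹ •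
          ((τ l k - t) • y (τ l (k - 1)) + (t - τ l (k - 1)) • y (τ l k)))
    (Y : ℕ → ℝ → V) (𝒴 : ℝ → V)
    (h𝒴 : ∀ t : ℝ, 𝒴 t = L 1 (Y n) t
      + ∑ l ∈ Finset.Icc 1 (n - 1), (L (l + 1) (Y (n - l)) t - L l (Y (n - l)) t)) :
    (⨆ t : Set.Icc (0:ℝ) T, N (𝒴 t - Y 0 t))
      ≤ (⨆ k ∈ Finset.range (m 1 + 1), N (Y n (τ 1 k) - Y 0 (τ 1 k)))
        + (⨆ k ∈ Finset.Icc 1 (m n),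
              ENNReal.ofReal (|τ n k - τ n (k - 1)| ^ α / (2:ℝ) ^ α))
          * (⨆ (t : Set.Icc (0:ℝ) T) (s : Set.Icc (0:ℝ) T) (_ : (t : ℝ) ≠ (s : ℝ)),
              N (Y 0 t - Y 0 s) / ENNReal.ofReal (|(t : ℝ) - (s : ℝ)| ^ α))
        + ∑ l ∈ Finset.Icc 1 (n - 1),
            (⨆ k ∈ Finset.Icc 1 (m l),
                ENNReal.ofReal (|τ l k - τ l (k - 1)| ^ α / (2:ℝ) ^ α))
              * ⨆ (t : Set.Icc (0:ℝ) T) (s : Set.Icc (0:ℝ) T) (_ : (t : ℝ) ≠ (s : ℝ)),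
                  N ((Y (n - l) t - Y 0 t) - (Y (n - l) s - Y 0 s))
                    / ENNReal.ofReal (|(t : ℝ) - (s : ℝ)| ^ α) := by
  have cell : ∀ l, 1 ≤ l → l ≤ n → ∀ t, 0 ≤ t → t ≤ T →
      ∃ k, 1 ≤ k ∧ k ≤ m l ∧ τ l (k - 1) ≤ t ∧ t ≤ τ l k := by
    intro l h1 h2 t h0 ht
    exact aux_cell (τ l) (m l) (hm l h1 h2) t (by rw [hτ0 l h1 h2]; exact h0)
      (by rw [hτT l h1 h2]; exact ht)
  have mono : ∀ l, 1 ≤ l → l ≤ n → ∀ i j, i ≤ j → j ≤ m l → τ l i ≤ τ l j :=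
    fun l h1 h2 => aux_mono (τ l) (m l) (hτmono l h1 h2)
  have nonneg : ∀ l, 1 ≤ l → l ≤ n → ∀ i, i ≤ m l → 0 ≤ τ l i := by
    intro l h1 h2 i hi
    rw [← hτ0 l h1 h2]; exact mono l h1 h2 0 i (by omega) hi
  have leT : ∀ l, 1 ≤ l → l ≤ n → ∀ i, i ≤ m l → τ l i ≤ T := by
    intro l h1 h2 i hi
    rw [← hτT l h1 h2]; exact mono l h1 h2 i (m l) hi le_rfl
  have lt' : ∀ l, 1 ≤ l → l ≤ n → ∀ k, 1 ≤ k → k ≤ m l → τ l (k - 1) < τ l k := by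
    intro l h1 h2 k hk hk'
    have := hτmono l h1 h2 (k - 1) (by omega)
    rwa [Nat.sub_add_cancel hk] at this
  -- interpolation error
  have err : ∀ l, 1 ≤ l → l ≤ n → ∀ y : ℝ → V, ∀ t, 0 ≤ t → t ≤ T →
      N (y t - L l y t) ≤ (⨆ k ∈ Finset.Icc 1 (m l),
              ENNReal.ofReal (|τ l k - τ l (k - 1)| ^ α / (2:ℝ) ^ α))
          * (⨆ (t : Set.Icc (0:ℝ) T) (s : Set.Icc (0:ℝ) T) (_ : (t : ℝ) ≠ (s : ℝ)),
              N (y t - y s) / ENNReal.ofReal (|(t : ℝ) - (s : ℝ)| ^ α)) := by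
    intro l h1 h2 y t h0 ht
    obtain ⟨k, hk1, hk2, ha, hb⟩ := cell l h1 h2 t h0 ht
    rw [hL l h1 h2 k hk1 hk2 y t ha hb]
    refine (aux_interp N hN T α hα0 hα1 y _ _ t (nonneg l h1 h2 _ (by omega)) ha hb
      (lt' l h1 h2 k hk1 hk2) (leT l h1 h2 k hk2)).trans ?_
    gcongr
    exact le_iSup₂_of_le k (Finset.mem_Icc.mpr ⟨hk1, hk2⟩) le_rfl
  have Lsub : ∀ l, 1 ≤ l → l ≤ n → ∀ y z : ℝ → V, ∀ t, 0 ≤ t → t ≤ T →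
      L l (fun s => y s - z s) t = L l y t - L l z t := by
    intro l h1 h2 y z t h0 ht
    obtain ⟨k, hk1, hk2, ha, hb⟩ := cell l h1 h2 t h0 ht
    simp only [hL l h1 h2 k hk1 hk2 _ t ha hb]
    module
  -- interpolation is bounded by the values on the grid
  have bdd : ∀ l, 1 ≤ l → l ≤ n → ∀ y : ℝ → V, ∀ t, 0 ≤ t → t ≤ T → ∀ C,
      (∀ k ≤ m l, N (y (τ l k)) ≤ C) → N (L l y t) ≤ C := by
    intro l h1 h2 y t h0 ht C hC
    obtain ⟨k, hk1, hk2, ha, hb⟩ := cell l h1 h2 t h0 ht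
    have hlt := sub_pos.mpr (lt' l h1 h2 k hk1 hk2)
    rw [hL l h1 h2 k hk1 hk2 y t ha hb, smul_add, smul_smul, smul_smul]
    refine aux_convex N hN _ _ _ _ (mul_nonneg (inv_nonneg.mpr hlt.le) (by linarith))
      (mul_nonneg (inv_nonneg.mpr hlt.le) (by linarith)) ?_ C (hC _ (by omega)) (hC _ hk2)
    field_simp
    ring
  -- interpolating a coarse interpolation on the finer grid changes nothing
  have LL : ∀ l, 1 ≤ l → l < n → ∀ y : ℝ → V, ∀ t, 0 ≤ t → t ≤ T →
      L (l + 1) (L l y) t = L l y t := by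
    intro l h1 h2 y t h0 ht
    have h3 : 1 ≤ l + 1 := by omega
    have h4 : l + 1 ≤ n := by omega
    obtain ⟨k, hk1, hk2, ha, hb⟩ := cell (l + 1) h3 h4 t h0 ht
    have hlt := lt' (l + 1) h3 h4 k hk1 hk2
    have hp0 := nonneg (l + 1) h3 h4 (k - 1) (by omega)
    have hqT := leT (l + 1) h3 h4 k hk2
    obtain ⟨j, hj1, hj2, hja, hjb⟩ := cell l h1 h2.le
      ((τ (l + 1) (k - 1) + τ (l + 1) k) / 2) (by linarith) (by linarith)
    have hlt2 := lt' l h1 h2.le j hj1 hj2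
    have A : τ l (j - 1) ≤ τ (l + 1) (k - 1) := by
      obtain ⟨i, hi, hie⟩ := hnested l h1 h2 (j - 1) (by omega)
      rw [← hie]
      by_cases hik : i ≤ k - 1
      · exact mono (l + 1) h3 h4 i (k - 1) hik (by omega)
      · have := mono (l + 1) h3 h4 k i (by omega) hi
        linarith
    have B : τ (l + 1) k ≤ τ l j := by
      obtain ⟨i, hi, hie⟩ := hnested l h1 h2 j hj2
      rw [← hie]
      by_cases hik : k ≤ i
      · exact mono (l + 1) h3 h4 k i hik hi
      · have := mono (l + 1) h3 h4 i (k - 1) (by omega) (by omega)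
        linarith
    rw [hL (l + 1) h3 h4 k hk1 hk2 _ t ha hb,
      hL l h1 h2.le j hj1 hj2 y t (A.trans ha) (hb.trans B),
      hL l h1 h2.le j hj1 hj2 y _ A (hlt.le.trans B),
      hL l h1 h2.le j hj1 hj2 y _ (A.trans hlt.le) B]
    have hne := (sub_pos.mpr hlt).ne'
    have hne2 := (sub_pos.mpr hlt2).ne'
    match_scalars <;> field_simp <;> ring
  refine iSup_le fun ⟨t, h0, ht⟩ => ?_
  show N (𝒴 t - Y 0 t) ≤ _
  have dec : 𝒴 t - Y 0 t = (L 1 (fun s => Y n s - Y 0 s) t + -(Y 0 t - L n (Y 0) t))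
      + ∑ l ∈ Finset.Icc 1 (n - 1), (L (l + 1) (fun s => (Y (n - l) s - Y 0 s)
          - L l (fun s => Y (n - l) s - Y 0 s) s) t) := by
    have e : ∑ l ∈ Finset.Icc 1 (n - 1), (L (l + 1) (fun s => (Y (n - l) s - Y 0 s)
          - L l (fun s => Y (n - l) s - Y 0 s) s) t)
        = ∑ l ∈ Finset.Icc 1 (n - 1), (L (l + 1) (Y (n - l)) t - L l (Y (n - l)) t)
          - ∑ l ∈ Finset.Icc 1 (n - 1), (L (l + 1) (Y 0) t - L l (Y 0) t) := by
      rw [← Finset.sum_sub_distrib]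
      refine Finset.sum_congr rfl fun l hl => ?_
      rw [Finset.mem_Icc] at hl
      rw [Lsub (l + 1) (by omega) (by omega) (fun s => Y (n - l) s - Y 0 s)
        (L l (fun s => Y (n - l) s - Y 0 s)) t h0 ht,
        LL l hl.1 (by omega) _ t h0 ht, Lsub (l + 1) (by omega) (by omega) _ _ t h0 ht,
        Lsub l (by omega) (by omega) _ _ t h0 ht]
      abel
    have tele := aux_tele (fun l => L l (Y 0) t) n hn
    rw [e, h𝒴, Lsub 1 le_rfl hn _ _ t h0 ht, ← tele]
    abel
  rw [dec]
  refine aux_sum N hN _ _ _ _ _ ((aux_add N hN _ _).trans (add_le_add ?_ ?_)) ?_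
  · refine bdd 1 le_rfl hn _ t h0 ht _ fun k hk => ?_
    exact le_iSup₂_of_le (f := fun k (_ : k ∈ Finset.range (m 1 + 1)) =>
      N (Y n (τ 1 k) - Y 0 (τ 1 k))) k (Finset.mem_range.mpr (by omega)) le_rfl
  · exact (aux_neg N hN _).trans (err n hn le_rfl (Y 0) t h0 ht)
  · intro l hl
    rw [Finset.mem_Icc] at hl
    refine bdd (l + 1) (by omega) (by omega) _ t h0 ht _ fun k hk => ?_
    exact err l hl.1 (by omega) (fun s => Y (n - l) s - Y 0 s) _
      (nonneg (l + 1) (by omega) (by omega) k hk) (leT (l + 1) (by omega) (by omega) k hk)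
end

section
/- Under the stochastic fixed-point equation (SFPE) setting with hypotheses (H1)–(H5), there exists a unique measurable function u : [0,T]×ℝ^d → ℝ which satisfies for all t ∈ [0,T], x ∈ ℝ^d that E[|g(X^x_{t,T})|] + ∫_t^T E[|f(r, X^x_{t,r}, u(r, X^x_{t,r}))|] dr + sup_{r∈[0,T], ξ∈ℝ^d} (|u(r,ξ)|/V(r,ξ)) < ∞ and u(t,x) = E[g(X^x_{t,T})] + ∫_t^T E[f(r, X^x_{t,r}, u(r, X^x_{t,r}))] dr. -/
open MeasureTheory
open scoped ENNReal

/-- Picard iteration in weighted sup norm, with pointwise limits. -/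
theorem aux_fixed {α : Type*} [MeasurableSpace α] (D : Set α) (W : α → ℝ)
    (hW : ∀ p ∈ D, 0 ≤ W p) (Φ : (α → ℝ) → (α → ℝ))
    (hΦM : ∀ v : α → ℝ, Measurable v → (∃ C : ℝ, ∀ p ∈ D, |v p| ≤ C * W p) →
      Measurable (Φ v) ∧ ∃ C : ℝ, ∀ p ∈ D, |Φ v p| ≤ C * W p)
    (hΦ0 : ∀ v, ∀ p, p ∉ D → Φ v p = 0)
    (hΦL : ∀ v w : α → ℝ, Measurable v → Measurable w →
      (∃ C : ℝ, ∀ p ∈ D, |v p| ≤ C * W p) → (∃ C : ℝ, ∀ p ∈ D, |w p| ≤ C * W p) →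
      ∀ N : ℝ, 0 ≤ N → (∀ p ∈ D, |v p - w p| ≤ N * W p) →
        ∀ p ∈ D, |Φ v p - Φ w p| ≤ N / 2 * W p) :
    ∃ u : α → ℝ, (Measurable u ∧ (∃ C : ℝ, ∀ p ∈ D, |u p| ≤ C * W p) ∧
      ∀ p ∈ D, u p = Φ u p) ∧
      ∀ v : α → ℝ, Measurable v → (∃ C : ℝ, ∀ p ∈ D, |v p| ≤ C * W p) →
        (∀ p ∈ D, v p = Φ v p) → ∀ p ∈ D, v p = u p := by
  let U : ℕ → α → ℝ := fun n => Φ^[n] (fun _ => 0)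
  have hUs : ∀ n, U (n+1) = Φ (U n) := fun n => Function.iterate_succ_apply' Φ n _
  have hUM : ∀ n, Measurable (U n) ∧ ∃ C : ℝ, ∀ p ∈ D, |U n p| ≤ C * W p := by
    intro n
    induction n with
    | zero => exact ⟨measurable_const, 0, fun p hp => by simp [U]⟩
    | succ n ih => rw [hUs]; exact hΦM _ ih.1 ih.2
  obtain ⟨K, hK0, hK⟩ : ∃ K : ℝ, 0 ≤ K ∧ ∀ p ∈ D, |U 1 p - U 0 p| ≤ K * W p := by
    obtain ⟨C, hC⟩ := (hUM 1).2
    refine ⟨|C|, abs_nonneg _, fun p hp => ?_⟩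
    have : U 0 p = 0 := rfl
    rw [this, sub_zero]
    exact (hC p hp).trans (mul_le_mul_of_nonneg_right (le_abs_self C) (hW p hp))
  have hstep : ∀ n, ∀ p ∈ D, |U (n+1) p - U n p| ≤ K / 2 ^ n * W p := by
    intro n
    induction n with
    | zero => simpa using hK
    | succ n ih =>
      intro p hp
      have := hΦL _ _ (hUM (n+1)).1 (hUM n).1 (hUM (n+1)).2 (hUM n).2 _ (by positivity) ih p hp
      rw [hUs (n+1)]
      nth_rewrite 2 [hUs n]
      calc _ ≤ _ := this
        _ = _ := by rw [pow_succ]; field_simp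
  have hlim : ∀ p, ∃ l, Filter.Tendsto (fun n => U n p) Filter.atTop (nhds l) ∧
      (p ∈ D → ∀ n, |U n p - l| ≤ 2 * K * W p / 2 ^ n) := by
    intro p
    by_cases hp : p ∈ D
    · have hd : ∀ n, dist (U n p) (U (n+1) p) ≤ (2 * K * W p) / 2 / 2 ^ n := by
        intro n
        rw [dist_comm, Real.dist_eq]
        refine (hstep n p hp).trans (le_of_eq ?_)
        ring
      obtain ⟨l, hl⟩ := cauchySeq_tendsto_of_complete (cauchySeq_of_le_geometric_two hd)
      refine ⟨l, hl, fun _ n => ?_⟩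
      have := dist_le_of_le_geometric_two_of_tendsto hd hl n
      rwa [Real.dist_eq] at this
    · refine ⟨0, ?_, fun h => absurd h hp⟩
      have : (fun n => U n p) = fun _ => 0 := by
        funext n
        cases n with
        | zero => rfl
        | succ n => rw [hUs]; exact hΦ0 _ _ hp
      rw [this]; exact tendsto_const_nhds
  choose u hu hub using hlim
  have huM : Measurable u := measurable_of_tendsto_metrizable (fun n => (hUM n).1)
    (tendsto_pi_nhds.2 hu)
  have huB : ∃ C : ℝ, ∀ p ∈ D, |u p| ≤ C * W p := by
    refine ⟨2 * K, fun p hp => ?_⟩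
    have := hub p hp 0
    have h0 : U 0 p = 0 := rfl
    simpa [h0] using this
  refine ⟨u, ⟨huM, huB, ?_⟩, ?_⟩
  · intro p hp
    have h1 : Filter.Tendsto (fun n => U (n+1) p) Filter.atTop (nhds (u p)) :=
      (hu p).comp (Filter.tendsto_add_atTop_nat 1)
    have h2 : Filter.Tendsto (fun n => U (n+1) p) Filter.atTop (nhds (Φ u p)) := by
      rw [tendsto_iff_dist_tendsto_zero]
      have hz : Filter.Tendsto (fun n : ℕ => K * W p * (1/2 : ℝ) ^ n) Filter.atTop (nhds 0) := by
        simpa using (tendsto_pow_atTop_nhds_zero_of_lt_one (r := (1/2:ℝ)) (by norm_num)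
          (by norm_num)).const_mul (K * W p)
      refine squeeze_zero (fun _ => dist_nonneg) (fun n => ?_) hz
      rw [Real.dist_eq, hUs]
      have := hΦL _ _ (hUM n).1 huM (hUM n).2 huB (2 * K / 2 ^ n) (by positivity)
        (fun q hq => (hub q hq n).trans (le_of_eq (by ring))) p hp
      refine this.trans (le_of_eq ?_)
      rw [one_div, inv_pow]; ring
    exact tendsto_nhds_unique h1 h2
  · intro v hvM hvB hv p hp
    obtain ⟨C, hC⟩ := hvB
    obtain ⟨C', hC'⟩ := huB
    have hb : ∀ n : ℕ, ∀ q ∈ D, |v q - u q| ≤ (|C| + |C'|) / 2 ^ n * W q := by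
      intro n
      induction n with
      | zero =>
        intro q hq
        have a1 := hC q hq
        have a2 := hC' q hq
        have a3 := mul_le_mul_of_nonneg_right (le_abs_self C) (hW q hq)
        have a4 := mul_le_mul_of_nonneg_right (le_abs_self C') (hW q hq)
        have := abs_sub (v q) (u q)
        simp only [pow_zero, div_one]
        linarith
      | succ n ih =>
        intro q hq
        have := hΦL _ _ hvM huM ⟨C, hC⟩ ⟨C', hC'⟩ _ (by positivity) ih q hq
        have hfix : u q = Φ u q := by
          have h1 : Filter.Tendsto (fun n => U (n+1) q) Filter.atTop (nhds (u q)) :=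
            (hu q).comp (Filter.tendsto_add_atTop_nat 1)
          have h2 : Filter.Tendsto (fun n => U (n+1) q) Filter.atTop (nhds (Φ u q)) := by
            rw [tendsto_iff_dist_tendsto_zero]
            have hz : Filter.Tendsto (fun n : ℕ => K * W q * (1/2 : ℝ) ^ n)
                Filter.atTop (nhds 0) := by
              simpa using (tendsto_pow_atTop_nhds_zero_of_lt_one (r := (1/2:ℝ)) (by norm_num)
                (by norm_num)).const_mul (K * W q)
            refine squeeze_zero (fun _ => dist_nonneg) (fun n => ?_) hz
            rw [Real.dist_eq, hUs]
            have := hΦL _ _ (hUM n).1 huM (hUM n).2 ⟨C', hC'⟩ (2 * K / 2 ^ n) (by positivity)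
              (fun q hq => (hub q hq n).trans (le_of_eq (by ring))) q hq
            refine this.trans (le_of_eq ?_)
            rw [one_div, inv_pow]; ring
          exact tendsto_nhds_unique h1 h2
        rw [hv q hq, hfix]
        refine this.trans (le_of_eq ?_)
        rw [pow_succ]; field_simp
    have hz : Filter.Tendsto (fun n : ℕ => (|C| + |C'|) / 2 ^ n * W p) Filter.atTop (nhds 0) := by
      have := (tendsto_pow_atTop_nhds_zero_of_lt_one (r := (1/2:ℝ)) (by norm_num)
          (by norm_num)).const_mul ((|C| + |C'|) * W p)
      rw [mul_zero] at this
      refine this.congr fun n => ?_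
      rw [one_div, inv_pow]; ring
    have := ge_of_tendsto' hz (fun n => hb n p hp)
    exact sub_eq_zero.1 (abs_nonpos_iff.1 this)

theorem aux_bound {Ω E : Type*} [MeasurableSpace Ω] [MeasurableSpace E] (P : Measure Ω)
    (V h : E → ℝ) (Y : Ω → E) (B C : ℝ) (hY : Measurable Y) (hh : Measurable h)
    (hVY : ∫⁻ ω, ENNReal.ofReal (V (Y ω)) ∂P ≤ ENNReal.ofReal B) (hB : 0 ≤ B) (hC : 0 ≤ C)
    (hb : ∀ ξ, |h ξ| ≤ C * V ξ) :
    Integrable (fun ω => h (Y ω)) P ∧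
      (∫⁻ ω, ENNReal.ofReal |h (Y ω)| ∂P) ≤ ENNReal.ofReal (C * B) ∧
      |∫ ω, h (Y ω) ∂P| ≤ C * B := by
  have h1 : (∫⁻ ω, ENNReal.ofReal |h (Y ω)| ∂P) ≤ ENNReal.ofReal (C * B) := by
    calc (∫⁻ ω, ENNReal.ofReal |h (Y ω)| ∂P)
        ≤ ∫⁻ ω, ENNReal.ofReal C * ENNReal.ofReal (V (Y ω)) ∂P := by
          refine lintegral_mono fun ω => ?_
          rw [← ENNReal.ofReal_mul hC]
          exact ENNReal.ofReal_le_ofReal (hb _)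
      _ = ENNReal.ofReal C * ∫⁻ ω, ENNReal.ofReal (V (Y ω)) ∂P :=
          lintegral_const_mul' _ _ ENNReal.ofReal_ne_top
      _ ≤ ENNReal.ofReal C * ENNReal.ofReal B := by gcongr
      _ = _ := (ENNReal.ofReal_mul hC).symm
  refine ⟨⟨(hh.comp hY).aestronglyMeasurable, ?_⟩, h1, ?_⟩
  · rw [hasFiniteIntegral_iff_norm]
    exact lt_of_le_of_lt h1 ENNReal.ofReal_lt_top
  · have := norm_integral_le_lintegral_norm (μ := P) (fun ω => h (Y ω))
    refine this.trans ?_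
    exact ENNReal.toReal_le_of_le_ofReal (by positivity) h1

theorem aux_core {Ω E : Type*} [MeasurableSpace Ω] [MeasurableSpace E]
    (P : Measure Ω)
    (L T : ℝ) (hL : 0 ≤ L) (hT : 0 < T)
    (f : ℝ → E → ℝ → ℝ)
    (hf_meas : Measurable fun p : ℝ × E × ℝ => f p.1 p.2.1 p.2.2)
    (g : E → ℝ) (hg_meas : Measurable g)
    (V : ℝ → E → ℝ)
    (hV1 : ∀ t ∈ Set.Icc (0:ℝ) T, ∀ x, 1 ≤ V t x)
    (X : ℝ → ℝ → E → Ω → E)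
    (hX : ∀ s t, 0 ≤ s → s ≤ t → t ≤ T → ∀ x, Measurable (X s t x))
    (hjoint : ∀ h : ℝ × E → ℝ≥0∞, Measurable h →
      Measurable fun q : {p : ℝ × ℝ // 0 ≤ p.1 ∧ p.1 ≤ p.2 ∧ p.2 ≤ T} × E =>
        ∫⁻ ω, h ((q.1 : ℝ × ℝ).2, X (q.1 : ℝ × ℝ).1 (q.1 : ℝ × ℝ).2 q.2 ω) ∂P)
    (hVX : ∀ s t, 0 ≤ s → s ≤ t → t ≤ T → ∀ x,
      ∫⁻ ω, ENNReal.ofReal (V t (X s t x ω)) ∂P ≤ ENNReal.ofReal (V s x))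
    (hg : ∀ x, |g x| ≤ V T x)
    (hf0 : ∀ t ∈ Set.Icc (0:ℝ) T, ∀ x, |f t x 0| ≤ T⁻¹ * V t x)
    (hfL : ∀ t ∈ Set.Icc (0:ℝ) T, ∀ x v w, |f t x v - f t x w| ≤ L * |v - w|) :
    ∃ u : ℝ → E → ℝ,
      ((Measurable fun p : ℝ × E => u p.1 p.2) ∧
        (∃ C : ℝ, ∀ r ∈ Set.Icc (0:ℝ) T, ∀ ξ, |u r ξ| ≤ C * V r ξ) ∧
        (∀ t ∈ Set.Icc (0:ℝ) T, ∀ x,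
          (∫⁻ ω, ENNReal.ofReal |g (X t T x ω)| ∂P) ≠ ⊤ ∧
          (∫⁻ r in Set.Ioc t T,
            ∫⁻ ω, ENNReal.ofReal |f r (X t r x ω) (u r (X t r x ω))| ∂P) ≠ ⊤ ∧
          u t x = (∫ ω, g (X t T x ω) ∂P)
            + ∫ r in t..T, ∫ ω, f r (X t r x ω) (u r (X t r x ω)) ∂P)) ∧
      (∀ v : ℝ → E → ℝ,
        ((Measurable fun p : ℝ × E => v p.1 p.2) ∧
          (∃ C : ℝ, ∀ r ∈ Set.Icc (0:ℝ) T, ∀ ξ, |v r ξ| ≤ C * V r ξ) ∧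
          (∀ t ∈ Set.Icc (0:ℝ) T, ∀ x,
            (∫⁻ ω, ENNReal.ofReal |g (X t T x ω)| ∂P) ≠ ⊤ ∧
            (∫⁻ r in Set.Ioc t T,
              ∫⁻ ω, ENNReal.ofReal |f r (X t r x ω) (v r (X t r x ω))| ∂P) ≠ ⊤ ∧
            v t x = (∫ ω, g (X t T x ω) ∂P)
              + ∫ r in t..T, ∫ ω, f r (X t r x ω) (v r (X t r x ω)) ∂P)) →
        ∀ t ∈ Set.Icc (0:ℝ) T, ∀ x, v t x = u t x) := by
  classical
  have hV0 : ∀ t ∈ Set.Icc (0:ℝ) T, ∀ x, 0 ≤ V t x := fun t ht x =>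
    zero_le_one.trans (hV1 t ht x)
  -- bounds for expectations
  have I1 : ∀ (h : ℝ × E → ℝ), Measurable h → ∀ t r, 0 ≤ t → t ≤ r → r ≤ T → ∀ x, ∀ C, 0 ≤ C →
      (∀ ξ, |h (r, ξ)| ≤ C * V r ξ) →
      Integrable (fun ω => h (r, X t r x ω)) P ∧
      (∫⁻ ω, ENNReal.ofReal |h (r, X t r x ω)| ∂P) ≤ ENNReal.ofReal (C * V t x) ∧
      |∫ ω, h (r, X t r x ω) ∂P| ≤ C * V t x := by
    intro h hh t r ht htr hr x C hC hb
    exact aux_bound P (V r) (fun ξ => h (r, ξ)) (X t r x) (V t x) C (hX t r ht htr hr x)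
      (hh.comp measurable_prodMk_left) (hVX t r ht htr hr x)
      (hV0 t ⟨ht, htr.trans hr⟩ x) hC hb
  -- joint measurability of expectations
  have I2 : ∀ (h : ℝ × E → ℝ), Measurable h → ∀ C, 0 ≤ C →
      (∀ r ∈ Set.Icc (0:ℝ) T, ∀ ξ, |h (r, ξ)| ≤ C * V r ξ) →
      Measurable (fun q : (ℝ × ℝ) × E => if 0 ≤ q.1.1 ∧ q.1.1 ≤ q.1.2 ∧ q.1.2 ≤ T then
        ∫ ω, h (q.1.2, X q.1.1 q.1.2 q.2 ω) ∂P else 0) := by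
    intro h hh C hC hb
    let S : Set ((ℝ × ℝ) × E) := {q | 0 ≤ q.1.1 ∧ q.1.1 ≤ q.1.2 ∧ q.1.2 ≤ T}
    have hS : MeasurableSet S := by
      have m1 : Measurable (fun q : (ℝ × ℝ) × E => q.1.1) := by fun_prop
      have m2 : Measurable (fun q : (ℝ × ℝ) × E => q.1.2) := by fun_prop
      exact (measurableSet_le measurable_const m1).inter
        ((measurableSet_le m1 m2).inter (measurableSet_le m2 measurable_const))
    have hpos := (hjoint (fun p => ENNReal.ofReal (h p)) hh.ennreal_ofReal).ennreal_toReal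
    have hneg := (hjoint (fun p => ENNReal.ofReal (-h p)) hh.neg.ennreal_ofReal).ennreal_toReal
    have hm := hpos.sub hneg
    let e : S → {p : ℝ × ℝ // 0 ≤ p.1 ∧ p.1 ≤ p.2 ∧ p.2 ≤ T} × E :=
      fun q => (⟨q.1.1, q.2⟩, q.1.2)
    have he : Measurable e :=
      ((measurable_fst.comp measurable_subtype_coe).subtype_mk).prodMk
        (measurable_snd.comp measurable_subtype_coe)
    have h0 : Measurable (fun _ : (Sᶜ : Set _) => (0:ℝ)) := measurable_const
    have := (hm.comp he).dite h0 hS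
    convert this using 2 with q
    by_cases hq : q ∈ S
    · have hq' : 0 ≤ q.1.1 ∧ q.1.1 ≤ q.1.2 ∧ q.1.2 ≤ T := hq
      rw [if_pos hq', dif_pos hq]
      exact integral_eq_lintegral_pos_part_sub_lintegral_neg_part
        (I1 h hh _ _ hq'.1 hq'.2.1 hq'.2.2 q.2 C hC (hb _ ⟨hq'.1.trans hq'.2.1, hq'.2.2⟩)).1
    · have hq' : ¬ (0 ≤ q.1.1 ∧ q.1.1 ≤ q.1.2 ∧ q.1.2 ≤ T) := hq
      rw [if_neg hq', dif_neg hq]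
  -- the nonlinearity
  let F : (ℝ × E → ℝ) → ℝ × E → ℝ := fun v p => f p.1 p.2 (v p)
  have hF : ∀ v, Measurable v → Measurable (F v) := fun v hv =>
    hf_meas.comp (measurable_fst.prodMk (measurable_snd.prodMk hv))
  have hFb : ∀ v : ℝ × E → ℝ, ∀ C, (∀ r ∈ Set.Icc (0:ℝ) T, ∀ ξ, |v (r, ξ)| ≤ C * V r ξ) →
      ∀ r ∈ Set.Icc (0:ℝ) T, ∀ ξ, |F v (r, ξ)| ≤ (L * C + T⁻¹) * V r ξ := by
    intro v C hv r hr ξ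
    have a1 := hfL r hr ξ (v (r, ξ)) 0
    have a2 := hf0 r hr ξ
    have a3 := mul_le_mul_of_nonneg_left (hv r hr ξ) hL
    have a4 : |f r ξ (v (r, ξ))| ≤ |f r ξ (v (r, ξ)) - f r ξ 0| + |f r ξ 0| := by
      simpa using abs_add_le (f r ξ (v (r, ξ)) - f r ξ 0) (f r ξ 0)
    rw [sub_zero] at a1
    change |f r ξ (v (r, ξ))| ≤ _
    nlinarith
  have I3 : ∀ v : ℝ × E → ℝ, Measurable v → ∀ C, 0 ≤ C →
      (∀ r ∈ Set.Icc (0:ℝ) T, ∀ ξ, |v (r, ξ)| ≤ C * V r ξ) → ∀ t ∈ Set.Icc (0:ℝ) T, ∀ x,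
      IntegrableOn (fun r => ∫ ω, F v (r, X t r x ω) ∂P) (Set.Ioc t T) := by
    intro v hv C hC hb t ht x
    have hC' : 0 ≤ L * C + T⁻¹ := by positivity
    have hm := (I2 (F v) (hF v hv) _ hC' (hFb v C hb)).comp
      (show Measurable (fun r : ℝ => ((t, r), x)) by fun_prop)
    have : IntegrableOn (fun r => if 0 ≤ t ∧ t ≤ r ∧ r ≤ T then
        ∫ ω, F v (r, X t r x ω) ∂P else 0) (Set.Ioc t T) := by
      refine Measure.integrableOn_of_bounded (by simp) hm.aestronglyMeasurable
        (M := (L * C + T⁻¹) * V t x) ?_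
      refine (ae_restrict_iff' measurableSet_Ioc).2 (Filter.Eventually.of_forall fun r hr => ?_)
      rw [if_pos ⟨ht.1, hr.1.le, hr.2⟩]
      exact (I1 (F v) (hF v hv) t r ht.1 hr.1.le hr.2 x _ hC'
        (hFb v C hb r ⟨ht.1.trans hr.1.le, hr.2⟩)).2.2
    refine this.congr_fun (fun r hr => ?_) measurableSet_Ioc
    exact if_pos ⟨ht.1, hr.1.le, hr.2⟩
  -- the operator
  let D : Set (ℝ × E) := {p | p.1 ∈ Set.Icc (0:ℝ) T}
  let Φ : (ℝ × E → ℝ) → ℝ × E → ℝ := fun v p => if p ∈ D then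
    (∫ ω, g (X p.1 T p.2 ω) ∂P) + ∫ r in p.1..T, ∫ ω, F v (r, X p.1 r p.2 ω) ∂P else 0
  have hD : MeasurableSet D := measurable_fst measurableSet_Icc
  have hΦD : ∀ v, ∀ p ∈ D, Φ v p = (∫ ω, g (X p.1 T p.2 ω) ∂P) +
      ∫ r in Set.Ioc p.1 T, ∫ ω, F v (r, X p.1 r p.2 ω) ∂P := by
    intro v p hp
    simp only [Φ]
    rw [if_pos hp, intervalIntegral.integral_of_le hp.2]
  let lam : ℝ := 2 * L + 1
  have hlam : 0 < lam := by positivity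
  let W : ℝ × E → ℝ := fun p => Real.exp (lam * (T - p.1)) * V p.1 p.2
  have hW0 : ∀ p ∈ D, 0 ≤ W p := fun p hp => mul_nonneg (Real.exp_pos _).le (hV0 _ hp _)
  have toV : ∀ v : ℝ × E → ℝ, (∃ C : ℝ, ∀ p ∈ D, |v p| ≤ C * W p) →
      ∃ C : ℝ, 0 ≤ C ∧ ∀ r ∈ Set.Icc (0:ℝ) T, ∀ ξ, |v (r, ξ)| ≤ C * V r ξ := by
    rintro v ⟨C, hC⟩
    refine ⟨|C| * Real.exp (lam * T), by positivity, fun r hr ξ => ?_⟩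
    have h1 := hC (r, ξ) hr
    have h2 := mul_le_mul_of_nonneg_right (le_abs_self C) (hW0 (r, ξ) hr)
    refine h1.trans (h2.trans ?_)
    rw [mul_assoc]
    refine mul_le_mul_of_nonneg_left ?_ (abs_nonneg _)
    refine mul_le_mul_of_nonneg_right ?_ (hV0 r hr ξ)
    refine Real.exp_le_exp.2 (mul_le_mul_of_nonneg_left ?_ hlam.le)
    have := hr.1
    change T - r ≤ T
    linarith
  have toW : ∀ v : ℝ × E → ℝ, (∃ C : ℝ, ∀ r ∈ Set.Icc (0:ℝ) T, ∀ ξ, |v (r, ξ)| ≤ C * V r ξ) →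
      ∃ C : ℝ, ∀ p ∈ D, |v p| ≤ C * W p := by
    rintro v ⟨C, hC⟩
    refine ⟨|C|, fun p hp => ?_⟩
    have h1 := hC p.1 hp p.2
    have h2 := mul_le_mul_of_nonneg_right (le_abs_self C) (hV0 p.1 hp p.2)
    refine h1.trans (h2.trans ?_)
    refine mul_le_mul_of_nonneg_left ?_ (abs_nonneg _)
    refine le_mul_of_one_le_left (hV0 p.1 hp p.2) (Real.one_le_exp ?_)
    exact mul_nonneg hlam.le (sub_nonneg.2 hp.2)
  have hgI : ∀ t ∈ Set.Icc (0:ℝ) T, ∀ x,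
      Integrable (fun ω => g (X t T x ω)) P ∧
      (∫⁻ ω, ENNReal.ofReal |g (X t T x ω)| ∂P) ≤ ENNReal.ofReal (1 * V t x) ∧
      |∫ ω, g (X t T x ω) ∂P| ≤ 1 * V t x := by
    intro t ht x
    exact aux_bound P (V T) g (X t T x) (V t x) 1 (hX t T ht.1 ht.2 le_rfl x)
      hg_meas (hVX t T ht.1 ht.2 le_rfl x) (hV0 t ht x) zero_le_one
      (fun ξ => by simpa using hg ξ)
  have hΦmeas : ∀ v : ℝ × E → ℝ, Measurable v → (∃ C : ℝ, ∀ p ∈ D, |v p| ≤ C * W p) →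
      Measurable (Φ v) := by
    intro v hv hvb
    obtain ⟨C, hC, hb⟩ := toV v hvb
    have hC' : 0 ≤ L * C + T⁻¹ := by positivity
    have hm := I2 (F v) (hF v hv) _ hC' (hFb v C hb)
    -- the terminal part
    let G : ℝ × E → ℝ := fun p => if p.1 = T then g p.2 else 0
    have hGm : Measurable G := Measurable.ite (measurable_fst (measurableSet_singleton T))
      (hg_meas.comp measurable_snd) measurable_const
    have hGb : ∀ r ∈ Set.Icc (0:ℝ) T, ∀ ξ, |G (r, ξ)| ≤ 1 * V r ξ := by
      intro r hr ξ
      by_cases h : r = T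
      · subst h; simpa [G] using hg ξ
      · simpa [G, h] using hV0 r hr ξ
    have hmG := (I2 G hGm 1 zero_le_one hGb).comp
      (show Measurable (fun p : ℝ × E => ((p.1, T), p.2)) by fun_prop)
    -- the integral part
    let H : ℝ × E → ℝ → ℝ := fun p r => if p.1 < r then
      (if 0 ≤ p.1 ∧ p.1 ≤ r ∧ r ≤ T then ∫ ω, F v (r, X p.1 r p.2 ω) ∂P else 0) else 0
    have hH : Measurable (Function.uncurry H) := by
      refine Measurable.ite (measurableSet_lt (by fun_prop) (by fun_prop)) ?_ measurable_const
      exact hm.comp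
        (show Measurable (fun q : (ℝ × E) × ℝ => ((q.1.1, q.2), q.1.2)) by fun_prop)
    have hHi : Measurable (fun p => ∫ r, H p r) :=
      (StronglyMeasurable.integral_prod_right hH.stronglyMeasurable).measurable
    have : Φ v = fun p => if p ∈ D then ((fun q : (ℝ × ℝ) × E =>
        if 0 ≤ q.1.1 ∧ q.1.1 ≤ q.1.2 ∧ q.1.2 ≤ T then
        ∫ ω, G (q.1.2, X q.1.1 q.1.2 q.2 ω) ∂P else 0) ∘ fun p : ℝ × E => ((p.1, T), p.2)) p
        + ∫ r, H p r else 0 := by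
      funext p
      by_cases hp : p ∈ D
      · rw [hΦD v p hp, if_pos hp]
        have hp' : 0 ≤ p.1 ∧ p.1 ≤ T ∧ T ≤ T := ⟨hp.1, hp.2, le_rfl⟩
        congr 1
        · simp only [Function.comp, if_pos hp', G, if_true]
        · rw [← integral_indicator measurableSet_Ioc]
          congr 1
          funext r
          by_cases hr : r ∈ Set.Ioc p.1 T
          · have h1 : p.1 < r := hr.1
            have h2 : 0 ≤ p.1 ∧ p.1 ≤ r ∧ r ≤ T := ⟨hp.1, hr.1.le, hr.2⟩
            simp only [Set.indicator_of_mem hr, H, if_pos h1, if_pos h2]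
          · rw [Set.indicator_of_notMem hr]
            simp only [H]
            split_ifs with h1 h2
            · exact absurd ⟨h1, h2.2.2⟩ hr
            · rfl
            · rfl
      · rw [if_neg hp]; exact if_neg hp
    rw [this]
    exact Measurable.ite hD (hmG.add hHi) measurable_const
  obtain ⟨u, ⟨huM, huB, huF⟩, hun⟩ := aux_fixed D W hW0 Φ
    (by
        intro v hv hvb
        refine ⟨hΦmeas v hv hvb, toW _ ?_⟩
        obtain ⟨C, hC, hb⟩ := toV v hvb
        have hC' : 0 ≤ L * C + T⁻¹ := by positivity
        refine ⟨1 + (L * C + T⁻¹) * T, fun t ht x => ?_⟩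
        rw [hΦD v (t, x) ht]
        have h1 := (hgI t ht x).2.2
        have h2 := norm_setIntegral_le_of_norm_le_const (μ := volume) (s := Set.Ioc t T)
          (f := fun r => ∫ ω, F v (r, X t r x ω) ∂P) (C := (L * C + T⁻¹) * V t x) (by simp)
          (fun r hr => (I1 (F v) (hF v hv) t r ht.1 hr.1.le hr.2 x _ hC'
                (hFb v C hb r ⟨ht.1.trans hr.1.le, hr.2⟩)).2.2)
        rw [Real.volume_real_Ioc_of_le ht.2, Real.norm_eq_abs] at h2
        refine (abs_add_le _ _).trans ((add_le_add h1 h2).trans ?_)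
        have h3 : (L * C + T⁻¹) * V t x * (T - t) ≤ (L * C + T⁻¹) * V t x * T :=
          mul_le_mul_of_nonneg_left (by linarith [ht.1]) (mul_nonneg hC' (hV0 t ht x))
        linarith)
    (by
        intro v p hp
        exact if_neg hp)
    (by
        intro v w hv hw hvb hwb N hN hvw p hp
        obtain ⟨t, x⟩ := p
        obtain ⟨C, hC, hb⟩ := toV v hvb
        obtain ⟨C', hC', hb'⟩ := toV w hwb
        have ht : t ∈ Set.Icc (0:ℝ) T := hp
        rw [hΦD v _ hp, hΦD w _ hp, add_sub_add_left_eq_sub]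
        rw [← integral_sub (I3 v hv C hC hb t ht x) (I3 w hw C' hC' hb' t ht x)]
        have key : ∀ r ∈ Set.Ioc t T, ‖(∫ ω, F v (r, X t r x ω) ∂P) - ∫ ω, F w (r, X t r x ω) ∂P‖
            ≤ L * N * V t x * Real.exp (lam * (T - r)) := by
          intro r hr
          have hr' : r ∈ Set.Icc (0:ℝ) T := ⟨ht.1.trans hr.1.le, hr.2⟩
          have i1 := (I1 (F v) (hF v hv) t r ht.1 hr.1.le hr.2 x (L * C + T⁻¹) (by positivity)
                (hFb v C hb r hr')).1
          have i2 := (I1 (F w) (hF w hw) t r ht.1 hr.1.le hr.2 x (L * C' + T⁻¹) (by positivity)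
                (hFb w C' hb' r hr')).1
          rw [← integral_sub i1 i2, Real.norm_eq_abs]
          have := (I1 (fun p => F v p - F w p) ((hF v hv).sub (hF w hw)) t r ht.1 hr.1.le hr.2 x
            (L * N * Real.exp (lam * (T - r))) (by positivity) (fun ξ => ?_)).2.2
          · refine this.trans (le_of_eq (by ring))
          · refine (hfL r hr' ξ _ _).trans ?_
            have := mul_le_mul_of_nonneg_left (hvw (r, ξ) hr') hL
            refine this.trans (le_of_eq ?_)
            simp only [W]; ring
        have hint : ∫ r in Set.Ioc t T, L * N * V t x * Real.exp (lam * (T - r)) =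
            L * N * V t x * ((Real.exp (lam * (T - t)) - 1) / lam) := by
          rw [← intervalIntegral.integral_of_le ht.2, intervalIntegral.integral_const_mul]
          congr 1
          have hd : ∀ r ∈ Set.uIcc t T, HasDerivAt (fun r => -(Real.exp (lam * (T - r)) / lam))
              (Real.exp (lam * (T - r))) r := by
            intro r _
            have h1 : HasDerivAt (fun r => lam * (T - r)) (lam * (-1)) r :=
              ((hasDerivAt_id r).const_sub T).const_mul lam
            have h2 := (h1.exp.div_const lam).neg
            have h3 : -(Real.exp (lam * (T - r)) * (lam * (-1)) / lam) = Real.exp (lam * (T - r)) := by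
              field_simp
            rw [h3] at h2
            exact h2
          rw [intervalIntegral.integral_eq_sub_of_hasDerivAt hd
            (Continuous.intervalIntegrable (by fun_prop) _ _)]
          simp
          ring
        have hbd := norm_integral_le_of_norm_le (μ := volume.restrict (Set.Ioc t T))
          (f := fun r => (∫ ω, F v (r, X t r x ω) ∂P) - ∫ ω, F w (r, X t r x ω) ∂P)
          (g := fun r => L * N * V t x * Real.exp (lam * (T - r)))
          ((Continuous.integrableOn_Icc (by fun_prop)).mono_set Set.Ioc_subset_Icc_self)
          ((ae_restrict_iff' measurableSet_Ioc).2 (Filter.Eventually.of_forall key))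
        rw [hint, Real.norm_eq_abs] at hbd
        refine hbd.trans ?_
        have hL2 : L / lam ≤ 1 / 2 := by
          rw [div_le_div_iff₀ hlam two_pos]; simp only [lam]; linarith
        have hNV : 0 ≤ N * V t x := mul_nonneg hN (hV0 t ht x)
        calc L * N * V t x * ((Real.exp (lam * (T - t)) - 1) / lam)
            = (L / lam) * (N * V t x * (Real.exp (lam * (T - t)) - 1)) := by ring
          _ ≤ (1 / 2) * (N * V t x * (Real.exp (lam * (T - t)) - 1)) := by
              refine mul_le_mul_of_nonneg_right hL2 (mul_nonneg hNV ?_)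
              exact sub_nonneg.2 (Real.one_le_exp (mul_nonneg hlam.le (sub_nonneg.2 ht.2)))
          _ ≤ (1 / 2) * (N * V t x * Real.exp (lam * (T - t))) := by
              gcongr; linarith
          _ = N / 2 * W (t, x) := by simp only [W]; ring)
  refine ⟨fun t x => u (t, x), ⟨huM, ?_, ?_⟩, ?_⟩
  · obtain ⟨C, _, hC⟩ := toV u huB
    exact ⟨C, hC⟩
  · intro t ht x
    obtain ⟨C, hC, hb⟩ := toV u huB
    have hC' : 0 ≤ L * C + T⁻¹ := by positivity
    refine ⟨ne_top_of_le_ne_top ENNReal.ofReal_ne_top (hgI t ht x).2.1, ?_, ?_⟩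
    · have : (∫⁻ r in Set.Ioc t T,
          ∫⁻ ω, ENNReal.ofReal |f r (X t r x ω) (u (r, (X t r x ω)))| ∂P) ≤
          ∫⁻ r in Set.Ioc t T, ENNReal.ofReal ((L * C + T⁻¹) * V t x) := by
        refine setLIntegral_mono measurable_const fun r hr => ?_
        exact (I1 (F u) (hF u huM) t r ht.1 hr.1.le hr.2 x _ hC'
          (hFb u C hb r ⟨ht.1.trans hr.1.le, hr.2⟩)).2.1
      refine ne_top_of_le_ne_top ?_ this
      rw [setLIntegral_const]
      exact ENNReal.mul_ne_top ENNReal.ofReal_ne_top (by simp)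
    · exact (huF (t, x) ht).trans (if_pos ht)
  · rintro v ⟨hvM, hvB, hv⟩ t ht x
    refine hun (fun p => v p.1 p.2) hvM (toW _ hvB) ?_ (t, x) ht
    intro p hp
    exact (hv p.1 hp p.2).2.2.trans (if_pos hp).symm

/-- Existence and uniqueness of solutions of stochastic fixed-point equations (SFPEs):
under the SFPE setting with hypotheses (H1)–(H5), there exists a unique measurable
`u : [0,T]×ℝ^d → ℝ` with at most `V`-growth satisfying the integrability conditions and
`u(t,x) = E[g(X^x_{t,T})] + ∫_t^T E[f(r, X^x_{t,r}, u(r, X^x_{t,r}))] dr`. -/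
theorem stmt_4
    {Ω : Type*} [MeasurableSpace Ω] (P : Measure Ω) [IsProbabilityMeasure P]
    (d : ℕ) (L T : ℝ) (hL : 0 ≤ L) (hT : 0 < T)
    (p₁ p₂ p₃ : ℝ≥0∞) (hp₁ : 1 ≤ p₁) (hp₂ : 1 ≤ p₂) (hp₃ : 1 ≤ p₃)
    (hp : 1 / p₁ + 1 / p₂ + 1 / p₃ ≤ 1)
    (nrm : (Fin d → ℝ) → ℝ)
    (hnrm_tri : ∀ x y, nrm (x + y) ≤ nrm x + nrm y)
    (hnrm_smul : ∀ (a : ℝ) x, nrm (a • x) = |a| * nrm x)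
    (hnrm_def : ∀ x, nrm x = 0 → x = 0)
    (f : ℝ → (Fin d → ℝ) → ℝ → ℝ)
    (hf_meas : Measurable fun p : ℝ × (Fin d → ℝ) × ℝ => f p.1 p.2.1 p.2.2)
    (g : (Fin d → ℝ) → ℝ) (hg_meas : Measurable g)
    (φ V ψ : ℝ → (Fin d → ℝ) → ℝ)
    (hφ_meas : Measurable fun p : ℝ × (Fin d → ℝ) => φ p.1 p.2)
    (hV_meas : Measurable fun p : ℝ × (Fin d → ℝ) => V p.1 p.2)
    (hψ_meas : Measurable fun p : ℝ × (Fin d → ℝ) => ψ p.1 p.2)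
    (hφ1 : ∀ t ∈ Set.Icc (0:ℝ) T, ∀ x, 1 ≤ φ t x)
    (hV1 : ∀ t ∈ Set.Icc (0:ℝ) T, ∀ x, 1 ≤ V t x)
    (hψ1 : ∀ t ∈ Set.Icc (0:ℝ) T, ∀ x, 1 ≤ ψ t x)
    (X : ℝ → ℝ → (Fin d → ℝ) → Ω → (Fin d → ℝ))
    (hX_meas : ∀ s ∈ Set.Icc (0:ℝ) T, ∀ x,
      Measurable fun p : Set.Icc s T × Ω => X s (p.1 : ℝ) x p.2)
    (hjoint : ∀ h : ℝ → (Fin d → ℝ) → (Fin d → ℝ) → ℝ≥0∞,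
      (Measurable fun p : ℝ × (Fin d → ℝ) × (Fin d → ℝ) => h p.1 p.2.1 p.2.2) →
      Measurable fun q : {p : ℝ × ℝ // 0 ≤ p.1 ∧ p.1 ≤ p.2 ∧ p.2 ≤ T}
          × (Fin d → ℝ) × (Fin d → ℝ) =>
        ∫⁻ ω, h (q.1 : ℝ × ℝ).2 (X (q.1 : ℝ × ℝ).1 (q.1 : ℝ × ℝ).2 q.2.1 ω)
          (X (q.1 : ℝ × ℝ).1 (q.1 : ℝ × ℝ).2 q.2.2 ω) ∂P)
    -- (H1)
    (hH1 : ∀ s t : ℝ, 0 ≤ s → s ≤ t → t ≤ T → ∀ x,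
      (if s = T then |g x| else 0) ≤ V s x ∧
      |T * f s x 0| ≤ V s x ∧
      eLpNorm (fun ω => V t (X s t x ω)) p₁ P ≤ ENNReal.ofReal (V s x) ∧
      eLpNorm (fun ω => φ t (X s t x ω)) p₃ P ≤ ENNReal.ofReal (φ s x))
    -- (H2)
    (hH2 : ∀ x y, |g x - g y| ≤ (2 * Real.sqrt T)⁻¹ * (V T x + V T y) * nrm (x - y))
    -- (H3)
    (hH3 : ∀ t ∈ Set.Icc (0:ℝ) T, ∀ x y v w,
      |f t x v - f t y w| ≤ L * |v - w|
        + (2 * T ^ ((3:ℝ)/2))⁻¹ * (V t x + V t y) * nrm (x - y))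
    -- (H4)
    (hH4 : ∀ s t : ℝ, 0 ≤ s → s ≤ t → t ≤ T → ∀ x y,
      eLpNorm (fun ω => nrm (X s t x ω - x)) p₂ P
        ≤ ENNReal.ofReal (ψ s x * |s - t| ^ ((1:ℝ)/2)) ∧
      eLpNorm (fun ω => nrm (X s t x ω - X s t y ω)) p₂ P
        ≤ ENNReal.ofReal (2⁻¹ * (φ s x + φ s y) * nrm (x - y)))
    -- (H5)
    (hH5 : ∀ h : ℝ → (Fin d → ℝ) → (Fin d → ℝ) → ℝ≥0∞,
      (Measurable fun p : ℝ × (Fin d → ℝ) × (Fin d → ℝ) => h p.1 p.2.1 p.2.2) →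
      ∀ s t r : ℝ, 0 ≤ s → s ≤ t → t ≤ r → r ≤ T → ∀ x y,
        ∫⁻ ω, (∫⁻ ω', h r (X t r (X s t x ω) ω') (X t r (X s t y ω) ω') ∂P) ∂P
          = ∫⁻ ω, h r (X s r x ω) (X s r y ω) ∂P) :
    ∃ u : ℝ → (Fin d → ℝ) → ℝ,
      ((Measurable fun p : ℝ × (Fin d → ℝ) => u p.1 p.2) ∧
        (∃ C : ℝ, ∀ r ∈ Set.Icc (0:ℝ) T, ∀ ξ, |u r ξ| ≤ C * V r ξ) ∧
        (∀ t ∈ Set.Icc (0:ℝ) T, ∀ x,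
          (∫⁻ ω, ENNReal.ofReal |g (X t T x ω)| ∂P) ≠ ⊤ ∧
          (∫⁻ r in Set.Ioc t T,
            ∫⁻ ω, ENNReal.ofReal |f r (X t r x ω) (u r (X t r x ω))| ∂P) ≠ ⊤ ∧
          u t x = (∫ ω, g (X t T x ω) ∂P)
            + ∫ r in t..T, ∫ ω, f r (X t r x ω) (u r (X t r x ω)) ∂P)) ∧
      (∀ v : ℝ → (Fin d → ℝ) → ℝ,
        ((Measurable fun p : ℝ × (Fin d → ℝ) => v p.1 p.2) ∧
          (∃ C : ℝ, ∀ r ∈ Set.Icc (0:ℝ) T, ∀ ξ, |v r ξ| ≤ C * V r ξ) ∧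
          (∀ t ∈ Set.Icc (0:ℝ) T, ∀ x,
            (∫⁻ ω, ENNReal.ofReal |g (X t T x ω)| ∂P) ≠ ⊤ ∧
            (∫⁻ r in Set.Ioc t T,
              ∫⁻ ω, ENNReal.ofReal |f r (X t r x ω) (v r (X t r x ω))| ∂P) ≠ ⊤ ∧
            v t x = (∫ ω, g (X t T x ω) ∂P)
              + ∫ r in t..T, ∫ ω, f r (X t r x ω) (v r (X t r x ω)) ∂P)) →
        ∀ t ∈ Set.Icc (0:ℝ) T, ∀ x, v t x = u t x) := by
  have hnn0 : nrm 0 = 0 := by simpa using hnrm_smul 0 0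
  have hX : ∀ s t, 0 ≤ s → s ≤ t → t ≤ T → ∀ x, Measurable (X s t x) := by
    intro s t hs hst ht x
    have := (hX_meas s ⟨hs, hst.trans ht⟩ x).comp
      (measurable_prodMk_left (x := (⟨t, hst, ht⟩ : Set.Icc s T)))
    exact this
  refine aux_core P L T hL hT f hf_meas g hg_meas V hV1 X hX ?_ ?_ ?_ ?_ ?_
  · intro h hh
    have := hjoint (fun t x _ => h (t, x))
      (hh.comp (measurable_fst.prodMk (measurable_fst.comp measurable_snd)))
    exact this.comp (measurable_fst.prodMk (measurable_snd.prodMk measurable_snd))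
  · intro s t hs hst ht x
    have hm : Measurable (fun ω => V t (X s t x ω)) :=
      hV_meas.comp (measurable_const.prodMk (hX s t hs hst ht x))
    have h1 := (eLpNorm_le_eLpNorm_of_exponent_le hp₁ hm.aestronglyMeasurable (μ := P)).trans
      (hH1 s t hs hst ht x).2.2.1
    rw [eLpNorm_one_eq_lintegral_enorm] at h1
    refine (lintegral_mono fun ω => ?_).trans h1
    rw [Real.enorm_eq_ofReal_abs]
    exact ENNReal.ofReal_le_ofReal (le_abs_self _)
  · intro x
    simpa using (hH1 T T hT.le le_rfl le_rfl x).1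
  · intro t ht x
    have := (hH1 t t ht.1 le_rfl ht.2 x).2.1
    rw [abs_mul, abs_of_pos hT] at this
    rwa [inv_mul_eq_div, le_div_iff₀' hT]
  · intro t ht x v w
    simpa [hnn0] using hH3 t ht x x v w
end

section
/- Under the stochastic fixed-point equation (SFPE) setting with hypotheses (H1)–(H5), the unique measurable solution u : [0,T]×ℝ^d → ℝ of the SFPE u(t,x) = E[g(X^x_{t,T})] + ∫_t^T E[f(r, X^x_{t,r}, u(r, X^x_{t,r}))] dr (with sup_{r,ξ} |u(r,ξ)|/V(r,ξ) < ∞) satisfies for all t ∈ [0,T], x ∈ ℝ^d that |u(t,x)| ≤ 2 e^{L(T−t)} V(t,x). -/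
open MeasureTheory
open scoped ENNReal

/-- A priori bound for SFPE solutions: under the SFPE setting with hypotheses (H1)–(H5),
the measurable solution `u` of the SFPE with at most `V`-growth satisfies
`|u(t,x)| ≤ 2 e^{L(T−t)} V(t,x)` for all `t ∈ [0,T]`, `x ∈ ℝ^d`. -/
theorem stmt_5
    {Ω : Type*} [MeasurableSpace Ω] (P : Measure Ω) [IsProbabilityMeasure P]
    (d : ℕ) (L T : ℝ) (hL : 0 ≤ L) (hT : 0 < T)
    (p₁ p₂ p₃ : ℝ≥0∞) (hp₁ : 1 ≤ p₁) (hp₂ : 1 ≤ p₂) (hp₃ : 1 ≤ p₃)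
    (hp : 1 / p₁ + 1 / p₂ + 1 / p₃ ≤ 1)
    (nrm : (Fin d → ℝ) → ℝ)
    (hnrm_tri : ∀ x y, nrm (x + y) ≤ nrm x + nrm y)
    (hnrm_smul : ∀ (a : ℝ) x, nrm (a • x) = |a| * nrm x)
    (hnrm_def : ∀ x, nrm x = 0 → x = 0)
    (f : ℝ → (Fin d → ℝ) → ℝ → ℝ)
    (hf_meas : Measurable fun p : ℝ × (Fin d → ℝ) × ℝ => f p.1 p.2.1 p.2.2)
    (g : (Fin d → ℝ) → ℝ) (hg_meas : Measurable g)
    (φ V ψ : ℝ → (Fin d → ℝ) → ℝ)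
    (hφ_meas : Measurable fun p : ℝ × (Fin d → ℝ) => φ p.1 p.2)
    (hV_meas : Measurable fun p : ℝ × (Fin d → ℝ) => V p.1 p.2)
    (hψ_meas : Measurable fun p : ℝ × (Fin d → ℝ) => ψ p.1 p.2)
    (hφ1 : ∀ t ∈ Set.Icc (0:ℝ) T, ∀ x, 1 ≤ φ t x)
    (hV1 : ∀ t ∈ Set.Icc (0:ℝ) T, ∀ x, 1 ≤ V t x)
    (hψ1 : ∀ t ∈ Set.Icc (0:ℝ) T, ∀ x, 1 ≤ ψ t x)
    (X : ℝ → ℝ → (Fin d → ℝ) → Ω → (Fin d → ℝ))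
    (hX_meas : ∀ s ∈ Set.Icc (0:ℝ) T, ∀ x,
      Measurable fun p : Set.Icc s T × Ω => X s (p.1 : ℝ) x p.2)
    (hjoint : ∀ h : ℝ → (Fin d → ℝ) → (Fin d → ℝ) → ℝ≥0∞,
      (Measurable fun p : ℝ × (Fin d → ℝ) × (Fin d → ℝ) => h p.1 p.2.1 p.2.2) →
      Measurable fun q : {p : ℝ × ℝ // 0 ≤ p.1 ∧ p.1 ≤ p.2 ∧ p.2 ≤ T}
          × (Fin d → ℝ) × (Fin d → ℝ) =>
        ∫⁻ ω, h (q.1 : ℝ × ℝ).2 (X (q.1 : ℝ × ℝ).1 (q.1 : ℝ × ℝ).2 q.2.1 ω)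
          (X (q.1 : ℝ × ℝ).1 (q.1 : ℝ × ℝ).2 q.2.2 ω) ∂P)
    -- (H1)
    (hH1 : ∀ s t : ℝ, 0 ≤ s → s ≤ t → t ≤ T → ∀ x,
      (if s = T then |g x| else 0) ≤ V s x ∧
      |T * f s x 0| ≤ V s x ∧
      eLpNorm (fun ω => V t (X s t x ω)) p₁ P ≤ ENNReal.ofReal (V s x) ∧
      eLpNorm (fun ω => φ t (X s t x ω)) p₃ P ≤ ENNReal.ofReal (φ s x))
    -- (H2)
    (hH2 : ∀ x y, |g x - g y| ≤ (2 * Real.sqrt T)⁻¹ * (V T x + V T y) * nrm (x - y))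
    -- (H3)
    (hH3 : ∀ t ∈ Set.Icc (0:ℝ) T, ∀ x y v w,
      |f t x v - f t y w| ≤ L * |v - w|
        + (2 * T ^ ((3:ℝ)/2))⁻¹ * (V t x + V t y) * nrm (x - y))
    -- (H4)
    (hH4 : ∀ s t : ℝ, 0 ≤ s → s ≤ t → t ≤ T → ∀ x y,
      eLpNorm (fun ω => nrm (X s t x ω - x)) p₂ P
        ≤ ENNReal.ofReal (ψ s x * |s - t| ^ ((1:ℝ)/2)) ∧
      eLpNorm (fun ω => nrm (X s t x ω - X s t y ω)) p₂ P
        ≤ ENNReal.ofReal (2⁻¹ * (φ s x + φ s y) * nrm (x - y)))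
    -- (H5)
    (hH5 : ∀ h : ℝ → (Fin d → ℝ) → (Fin d → ℝ) → ℝ≥0∞,
      (Measurable fun p : ℝ × (Fin d → ℝ) × (Fin d → ℝ) => h p.1 p.2.1 p.2.2) →
      ∀ s t r : ℝ, 0 ≤ s → s ≤ t → t ≤ r → r ≤ T → ∀ x y,
        ∫⁻ ω, (∫⁻ ω', h r (X t r (X s t x ω) ω') (X t r (X s t y ω) ω') ∂P) ∂P
          = ∫⁻ ω, h r (X s r x ω) (X s r y ω) ∂P)
    (u : ℝ → (Fin d → ℝ) → ℝ)
    (hu_meas : Measurable fun p : ℝ × (Fin d → ℝ) => u p.1 p.2)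
    (hu_growth : ∃ C : ℝ, ∀ r ∈ Set.Icc (0:ℝ) T, ∀ ξ, |u r ξ| ≤ C * V r ξ)
    (hu_sfpe : ∀ t ∈ Set.Icc (0:ℝ) T, ∀ x,
      (∫⁻ ω, ENNReal.ofReal |g (X t T x ω)| ∂P) ≠ ⊤ ∧
      (∫⁻ r in Set.Ioc t T,
        ∫⁻ ω, ENNReal.ofReal |f r (X t r x ω) (u r (X t r x ω))| ∂P) ≠ ⊤ ∧
      u t x = (∫ ω, g (X t T x ω) ∂P)
        + ∫ r in t..T, ∫ ω, f r (X t r x ω) (u r (X t r x ω)) ∂P) :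
    ∀ t ∈ Set.Icc (0:ℝ) T, ∀ x, |u t x| ≤ 2 * Real.exp (L * (T - t)) * V t x := by
  have hVX : ∀ s r : ℝ, 0 ≤ s → s ≤ r → r ≤ T → ∀ x,
      Integrable (fun ω => V r (X s r x ω)) P ∧ ∫ ω, V r (X s r x ω) ∂P ≤ V s x := by
    intro s r hs hsr hr x
    have hXm : Measurable (fun ω => X s r x ω) :=
      (hX_meas s ⟨hs, hsr.trans hr⟩ x).comp
        (measurable_const.prodMk measurable_id :
          Measurable fun ω : Ω => ((⟨r, hsr, hr⟩ : Set.Icc s T), ω))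
    have hm : Measurable (fun ω => V r (X s r x ω)) :=
      hV_meas.comp (measurable_const.prodMk hXm)
    have h1 : eLpNorm (fun ω => V r (X s r x ω)) 1 P ≤ ENNReal.ofReal (V s x) :=
      (eLpNorm_le_eLpNorm_of_exponent_le hp₁ hm.aestronglyMeasurable).trans
        (hH1 s r hs hsr hr x).2.2.1
    have hint : Integrable (fun ω => V r (X s r x ω)) P :=
      memLp_one_iff_integrable.1
        ⟨hm.aestronglyMeasurable, h1.trans_lt ENNReal.ofReal_lt_top⟩
    have hV0 : 0 ≤ V s x := zero_le_one.trans (hV1 s ⟨hs, hsr.trans hr⟩ x)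
    refine ⟨hint, ?_⟩
    refine (le_abs_self _).trans ?_
    have h2 := enorm_integral_le_lintegral_enorm (μ := P) (fun ω => V r (X s r x ω))
    rw [eLpNorm_one_eq_lintegral_enorm] at h1
    have h3 := h2.trans h1
    rw [Real.enorm_eq_ofReal_abs] at h3
    exact (ENNReal.ofReal_le_ofReal_iff hV0).1 h3
  have hn0 : nrm 0 = 0 := by
    have := hnrm_smul 0 0
    simpa using this
  have hfb : ∀ r ∈ Set.Icc (0:ℝ) T, ∀ y v, |f r y v| ≤ T⁻¹ * V r y + L * |v| := by
    intro r hr y v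
    have h1 := hH3 r hr y y v 0
    rw [sub_self, hn0, mul_zero, add_zero, sub_zero] at h1
    have h2 := (hH1 r r hr.1 le_rfl hr.2 y).2.1
    rw [abs_mul, abs_of_pos hT] at h2
    have h3 : |f r y 0| ≤ T⁻¹ * V r y := by
      rw [inv_mul_eq_div, le_div_iff₀ hT]
      linarith
    have h4 := abs_sub_abs_le_abs_sub (f r y v) (f r y 0)
    linarith
  have step : ∀ a : ℝ → ℝ, Continuous a →
      (∀ r ∈ Set.Icc (0:ℝ) T, ∀ ξ, |u r ξ| ≤ a r * V r ξ) →
      ∀ t ∈ Set.Icc (0:ℝ) T, ∀ x, |u t x| ≤ (2 + L * ∫ r in t..T, a r) * V t x := by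
    intro a ha hua t ht x
    have hV0 : 0 ≤ V t x := zero_le_one.trans (hV1 t ht x)
    rw [(hu_sfpe t ht x).2.2]
    have hg : |∫ ω, g (X t T x ω) ∂P| ≤ V t x := by
      obtain ⟨hi, hle⟩ := hVX t T ht.1 ht.2 le_rfl x
      refine le_trans ?_ hle
      rw [← Real.norm_eq_abs]
      refine norm_integral_le_of_norm_le hi (Filter.Eventually.of_forall fun ω => ?_)
      have := (hH1 T T hT.le le_rfl le_rfl (X t T x ω)).1
      simpa using this
    have hin : ∀ r ∈ Set.Icc t T,
        ‖∫ ω, f r (X t r x ω) (u r (X t r x ω)) ∂P‖ ≤ (T⁻¹ + L * a r) * V t x := by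
      intro r hr
      have hr' : r ∈ Set.Icc (0:ℝ) T := ⟨ht.1.trans hr.1, hr.2⟩
      obtain ⟨hi, hle⟩ := hVX t r ht.1 hr.1 hr.2 x
      have ha0 : 0 ≤ a r := by
        have h1 := (abs_nonneg _).trans (hua r hr' 0)
        have h2 := hV1 r hr' 0
        exact nonneg_of_mul_nonneg_left h1 (by linarith)
      have hc : 0 ≤ T⁻¹ + L * a r := by positivity
      refine le_trans (norm_integral_le_of_norm_le (hi.const_mul (T⁻¹ + L * a r))
        (Filter.Eventually.of_forall fun ω => ?_)) ?_
      · have h1 := hfb r hr' (X t r x ω) (u r (X t r x ω))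
        have h2 := mul_le_mul_of_nonneg_left (hua r hr' (X t r x ω)) hL
        rw [Real.norm_eq_abs]
        linarith
      · rw [integral_const_mul]
        exact mul_le_mul_of_nonneg_left hle hc
    have hcont : Continuous fun r => (T⁻¹ + L * a r) * V t x := by fun_prop
    have hI : |∫ r in t..T, ∫ ω, f r (X t r x ω) (u r (X t r x ω)) ∂P|
        ≤ ∫ r in t..T, (T⁻¹ + L * a r) * V t x :=
      intervalIntegral.norm_integral_le_of_norm_le ht.2
        (Filter.Eventually.of_forall fun r hr => hin r (Set.Ioc_subset_Icc_self hr))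
        (hcont.intervalIntegrable _ _)
    have hLa : Continuous fun r => L * a r := by fun_prop
    rw [intervalIntegral.integral_mul_const, intervalIntegral.integral_add
      (continuous_const.intervalIntegrable _ _)
      (hLa.intervalIntegrable _ _),
      intervalIntegral.integral_const_mul, intervalIntegral.integral_const, smul_eq_mul] at hI
    have h5 : (T - t) * T⁻¹ ≤ 1 := by
      rw [← div_eq_mul_inv, div_le_one hT]
      linarith [ht.1]
    have h6 := mul_le_mul_of_nonneg_right h5 hV0
    have h7 := abs_add_le (∫ ω, g (X t T x ω) ∂P)
      (∫ r in t..T, ∫ ω, f r (X t r x ω) (u r (X t r x ω)) ∂P)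
    nlinarith
  obtain ⟨C, hC⟩ := hu_growth
  have key : ∀ n : ℕ, ∀ t ∈ Set.Icc (0:ℝ) T, ∀ x,
      |u t x| ≤ (2 * Real.exp (L * (T - t)) + C * ((L * (T - t)) ^ n / n.factorial)) * V t x := by
    intro n
    induction n with
    | zero =>
      intro t ht x
      have h1 := hC t ht x
      have h2 := hV1 t ht x
      have h3 := Real.exp_pos (L * (T - t))
      simp only [pow_zero, Nat.factorial_zero, Nat.cast_one, div_one, mul_one]
      nlinarith
    | succ n ih =>
      intro t ht x
      have h := step (fun t => 2 * Real.exp (L * (T - t))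
        + C * ((L * (T - t)) ^ n / n.factorial)) (by fun_prop) ih t ht x
      refine h.trans (le_of_eq ?_)
      congr 1
      have hd : ∀ r ∈ Set.uIcc t T, HasDerivAt
          (fun r => -(2 * Real.exp (L * (T - r))
            + C * ((L * (T - r)) ^ (n+1) / (n+1).factorial)))
          (L * (2 * Real.exp (L * (T - r)) + C * ((L * (T - r)) ^ n / n.factorial))) r := by
        intro r _
        have e : HasDerivAt (fun r => L * (T - r)) (L * (-1)) r :=
          ((hasDerivAt_id r).const_sub T).const_mul L
        have e2 := ((e.exp.const_mul 2).add
          (((e.pow (n+1)).div_const ((n+1).factorial : ℝ)).const_mul C)).neg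
        refine e2.congr_deriv ?_
        have : (n.factorial : ℝ) ≠ 0 := by positivity
        have : (n : ℝ) + 1 ≠ 0 := by positivity
        rw [Nat.factorial_succ]
        push_cast
        field_simp
        ring
      rw [← intervalIntegral.integral_const_mul,
        intervalIntegral.integral_eq_sub_of_hasDerivAt hd
          (Continuous.intervalIntegrable (by fun_prop) _ _)]
      simp
      ring
  intro t ht x
  have hlim : Filter.Tendsto (fun n : ℕ => (2 * Real.exp (L * (T - t))
      + C * ((L * (T - t)) ^ n / n.factorial)) * V t x) Filter.atTop
      (nhds ((2 * Real.exp (L * (T - t)) + C * 0) * V t x)) :=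
    (((FloorSemiring.tendsto_pow_div_factorial_atTop (L * (T - t))).const_mul C).const_add
      _).mul_const _
  rw [mul_zero, add_zero] at hlim
  exact ge_of_tendsto' hlim fun n => key n t ht x
end

section
/- Under the stochastic fixed-point equation (SFPE) setting with hypotheses (H1)–(H5), the unique measurable solution u : [0,T]×ℝ^d → ℝ of the SFPE u(t,x) = E[g(X^x_{t,T})] + ∫_t^T E[f(r, X^x_{t,r}, u(r, X^x_{t,r}))] dr (with sup_{r,ξ} |u(r,ξ)|/V(r,ξ) < ∞) satisfies for all 0 ≤ s ≤ t ≤ T and x,y ∈ ℝ^d that |u(s,x) − u(t,y)| ≤ T^{−1/2} e^{2LT} (V(s,x) + V(t,y)) (φ(s,x) + φ(t,y)) [ψ(s,x)|s−t|^{1/2} + ‖x−y‖]. -/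
open MeasureTheory
open scoped ENNReal

/-- The flow properties of the process `X` used in the proof. -/
structure SFPEFlow {Ω E : Type*} [MeasurableSpace Ω] [MeasurableSpace E] (P : Measure Ω)
    (T : ℝ) (X : ℝ → ℝ → E → Ω → E) : Prop where
  meas : ∀ s t : ℝ, 0 ≤ s → s ≤ t → t ≤ T → ∀ x, Measurable (X s t x)
  joint : ∀ h : ℝ → E → E → ℝ≥0∞,
      (Measurable fun p : ℝ × E × E => h p.1 p.2.1 p.2.2) →
      Measurable fun q : {p : ℝ × ℝ // 0 ≤ p.1 ∧ p.1 ≤ p.2 ∧ p.2 ≤ T} × E × E =>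
        ∫⁻ ω, h (q.1 : ℝ × ℝ).2 (X (q.1 : ℝ × ℝ).1 (q.1 : ℝ × ℝ).2 q.2.1 ω)
          (X (q.1 : ℝ × ℝ).1 (q.1 : ℝ × ℝ).2 q.2.2 ω) ∂P
  markov : ∀ h : ℝ → E → E → ℝ≥0∞,
      (Measurable fun p : ℝ × E × E => h p.1 p.2.1 p.2.2) →
      ∀ s t r : ℝ, 0 ≤ s → s ≤ t → t ≤ r → r ≤ T → ∀ x y,
        ∫⁻ ω, (∫⁻ ω', h r (X t r (X s t x ω) ω') (X t r (X s t y ω) ω') ∂P) ∂P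
          = ∫⁻ ω, h r (X s r x ω) (X s r y ω) ∂P

namespace SFPEFlow

variable {Ω E : Type*} [MeasurableSpace Ω] [MeasurableSpace E] {P : Measure Ω}
    {T : ℝ} {X : ℝ → ℝ → E → Ω → E}

/-- Clamped version of the joint measurability hypothesis. -/
lemma joint_clamp (hF : SFPEFlow P T X) {h : ℝ → E → E → ℝ≥0∞}
    (hh : Measurable fun p : ℝ × E × E => h p.1 p.2.1 p.2.2) {t : ℝ} (ht0 : 0 ≤ t) (htT : t ≤ T) :
    Measurable fun q : ℝ × E × E =>
      ∫⁻ ω, h (max t (min q.1 T)) (X t (max t (min q.1 T)) q.2.1 ω)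
        (X t (max t (min q.1 T)) q.2.2 ω) ∂P := by
  have h1 : Measurable fun q : ℝ × E × E =>
      (((⟨(t, max t (min q.1 T)), ht0, le_max_left _ _, max_le htT (min_le_right _ _)⟩ :
        {p : ℝ × ℝ // 0 ≤ p.1 ∧ p.1 ≤ p.2 ∧ p.2 ≤ T})), q.2) := by
    refine Measurable.prodMk (Measurable.subtype_mk ?_) measurable_snd
    fun_prop
  exact (hF.joint h hh).comp h1

lemma clamp_eq {t T r : ℝ} (hr : r ∈ Set.Icc t T) : max t (min r T) = r := by
  rw [min_eq_left hr.2, max_eq_right hr.1]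

lemma aemeas_time (hF : SFPEFlow P T X) {h : ℝ → E → E → ℝ≥0∞}
    (hh : Measurable fun p : ℝ × E × E => h p.1 p.2.1 p.2.2) {t : ℝ} (ht0 : 0 ≤ t) (htT : t ≤ T)
    (x y : E) :
    AEMeasurable (fun r => ∫⁻ ω, h r (X t r x ω) (X t r y ω) ∂P)
      (volume.restrict (Set.Ioc t T)) := by
  refine ⟨_, (hF.joint_clamp hh ht0 htT).comp
    (measurable_id.prodMk (measurable_const (a := (x, y)))), ?_⟩
  filter_upwards [ae_restrict_mem measurableSet_Ioc] with r hr
  simp [clamp_eq (Set.Ioc_subset_Icc_self hr)]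

lemma meas_space (hF : SFPEFlow P T X) {h : ℝ → E → E → ℝ≥0∞}
    (hh : Measurable fun p : ℝ × E × E => h p.1 p.2.1 p.2.2) {t r : ℝ} (ht0 : 0 ≤ t)
    (htr : t ≤ r) (hrT : r ≤ T) :
    Measurable (fun q : E × E => ∫⁻ ω, h r (X t r q.1 ω) (X t r q.2 ω) ∂P) := by
  have := (hF.joint_clamp hh ht0 (htr.trans hrT)).comp
    ((measurable_const (a := r)).prodMk (measurable_id (α := E × E)))
  simpa [Function.comp_def, clamp_eq (⟨htr, hrT⟩ : r ∈ Set.Icc t T)] using this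

lemma meas_int (hF : SFPEFlow P T X) {h : ℝ → E → E → ℝ≥0∞}
    (hh : Measurable fun p : ℝ × E × E => h p.1 p.2.1 p.2.2) {t : ℝ} (ht0 : 0 ≤ t)
    (htT : t ≤ T) :
    Measurable (fun q : E × E => ∫⁻ r in Set.Ioc t T,
      ∫⁻ ω, h r (X t r q.1 ω) (X t r q.2 ω) ∂P) := by
  have h1 : (fun q : E × E => ∫⁻ r in Set.Ioc t T,
      ∫⁻ ω, h r (X t r q.1 ω) (X t r q.2 ω) ∂P) = fun q : E × E => ∫⁻ r in Set.Ioc t T,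
      ∫⁻ ω, h (max t (min r T)) (X t (max t (min r T)) q.1 ω)
        (X t (max t (min r T)) q.2 ω) ∂P := by
    funext q
    refine setLIntegral_congr_fun measurableSet_Ioc fun r hr => ?_
    simp [clamp_eq (Set.Ioc_subset_Icc_self hr)]
  rw [h1]
  refine Measurable.lintegral_prod_right' (f := fun z : (E × E) × ℝ =>
    ∫⁻ ω, h (max t (min z.2 T)) (X t (max t (min z.2 T)) z.1.1 ω)
        (X t (max t (min z.2 T)) z.1.2 ω) ∂P) ?_
  exact (hF.joint_clamp hh ht0 htT).comp (measurable_snd.prodMk measurable_fst)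

/-- Markov property integrated over time. -/
lemma markov_int [SFinite P] (hF : SFPEFlow P T X) {h : ℝ → E → E → ℝ≥0∞}
    (hh : Measurable fun p : ℝ × E × E => h p.1 p.2.1 p.2.2) {s t : ℝ} (hs0 : 0 ≤ s)
    (hst : s ≤ t) (htT : t ≤ T) (x y : E) :
    ∫⁻ ω, (∫⁻ r in Set.Ioc t T,
      ∫⁻ ω', h r (X t r (X s t x ω) ω') (X t r (X s t y ω) ω') ∂P) ∂P
     = ∫⁻ r in Set.Ioc t T, ∫⁻ ω, h r (X s r x ω) (X s r y ω) ∂P := by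
  have ht0 := hs0.trans hst
  have h1 : ∀ ω, (∫⁻ r in Set.Ioc t T,
      ∫⁻ ω', h r (X t r (X s t x ω) ω') (X t r (X s t y ω) ω') ∂P) = ∫⁻ r in Set.Ioc t T,
      ∫⁻ ω', h (max t (min r T)) (X t (max t (min r T)) (X s t x ω) ω')
        (X t (max t (min r T)) (X s t y ω) ω') ∂P := by
    intro ω
    refine setLIntegral_congr_fun measurableSet_Ioc fun r hr => ?_
    simp [clamp_eq (Set.Ioc_subset_Icc_self hr)]
  simp_rw [h1]
  rw [lintegral_lintegral_swap]
  · refine setLIntegral_congr_fun measurableSet_Ioc fun r hr => ?_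
    simp only [clamp_eq (Set.Ioc_subset_Icc_self hr)]
    exact hF.markov h hh s t r hs0 hst hr.1.le hr.2 x y
  · refine Measurable.aemeasurable ?_
    have h2 : Measurable fun z : Ω × ℝ => (z.2, X s t x z.1, X s t y z.1) :=
      measurable_snd.prodMk (((hF.meas s t hs0 hst htT x).comp measurable_fst).prodMk
        ((hF.meas s t hs0 hst htT y).comp measurable_fst))
    exact (hF.joint_clamp hh ht0 htT).comp h2

/-- Markov property for terminal plus running parts. -/
lemma markov_add [SFinite P] (hF : SFPEFlow P T X) {a h : ℝ → E → E → ℝ≥0∞}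
    (ha : Measurable fun p : ℝ × E × E => a p.1 p.2.1 p.2.2)
    (hh : Measurable fun p : ℝ × E × E => h p.1 p.2.1 p.2.2) {s t : ℝ} (hs0 : 0 ≤ s)
    (hst : s ≤ t) (htT : t ≤ T) (x y : E) :
    ∫⁻ ω, ((∫⁻ ω', a T (X t T (X s t x ω) ω') (X t T (X s t y ω) ω') ∂P)
      + ∫⁻ r in Set.Ioc t T,
      ∫⁻ ω', h r (X t r (X s t x ω) ω') (X t r (X s t y ω) ω') ∂P) ∂P
     = (∫⁻ ω, a T (X s T x ω) (X s T y ω) ∂P)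
      + ∫⁻ r in Set.Ioc t T, ∫⁻ ω, h r (X s r x ω) (X s r y ω) ∂P := by
  rw [lintegral_add_left, hF.markov_int hh hs0 hst htT,
    hF.markov a ha s t T hs0 hst htT le_rfl]
  exact (hF.meas_space ha (hs0.trans hst) htT le_rfl).comp
    ((hF.meas s t hs0 hst htT x).prodMk (hF.meas s t hs0 hst htT y))

end SFPEFlow

/-- Backward Gronwall inequality for `ℝ≥0∞`-valued functions. -/
lemma sfpe_gronwall {q : ℝ → ℝ≥0∞} {s T L K C : ℝ} (hL : 0 ≤ L) (hK : 0 ≤ K) (hC : 0 ≤ C)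
    (hq : ∀ t ∈ Set.Icc s T, q t ≤ ENNReal.ofReal C)
    (hIneq : ∀ t ∈ Set.Icc s T,
      q t ≤ ENNReal.ofReal K + ∫⁻ r in Set.Ioc t T, ENNReal.ofReal L * q r) :
    ∀ t ∈ Set.Icc s T, q t ≤ ENNReal.ofReal (K * Real.exp (L * (T - t))) := by
  have key : ∀ n : ℕ, ∀ t ∈ Set.Icc s T, q t ≤
      ENNReal.ofReal (K * Real.exp (L * (T - t)) + C * ((L * (T - t)) ^ n / n.factorial)) := by
    intro n
    induction n with
    | zero =>
      intro t ht
      refine (hq t ht).trans (ENNReal.ofReal_le_ofReal ?_)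
      have : 0 ≤ K * Real.exp (L * (T - t)) := by positivity
      simpa using this
    | succ n ih =>
      intro t ht
      set F : ℝ → ℝ := fun r =>
        L * (K * Real.exp (L * (T - r)) + C * ((L * (T - r)) ^ n / n.factorial)) with hFdef
      have hFc : Continuous F := by fun_prop
      have hder : ∀ r ∈ Set.uIcc t T, HasDerivAt (fun r =>
          -(K * Real.exp (L * (T - r)) +
            C * ((L * (T - r)) ^ (n+1) / (n+1).factorial))) (F r) r := by
        intro r _
        have h0 : HasDerivAt (fun r => L * (T - r)) (L * (-1)) r :=
          ((hasDerivAt_id r).const_sub T).const_mul L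
        have h1 := (h0.exp.const_mul K).add
          (((h0.pow (n+1)).div_const ((n+1).factorial : ℝ)).const_mul C)
        refine HasDerivAt.congr_deriv (f' := _) h1.neg ?_
        simp only [hFdef, Nat.factorial_succ, Nat.cast_mul, Nat.add_sub_cancel]
        have : (n.factorial : ℝ) ≠ 0 := by positivity
        have : ((n + 1 : ℕ) : ℝ) ≠ 0 := by positivity
        field_simp
        ring
      have hI : ∫ r in t..T, F r = K * Real.exp (L * (T - t)) +
            C * ((L * (T - t)) ^ (n+1) / (n+1).factorial) - K := by
        rw [intervalIntegral.integral_eq_sub_of_hasDerivAt hder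
          (hFc.intervalIntegrable _ _)]
        simp
        ring
      have hFpos : ∀ r ∈ Set.Ioc t T, 0 ≤ F r := by
        intro r hr
        have : 0 ≤ T - r := sub_nonneg.2 hr.2
        simp only [hFdef]; positivity
      have hlin : ∫⁻ r in Set.Ioc t T, ENNReal.ofReal (F r)
          = ENNReal.ofReal (∫ r in t..T, F r) := by
        rw [intervalIntegral.integral_of_le ht.2, ofReal_integral_eq_lintegral_ofReal]
        · exact (hFc.integrableOn_Icc (a := t) (b := T)).mono_set Set.Ioc_subset_Icc_self
        · filter_upwards [ae_restrict_mem measurableSet_Ioc] with r hr using hFpos r hr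
      have hpos : 0 ≤ ∫ r in t..T, F r := by
        rw [intervalIntegral.integral_of_le ht.2]
        exact setIntegral_nonneg measurableSet_Ioc hFpos
      calc q t ≤ ENNReal.ofReal K + ∫⁻ r in Set.Ioc t T, ENNReal.ofReal L * q r := hIneq t ht
        _ ≤ ENNReal.ofReal K + ∫⁻ r in Set.Ioc t T, ENNReal.ofReal (F r) := by
            refine add_le_add le_rfl ?_
            refine setLIntegral_mono' measurableSet_Ioc fun r hr => ?_
            simp only [hFdef]
            rw [ENNReal.ofReal_mul hL]
            gcongr
            exact ih r ⟨ht.1.trans hr.1.le, hr.2⟩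
        _ = _ := by
            rw [hlin, ← ENNReal.ofReal_add hK hpos, hI]
            congr 1; ring
  intro t ht
  have hlim : Filter.Tendsto (fun n : ℕ => ENNReal.ofReal
      (K * Real.exp (L * (T - t)) + C * ((L * (T - t)) ^ n / n.factorial))) Filter.atTop
      (nhds (ENNReal.ofReal (K * Real.exp (L * (T - t)) + C * 0))) :=
    ENNReal.tendsto_ofReal (((FloorSemiring.tendsto_pow_div_factorial_atTop
      (L * (T - t))).const_mul C).const_add _)
  have := ge_of_tendsto' hlim (fun n => key n t ht)
  simpa using this

/-- Gronwall along the flow. -/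
lemma SFPEFlow.gronwall {Ω E : Type*} [MeasurableSpace Ω] [MeasurableSpace E] {P : Measure Ω}
    [SFinite P] {T : ℝ} {X : ℝ → ℝ → E → Ω → E} (hF : SFPEFlow P T X)
    {D a b : ℝ → E → E → ℝ≥0∞}
    (hD : Measurable fun p : ℝ × E × E => D p.1 p.2.1 p.2.2)
    (ha : Measurable fun p : ℝ × E × E => a p.1 p.2.1 p.2.2)
    (hb : Measurable fun p : ℝ × E × E => b p.1 p.2.1 p.2.2)
    {L α C : ℝ} (hL : 0 ≤ L) (hα : 0 ≤ α) (hC : 0 ≤ C) (hT : 0 < T)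
    (hrec : ∀ t ∈ Set.Icc 0 T, ∀ x y, D t x y ≤ (∫⁻ ω, a T (X t T x ω) (X t T y ω) ∂P)
      + ∫⁻ r in Set.Ioc t T, ∫⁻ ω, (b r (X t r x ω) (X t r y ω)
        + ENNReal.ofReal L * D r (X t r x ω) (X t r y ω)) ∂P)
    {s : ℝ} (hs : 0 ≤ s) (x y : E)
    (hA : (∫⁻ ω, a T (X s T x ω) (X s T y ω) ∂P) ≤ ENNReal.ofReal α)
    (hB : ∀ r ∈ Set.Icc s T, (∫⁻ ω, b r (X s r x ω) (X s r y ω) ∂P) ≤ ENNReal.ofReal (α / T))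
    (hDC : ∀ r ∈ Set.Icc s T, (∫⁻ ω, D r (X s r x ω) (X s r y ω) ∂P) ≤ ENNReal.ofReal C) :
    ∀ t ∈ Set.Icc s T, (∫⁻ ω, D t (X s t x ω) (X s t y ω) ∂P)
      ≤ ENNReal.ofReal (2 * α * Real.exp (L * (T - t))) := by
  refine sfpe_gronwall hL (by positivity) hC hDC ?_
  intro t ht
  have ht0 := hs.trans ht.1
  have hh : Measurable fun p : ℝ × E × E => b p.1 p.2.1 p.2.2
      + ENNReal.ofReal L * D p.1 p.2.1 p.2.2 := hb.add (hD.const_mul _)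
  have h1 := hF.markov_add ha (h := fun r x y => b r x y + ENNReal.ofReal L * D r x y) hh hs ht.1
    ht.2 x y
  refine (lintegral_mono fun ω => hrec t ⟨ht0, ht.2⟩ _ _).trans (h1.trans_le ?_)
  have h2 : ∫⁻ r in Set.Ioc t T, ∫⁻ ω, (b r (X s r x ω) (X s r y ω)
        + ENNReal.ofReal L * D r (X s r x ω) (X s r y ω)) ∂P
      ≤ ∫⁻ r in Set.Ioc t T, (ENNReal.ofReal (α / T) + ENNReal.ofReal L *
        ∫⁻ ω, D r (X s r x ω) (X s r y ω) ∂P) := by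
    refine setLIntegral_mono' measurableSet_Ioc fun r hr => ?_
    have hr' : r ∈ Set.Icc s T := ⟨ht.1.trans hr.1.le, hr.2⟩
    have hm : Measurable fun ω => (r, X s r x ω, X s r y ω) :=
      measurable_const.prodMk ((hF.meas s r hs hr'.1 hr'.2 x).prodMk
        (hF.meas s r hs hr'.1 hr'.2 y))
    have hbm : Measurable fun ω => b r (X s r x ω) (X s r y ω) := hb.comp hm
    have hDm : Measurable fun ω => D r (X s r x ω) (X s r y ω) := hD.comp hm
    rw [lintegral_add_left hbm, lintegral_const_mul _ hDm]
    gcongr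
    exact hB r hr'
  refine (add_le_add hA h2).trans ?_
  rw [lintegral_add_left measurable_const, ← add_assoc]
  gcongr ?_ + _
  rw [setLIntegral_const, Real.volume_Ioc, ← ENNReal.ofReal_mul (by positivity),
    ← ENNReal.ofReal_add hα (mul_nonneg (by positivity) (sub_nonneg.2 ht.2))]
  refine ENNReal.ofReal_le_ofReal ?_
  have : α / T * (T - t) ≤ α / T * T := by gcongr; linarith
  rw [div_mul_cancel₀ _ hT.ne'] at this
  linarith

/-- Solutions of the stochastic fixed point equation. -/
structure SFPESol {Ω E : Type*} [MeasurableSpace Ω] [MeasurableSpace E] (P : Measure Ω)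
    (T : ℝ) (X : ℝ → ℝ → E → Ω → E) (g : E → ℝ) (F : ℝ → E → ℝ) (u : ℝ → E → ℝ) : Prop where
  flow : SFPEFlow P T X
  g_meas : Measurable g
  F_meas : Measurable fun p : ℝ × E => F p.1 p.2
  sfpe : ∀ t ∈ Set.Icc (0:ℝ) T, ∀ x,
      (∫⁻ ω, ENNReal.ofReal |g (X t T x ω)| ∂P) ≠ ⊤ ∧
      (∫⁻ r in Set.Ioc t T, ∫⁻ ω, ENNReal.ofReal |F r (X t r x ω)| ∂P) ≠ ⊤ ∧
      u t x = (∫ ω, g (X t T x ω) ∂P) + ∫ r in t..T, ∫ ω, F r (X t r x ω) ∂P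

lemma sfpe_integrable {Ω : Type*} [MeasurableSpace Ω] {P : Measure Ω} {G : Ω → ℝ}
    (hG : AEStronglyMeasurable G P) (h : (∫⁻ ω, ENNReal.ofReal |G ω| ∂P) ≠ ⊤) :
    Integrable G P := by
  refine ⟨hG, ?_⟩
  rw [hasFiniteIntegral_iff_norm]
  exact lt_top_iff_ne_top.2 h

lemma sfpe_ofReal_abs_integral {Ω : Type*} [MeasurableSpace Ω] {P : Measure Ω} (G : Ω → ℝ) :
    ENNReal.ofReal |∫ ω, G ω ∂P| ≤ ∫⁻ ω, ENNReal.ofReal |G ω| ∂P := by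
  simpa [← Real.enorm_eq_ofReal_abs] using enorm_integral_le_lintegral_enorm (μ := P) G

lemma sfpe_ofReal_abs_add (a b : ℝ) :
    ENNReal.ofReal |a + b| ≤ ENNReal.ofReal |a| + ENNReal.ofReal |b| := by
  rw [← ENNReal.ofReal_add (abs_nonneg _) (abs_nonneg _)]
  exact ENNReal.ofReal_le_ofReal (abs_add_le a b)

namespace SFPESol

variable {Ω E : Type*} [MeasurableSpace Ω] [MeasurableSpace E] {P : Measure Ω}
    {T : ℝ} {X : ℝ → ℝ → E → Ω → E} {g : E → ℝ} {F : ℝ → E → ℝ} {u : ℝ → E → ℝ}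

/-- Positive (`σ = 1`) and negative (`σ = -1`) parts of the fixed point equation. -/
noncomputable def part (P : Measure Ω) (T : ℝ) (X : ℝ → ℝ → E → Ω → E) (g : E → ℝ)
    (F : ℝ → E → ℝ) (σ : ℝ) (s t : ℝ) (x : E) : ℝ≥0∞ :=
  (∫⁻ ω, ENNReal.ofReal (σ * g (X s T x ω)) ∂P)
    + ∫⁻ r in Set.Ioc t T, ∫⁻ ω, ENNReal.ofReal (σ * F r (X s r x ω)) ∂P

lemma measF (hS : SFPESol P T X g F u) {s r : ℝ} (hs : 0 ≤ s) (hsr : s ≤ r) (hr : r ≤ T) (x : E) :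
    Measurable fun ω => F r (X s r x ω) :=
  hS.F_meas.comp (measurable_const.prodMk (hS.flow.meas s r hs hsr hr x))

lemma measg (hS : SFPESol P T X g F u) {s : ℝ} (hs : 0 ≤ s) (hsr : s ≤ T) (x : E) :
    Measurable fun ω => g (X s T x ω) :=
  hS.g_meas.comp (hS.flow.meas s T hs hsr le_rfl x)

lemma h_meas (hS : SFPESol P T X g F u) (σ : ℝ) :
    Measurable fun p : ℝ × E × E => ENNReal.ofReal (σ * F p.1 p.2.1) := by
  have : Measurable fun p : ℝ × E × E => F p.1 p.2.1 :=
    hS.F_meas.comp (measurable_fst.prodMk (measurable_fst.comp measurable_snd))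
  exact ENNReal.measurable_ofReal.comp (this.const_mul σ)

lemma ha_meas (hS : SFPESol P T X g F u) :
    Measurable fun p : ℝ × E × E => ENNReal.ofReal |F p.1 p.2.1| := by
  have : Measurable fun p : ℝ × E × E => F p.1 p.2.1 :=
    hS.F_meas.comp (measurable_fst.prodMk (measurable_fst.comp measurable_snd))
  exact ENNReal.measurable_ofReal.comp this.abs

lemma ae_int (hS : SFPESol P T X g F u) {t : ℝ} (ht : t ∈ Set.Icc 0 T) (x : E) :
    ∀ᵐ r ∂(volume.restrict (Set.Ioc t T)), Integrable (fun ω => F r (X t r x ω)) P := by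
  have h1 := ae_lt_top' (hS.flow.aemeas_time (h := fun r x _ => ENNReal.ofReal |F r x|)
    hS.ha_meas ht.1 ht.2 x x) (hS.sfpe t ht x).2.1
  filter_upwards [h1, ae_restrict_mem measurableSet_Ioc] with r hr hr'
  exact sfpe_integrable (hS.measF ht.1 hr'.1.le hr'.2 x).aestronglyMeasurable hr.ne

lemma part_le (σ : ℝ) (hσ : |σ| ≤ 1) (G : Ω → ℝ) :
    ∫⁻ ω, ENNReal.ofReal (σ * G ω) ∂P ≤ ∫⁻ ω, ENNReal.ofReal |G ω| ∂P := by
  refine lintegral_mono fun ω => ENNReal.ofReal_le_ofReal ?_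
  calc σ * G ω ≤ |σ * G ω| := le_abs_self _
    _ = |σ| * |G ω| := abs_mul _ _
    _ ≤ 1 * |G ω| := by gcongr
    _ = _ := one_mul _

lemma int_eq {G : Ω → ℝ} (hG : Integrable G P) :
    ∫ ω, G ω ∂P = (∫⁻ ω, ENNReal.ofReal (1 * G ω) ∂P).toReal
      - (∫⁻ ω, ENNReal.ofReal (-1 * G ω) ∂P).toReal := by
  rw [integral_eq_lintegral_pos_part_sub_lintegral_neg_part hG]
  simp

lemma lint_ne_top (hS : SFPESol P T X g F u) {t : ℝ} (ht : t ∈ Set.Icc 0 T) (x : E) {σ : ℝ}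
    (hσ : |σ| ≤ 1) :
    (∫⁻ r in Set.Ioc t T, ∫⁻ ω, ENNReal.ofReal (σ * F r (X t r x ω)) ∂P) ≠ ⊤ :=
  ne_top_of_le_ne_top (hS.sfpe t ht x).2.1 (lintegral_mono fun _ => part_le σ hσ _)

lemma time_int (hS : SFPESol P T X g F u) {t : ℝ} (ht : t ∈ Set.Icc 0 T) (x : E) :
    IntegrableOn (fun r => ∫ ω, F r (X t r x ω) ∂P) (Set.Ioc t T) ∧
    ∫ r in Set.Ioc t T, ∫ ω, F r (X t r x ω) ∂P =
      (∫⁻ r in Set.Ioc t T, ∫⁻ ω, ENNReal.ofReal (1 * F r (X t r x ω)) ∂P).toReal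
      - (∫⁻ r in Set.Ioc t T, ∫⁻ ω, ENNReal.ofReal (-1 * F r (X t r x ω)) ∂P).toReal := by
  have hm : ∀ σ : ℝ, AEMeasurable
      (fun r => ∫⁻ ω, ENNReal.ofReal (σ * F r (X t r x ω)) ∂P) (volume.restrict (Set.Ioc t T)) :=
    fun σ => hS.flow.aemeas_time (h := fun r x _ => ENNReal.ofReal (σ * F r x))
      (hS.h_meas σ) ht.1 ht.2 x x
  have hi : ∀ σ : ℝ, |σ| ≤ 1 → Integrable
      (fun r => (∫⁻ ω, ENNReal.ofReal (σ * F r (X t r x ω)) ∂P).toReal)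
      (volume.restrict (Set.Ioc t T)) :=
    fun σ hσ => integrable_toReal_of_lintegral_ne_top (hm σ) (hS.lint_ne_top ht x hσ)
  have he : (fun r => ∫ ω, F r (X t r x ω) ∂P) =ᵐ[volume.restrict (Set.Ioc t T)] fun r =>
      (∫⁻ ω, ENNReal.ofReal (1 * F r (X t r x ω)) ∂P).toReal
      - (∫⁻ ω, ENNReal.ofReal (-1 * F r (X t r x ω)) ∂P).toReal := by
    filter_upwards [hS.ae_int ht x] with r hr using int_eq hr
  have h1 := hi 1 (by simp)
  have h2 := hi (-1) (by simp)
  refine ⟨(h1.sub h2).congr he.symm, ?_⟩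
  rw [integral_congr_ae he, integral_sub h1 h2,
    integral_toReal (hm 1) (ae_lt_top' (hm 1) (hS.lint_ne_top ht x (by simp))),
    integral_toReal (hm (-1)) (ae_lt_top' (hm (-1)) (hS.lint_ne_top ht x (by simp)))]

lemma g_int (hS : SFPESol P T X g F u) {t : ℝ} (ht : t ∈ Set.Icc 0 T) (x : E) :
    Integrable (fun ω => g (X t T x ω)) P :=
  sfpe_integrable (hS.measg ht.1 ht.2 x).aestronglyMeasurable (hS.sfpe t ht x).1

lemma part_ne_top (hS : SFPESol P T X g F u) {t : ℝ} (ht : t ∈ Set.Icc 0 T) (x : E) {σ : ℝ}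
    (hσ : |σ| ≤ 1) : part P T X g F σ t t x ≠ ⊤ :=
  ENNReal.add_ne_top.2 ⟨ne_top_of_le_ne_top (hS.sfpe t ht x).1 (part_le σ hσ _),
    hS.lint_ne_top ht x hσ⟩

lemma u_eq (hS : SFPESol P T X g F u) {t : ℝ} (ht : t ∈ Set.Icc 0 T) (x : E) :
    u t x = (part P T X g F 1 t t x).toReal - (part P T X g F (-1) t t x).toReal := by
  rw [(hS.sfpe t ht x).2.2, intervalIntegral.integral_of_le ht.2, (hS.time_int ht x).2,
    int_eq (hS.g_int ht x)]
  unfold part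
  rw [ENNReal.toReal_add (ne_top_of_le_ne_top (hS.sfpe t ht x).1 (part_le _ (by simp) _))
    (hS.lint_ne_top ht x (by simp)),
    ENNReal.toReal_add (ne_top_of_le_ne_top (hS.sfpe t ht x).1 (part_le _ (by simp) _))
    (hS.lint_ne_top ht x (by simp))]
  ring

lemma abs_le (hS : SFPESol P T X g F u) {t : ℝ} (ht : t ∈ Set.Icc 0 T) (x : E) :
    ENNReal.ofReal |u t x| ≤ (∫⁻ ω, ENNReal.ofReal |g (X t T x ω)| ∂P)
      + ∫⁻ r in Set.Ioc t T, ∫⁻ ω, ENNReal.ofReal |F r (X t r x ω)| ∂P := by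
  rw [(hS.sfpe t ht x).2.2, intervalIntegral.integral_of_le ht.2]
  refine (sfpe_ofReal_abs_add _ _).trans (add_le_add (sfpe_ofReal_abs_integral _) ?_)
  exact (sfpe_ofReal_abs_integral _).trans (lintegral_mono fun r => sfpe_ofReal_abs_integral _)

lemma diff_le (hS : SFPESol P T X g F u) {t : ℝ} (ht : t ∈ Set.Icc 0 T) (x y : E) :
    ENNReal.ofReal |u t x - u t y| ≤
      (∫⁻ ω, ENNReal.ofReal |g (X t T x ω) - g (X t T y ω)| ∂P)
      + ∫⁻ r in Set.Ioc t T, ∫⁻ ω, ENNReal.ofReal |F r (X t r x ω) - F r (X t r y ω)| ∂P := by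
  have h1 : u t x - u t y = (∫ ω, (g (X t T x ω) - g (X t T y ω)) ∂P)
      + ∫ r in Set.Ioc t T, ((∫ ω, F r (X t r x ω) ∂P) - ∫ ω, F r (X t r y ω) ∂P) := by
    rw [(hS.sfpe t ht x).2.2, (hS.sfpe t ht y).2.2, intervalIntegral.integral_of_le ht.2,
      intervalIntegral.integral_of_le ht.2, integral_sub (hS.g_int ht x) (hS.g_int ht y),
      integral_sub (hS.time_int ht x).1 (hS.time_int ht y).1]
    ring
  rw [h1]
  refine (sfpe_ofReal_abs_add _ _).trans (add_le_add (sfpe_ofReal_abs_integral _) ?_)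
  refine (sfpe_ofReal_abs_integral _).trans (lintegral_mono_ae ?_)
  filter_upwards [hS.ae_int ht x, hS.ae_int ht y] with r hx hy
  rw [← integral_sub hx hy]
  exact sfpe_ofReal_abs_integral _

lemma part_meas (hS : SFPESol P T X g F u) {t : ℝ} (ht : t ∈ Set.Icc 0 T) (σ : ℝ) :
    Measurable fun x => part P T X g F σ t t x := by
  have hgm : Measurable fun p : ℝ × E × E => ENNReal.ofReal (σ * g p.2.1) := by
    have := hS.g_meas
    fun_prop
  have h1 := (hS.flow.meas_space (h := fun _ x _ => ENNReal.ofReal (σ * g x))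
    hgm ht.1 ht.2 le_rfl).comp (measurable_id.prodMk measurable_id)
  have h2 := (hS.flow.meas_int (h := fun r x _ => ENNReal.ofReal (σ * F r x)) (hS.h_meas σ)
    ht.1 ht.2).comp (measurable_id.prodMk measurable_id)
  exact h1.add h2

lemma mean (hS : SFPESol P T X g F u) [IsProbabilityMeasure P] {s t : ℝ} (hs : 0 ≤ s)
    (hst : s ≤ t) (htT : t ≤ T) (x : E) :
    Integrable (fun ω => u t (X s t x ω)) P ∧
    ENNReal.ofReal |u s x - ∫ ω, u t (X s t x ω) ∂P| ≤
      ∫⁻ r in Set.Ioc s t, ∫⁻ ω, ENNReal.ofReal |F r (X s r x ω)| ∂P := by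
  have ht : t ∈ Set.Icc 0 T := ⟨hs.trans hst, htT⟩
  have hs' : s ∈ Set.Icc 0 T := ⟨hs, hst.trans htT⟩
  have hmk : ∀ σ : ℝ, ∫⁻ ω, part P T X g F σ t t (X s t x ω) ∂P = part P T X g F σ s t x := by
    intro σ
    have hgm : Measurable fun p : ℝ × E × E => ENNReal.ofReal (σ * g p.2.1) := by
      have := hS.g_meas
      fun_prop
    exact hS.flow.markov_add (a := fun _ x _ => ENNReal.ofReal (σ * g x))
      (h := fun r x _ => ENNReal.ofReal (σ * F r x)) hgm (hS.h_meas σ) hs hst htT x x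
  have hsplit : ∀ σ : ℝ, part P T X g F σ s s x = part P T X g F σ s t x +
      ∫⁻ r in Set.Ioc s t, ∫⁻ ω, ENNReal.ofReal (σ * F r (X s r x ω)) ∂P := by
    intro σ
    unfold part
    rw [← Set.Ioc_union_Ioc_eq_Ioc hst htT,
      lintegral_union measurableSet_Ioc (Set.Ioc_disjoint_Ioc_of_le le_rfl)]
    ring
  have hfinB : ∀ σ : ℝ, |σ| ≤ 1 → part P T X g F σ s t x ≠ ⊤ := fun σ hσ =>
    ne_top_of_le_ne_top (hS.part_ne_top hs' x hσ) (by rw [hsplit]; exact le_self_add)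
  have hfinC : ∀ σ : ℝ, |σ| ≤ 1 →
      (∫⁻ r in Set.Ioc s t, ∫⁻ ω, ENNReal.ofReal (σ * F r (X s r x ω)) ∂P) ≠ ⊤ := fun σ hσ =>
    ne_top_of_le_ne_top (hS.part_ne_top hs' x hσ) (by rw [hsplit]; exact le_add_self)
  have hm : ∀ σ : ℝ, AEMeasurable (fun ω => part P T X g F σ t t (X s t x ω)) P := fun σ =>
    ((hS.part_meas ht σ).comp (hS.flow.meas s t hs hst htT x)).aemeasurable
  have hi : ∀ σ : ℝ, |σ| ≤ 1 → Integrable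
      (fun ω => (part P T X g F σ t t (X s t x ω)).toReal) P := fun σ hσ =>
    integrable_toReal_of_lintegral_ne_top (hm σ) (by rw [hmk]; exact hfinB σ hσ)
  have hIneq : ∀ σ : ℝ, |σ| ≤ 1 → ∫ ω, (part P T X g F σ t t (X s t x ω)).toReal ∂P
      = (part P T X g F σ s t x).toReal := fun σ hσ => by
    rw [integral_toReal (hm σ) (ae_lt_top' (hm σ) (by rw [hmk]; exact hfinB σ hσ)), hmk]
  have he : (fun ω => u t (X s t x ω)) = fun ω => (part P T X g F 1 t t (X s t x ω)).toReal
      - (part P T X g F (-1) t t (X s t x ω)).toReal := by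
    funext ω
    exact hS.u_eq ht _
  have o1 : |(1:ℝ)| ≤ 1 := by simp
  have o2 : |(-1:ℝ)| ≤ 1 := by simp
  refine ⟨?_, ?_⟩
  · rw [he]
    exact (hi 1 o1).sub (hi (-1) o2)
  · rw [he, integral_sub (hi 1 o1) (hi (-1) o2), hIneq 1 o1, hIneq (-1) o2, hS.u_eq hs' x, hsplit,
      hsplit, ENNReal.toReal_add (hfinB _ o1) (hfinC _ o1),
      ENNReal.toReal_add (hfinB _ o2) (hfinC _ o2)]
    set c₁ := ∫⁻ r in Set.Ioc s t, ∫⁻ ω, ENNReal.ofReal (1 * F r (X s r x ω)) ∂P with hc₁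
    set c₂ := ∫⁻ r in Set.Ioc s t, ∫⁻ ω, ENNReal.ofReal (-1 * F r (X s r x ω)) ∂P with hc₂
    set c := ∫⁻ r in Set.Ioc s t, ∫⁻ ω, ENNReal.ofReal |F r (X s r x ω)| ∂P with hc
    have l1 : c₁ ≤ c := lintegral_mono fun r => part_le 1 o1 _
    have l2 : c₂ ≤ c := lintegral_mono fun r => part_le (-1) o2 _
    have hcT : c ≠ ⊤ := ne_top_of_le_ne_top (hS.sfpe s hs' x).2.1
      (lintegral_mono_set (Set.Ioc_subset_Ioc_right htT))
    refine ENNReal.ofReal_le_of_le_toReal ?_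
    have m1 := ENNReal.toReal_mono hcT l1
    have m2 := ENNReal.toReal_mono hcT l2
    have n1 : 0 ≤ c₁.toReal := ENNReal.toReal_nonneg
    have n2 : 0 ≤ c₂.toReal := ENNReal.toReal_nonneg
    rw [abs_le']
    constructor <;> linarith

end SFPESol

lemma sfpe_holder {Ω : Type*} [MeasurableSpace Ω] {P : Measure Ω} [IsProbabilityMeasure P]
    {p₁ p₂ p₃ : ℝ≥0∞} (hp : 1 / p₁ + 1 / p₂ + 1 / p₃ ≤ 1) {a b c : Ω → ℝ}
    (ha : Measurable a) (hb : Measurable b) (hc : Measurable c) {A B C K : ℝ}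
    (hA : 0 ≤ A) (hB : 0 ≤ B) (hK : 0 ≤ K)
    (h1 : eLpNorm a p₁ P ≤ ENNReal.ofReal A) (h2 : eLpNorm b p₂ P ≤ ENNReal.ofReal B)
    (h3 : eLpNorm c p₃ P ≤ ENNReal.ofReal C) :
    ∫⁻ ω, ENNReal.ofReal (K * (a ω * b ω * c ω)) ∂P ≤ ENNReal.ofReal (K * (A * B * C)) := by
  simp only [one_div] at hp
  have : ENNReal.HolderTriple p₁ p₂ (p₁⁻¹ + p₂⁻¹)⁻¹ := ⟨by simp⟩
  have : ENNReal.HolderTriple (p₁⁻¹ + p₂⁻¹)⁻¹ p₃ (p₁⁻¹ + p₂⁻¹ + p₃⁻¹)⁻¹ := ⟨by simp⟩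
  have hab : Measurable (a • b) := ha.mul hb
  have habc : Measurable ((a • b) • c) := (ha.mul hb).mul hc
  have e1 : eLpNorm ((a • b) • c) 1 P ≤ eLpNorm ((a • b) • c) (p₁⁻¹ + p₂⁻¹ + p₃⁻¹)⁻¹ P :=
    eLpNorm_le_eLpNorm_of_exponent_le (by simpa using ENNReal.inv_le_inv.2 hp)
      habc.aestronglyMeasurable
  have e2 := eLpNorm_smul_le_mul_eLpNorm (p := (p₁⁻¹ + p₂⁻¹)⁻¹) (q := p₃)
    (r := (p₁⁻¹ + p₂⁻¹ + p₃⁻¹)⁻¹) hc.aestronglyMeasurable hab.aestronglyMeasurable (μ := P)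
  have e3 := eLpNorm_smul_le_mul_eLpNorm (p := p₁) (q := p₂)
    (r := (p₁⁻¹ + p₂⁻¹)⁻¹) hb.aestronglyMeasurable ha.aestronglyMeasurable (μ := P)
  have hm : Measurable fun ω => ENNReal.ofReal (a ω * b ω * c ω) :=
    ENNReal.measurable_ofReal.comp ((ha.mul hb).mul hc)
  simp_rw [ENNReal.ofReal_mul hK]
  rw [lintegral_const_mul _ hm]
  gcongr
  calc ∫⁻ ω, ENNReal.ofReal (a ω * b ω * c ω) ∂P
      ≤ ∫⁻ ω, ‖((a • b) • c) ω‖ₑ ∂P := by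
        refine lintegral_mono fun ω => ?_
        rw [Real.enorm_eq_ofReal_abs]
        exact ENNReal.ofReal_le_ofReal (le_abs_self _)
    _ = eLpNorm ((a • b) • c) 1 P := eLpNorm_one_eq_lintegral_enorm.symm
    _ ≤ eLpNorm a p₁ P * eLpNorm b p₂ P * eLpNorm c p₃ P :=
        e1.trans (e2.trans (by gcongr))
    _ ≤ ENNReal.ofReal A * ENNReal.ofReal B * ENNReal.ofReal C := by gcongr
    _ = _ := by rw [ENNReal.ofReal_mul (by positivity), ENNReal.ofReal_mul hA]

lemma sfpe_eLp_add {Ω : Type*} [MeasurableSpace Ω] {P : Measure Ω}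
    {p : ℝ≥0∞} (hp : 1 ≤ p) {a b : Ω → ℝ} (ha : Measurable a) (hb : Measurable b) {A B : ℝ}
    (hA : 0 ≤ A) (hB : 0 ≤ B)
    (h1 : eLpNorm a p P ≤ ENNReal.ofReal A) (h2 : eLpNorm b p P ≤ ENNReal.ofReal B) :
    eLpNorm (fun ω => a ω + b ω) p P ≤ ENNReal.ofReal (A + B) := by
  rw [ENNReal.ofReal_add hA hB]
  exact (eLpNorm_add_le ha.aestronglyMeasurable hb.aestronglyMeasurable hp).trans
    (add_le_add h1 h2)

lemma sfpe_eLp_const {Ω : Type*} [MeasurableSpace Ω] {P : Measure Ω} [IsProbabilityMeasure P]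
    {p : ℝ≥0∞} (hp : 1 ≤ p) {A : ℝ} (hA : 0 ≤ A) :
    eLpNorm (fun _ : Ω => A) p P ≤ ENNReal.ofReal A := by
  rw [eLpNorm_const _ (by positivity) (IsProbabilityMeasure.ne_zero P)]
  simp [Real.enorm_eq_ofReal_abs, abs_of_nonneg hA]

lemma sfpe_arith {L T Vs Q W ρ φs ψs n : ℝ} (hT : 0 < T) (hL : 0 ≤ L) (hV : 1 ≤ Vs) (hQ : Vs ≤ Q)
    (hφ : 2 ≤ φs) (hψ : 1 ≤ ψs) (hn : 0 ≤ n) (hρ : 0 ≤ ρ) (hρT : ρ ≤ Real.sqrt T)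
    (hW : W = Q * φs * (ψs * ρ + n)) :
    (Vs / T + L * (2 * Vs * Real.exp (L * T))) * ρ ^ 2
      + (2 * Real.sqrt T)⁻¹ * Real.exp (L * T) * W ≤
    (Real.sqrt T)⁻¹ * Real.exp (2 * L * T) * W := by
  have hsT : 0 < Real.sqrt T := Real.sqrt_pos.2 hT
  have hTT : Real.sqrt T * Real.sqrt T = T := Real.mul_self_sqrt hT.le
  have hVW : 2 * (Vs * ρ) ≤ W := by
    rw [hW]
    have h1 : ρ ≤ ψs * ρ + n := by nlinarith
    have h2 : Vs * 2 ≤ Q * φs := mul_le_mul hQ hφ (by norm_num) (by linarith)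
    calc 2 * (Vs * ρ) = Vs * 2 * ρ := by ring
      _ ≤ _ := mul_le_mul h2 h1 hρ (by nlinarith)
  have hW0 : 0 ≤ W := le_trans (by positivity) hVW
  have he1 : L * T + 1 ≤ Real.exp (L * T) := Real.add_one_le_exp _
  have he2 : Real.exp (2 * L * T) = Real.exp (L * T) * Real.exp (L * T) := by
    rw [← Real.exp_add]; congr 1; ring
  have hLT : 0 ≤ L * T := by positivity
  set e := Real.exp (L * T)
  have h1 : (Vs / T + L * (2 * Vs * e)) * ρ ^ 2 ≤
      (Real.sqrt T)⁻¹ * ((1 + 2 * (L * T) * e) * (W / 2)) := by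
    have : (Vs / T + L * (2 * Vs * e)) * ρ ^ 2 = (1 + 2 * (L * T) * e) * (Vs * ρ) * (ρ / T) := by
      field_simp
    rw [this]
    have h3 : ρ / T ≤ (Real.sqrt T)⁻¹ := by
      rw [div_le_iff₀ hT, inv_mul_eq_div, le_div_iff₀ hsT]
      nlinarith
    calc (1 + 2 * (L * T) * e) * (Vs * ρ) * (ρ / T)
        ≤ (1 + 2 * (L * T) * e) * (W / 2) * (Real.sqrt T)⁻¹ := by
          gcongr
          linarith
      _ = _ := by ring
  refine (add_le_add h1 le_rfl).trans ?_
  have h4 : (1 + 2 * (L * T) * e) + e ≤ 2 * (e * e) := by nlinarith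
  rw [he2]
  have : (Real.sqrt T)⁻¹ * ((1 + 2 * (L * T) * e) * (W / 2)) + (2 * Real.sqrt T)⁻¹ * e * W
     = (Real.sqrt T)⁻¹ * (W / 2) * ((1 + 2 * (L * T) * e) + e) := by
    rw [mul_inv]; ring
  rw [this]
  calc _ ≤ (Real.sqrt T)⁻¹ * (W / 2) * (2 * (e * e)) := by gcongr
    _ = _ := by ring

/-- Hölder continuity of SFPE solutions: under the SFPE setting with hypotheses
(H1)–(H5), the measurable solution `u` of the SFPE with at most `V`-growth satisfies
`|u(s,x) − u(t,y)| ≤ T^{−1/2} e^{2LT}(V(s,x)+V(t,y))(φ(s,x)+φ(t,y))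
[ψ(s,x)|s−t|^{1/2} + ‖x−y‖]` for all `0 ≤ s ≤ t ≤ T`, `x,y ∈ ℝ^d`. -/
theorem stmt_6
    {Ω : Type*} [MeasurableSpace Ω] (P : Measure Ω) [IsProbabilityMeasure P]
    (d : ℕ) (L T : ℝ) (hL : 0 ≤ L) (hT : 0 < T)
    (p₁ p₂ p₃ : ℝ≥0∞) (hp₁ : 1 ≤ p₁) (hp₂ : 1 ≤ p₂) (hp₃ : 1 ≤ p₃)
    (hp : 1 / p₁ + 1 / p₂ + 1 / p₃ ≤ 1)
    (nrm : (Fin d → ℝ) → ℝ)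
    (hnrm_tri : ∀ x y, nrm (x + y) ≤ nrm x + nrm y)
    (hnrm_smul : ∀ (a : ℝ) x, nrm (a • x) = |a| * nrm x)
    (hnrm_def : ∀ x, nrm x = 0 → x = 0)
    (f : ℝ → (Fin d → ℝ) → ℝ → ℝ)
    (hf_meas : Measurable fun p : ℝ × (Fin d → ℝ) × ℝ => f p.1 p.2.1 p.2.2)
    (g : (Fin d → ℝ) → ℝ) (hg_meas : Measurable g)
    (φ V ψ : ℝ → (Fin d → ℝ) → ℝ)
    (hφ_meas : Measurable fun p : ℝ × (Fin d → ℝ) => φ p.1 p.2)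
    (hV_meas : Measurable fun p : ℝ × (Fin d → ℝ) => V p.1 p.2)
    (hψ_meas : Measurable fun p : ℝ × (Fin d → ℝ) => ψ p.1 p.2)
    (hφ1 : ∀ t ∈ Set.Icc (0:ℝ) T, ∀ x, 1 ≤ φ t x)
    (hV1 : ∀ t ∈ Set.Icc (0:ℝ) T, ∀ x, 1 ≤ V t x)
    (hψ1 : ∀ t ∈ Set.Icc (0:ℝ) T, ∀ x, 1 ≤ ψ t x)
    (X : ℝ → ℝ → (Fin d → ℝ) → Ω → (Fin d → ℝ))
    (hX_meas : ∀ s ∈ Set.Icc (0:ℝ) T, ∀ x,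
      Measurable fun p : Set.Icc s T × Ω => X s (p.1 : ℝ) x p.2)
    (hjoint : ∀ h : ℝ → (Fin d → ℝ) → (Fin d → ℝ) → ℝ≥0∞,
      (Measurable fun p : ℝ × (Fin d → ℝ) × (Fin d → ℝ) => h p.1 p.2.1 p.2.2) →
      Measurable fun q : {p : ℝ × ℝ // 0 ≤ p.1 ∧ p.1 ≤ p.2 ∧ p.2 ≤ T}
          × (Fin d → ℝ) × (Fin d → ℝ) =>
        ∫⁻ ω, h (q.1 : ℝ × ℝ).2 (X (q.1 : ℝ × ℝ).1 (q.1 : ℝ × ℝ).2 q.2.1 ω)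
          (X (q.1 : ℝ × ℝ).1 (q.1 : ℝ × ℝ).2 q.2.2 ω) ∂P)
    -- (H1)
    (hH1 : ∀ s t : ℝ, 0 ≤ s → s ≤ t → t ≤ T → ∀ x,
      (if s = T then |g x| else 0) ≤ V s x ∧
      |T * f s x 0| ≤ V s x ∧
      eLpNorm (fun ω => V t (X s t x ω)) p₁ P ≤ ENNReal.ofReal (V s x) ∧
      eLpNorm (fun ω => φ t (X s t x ω)) p₃ P ≤ ENNReal.ofReal (φ s x))
    -- (H2)
    (hH2 : ∀ x y, |g x - g y| ≤ (2 * Real.sqrt T)⁻¹ * (V T x + V T y) * nrm (x - y))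
    -- (H3)
    (hH3 : ∀ t ∈ Set.Icc (0:ℝ) T, ∀ x y v w,
      |f t x v - f t y w| ≤ L * |v - w|
        + (2 * T ^ ((3:ℝ)/2))⁻¹ * (V t x + V t y) * nrm (x - y))
    -- (H4)
    (hH4 : ∀ s t : ℝ, 0 ≤ s → s ≤ t → t ≤ T → ∀ x y,
      eLpNorm (fun ω => nrm (X s t x ω - x)) p₂ P
        ≤ ENNReal.ofReal (ψ s x * |s - t| ^ ((1:ℝ)/2)) ∧
      eLpNorm (fun ω => nrm (X s t x ω - X s t y ω)) p₂ P
        ≤ ENNReal.ofReal (2⁻¹ * (φ s x + φ s y) * nrm (x - y)))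
    -- (H5)
    (hH5 : ∀ h : ℝ → (Fin d → ℝ) → (Fin d → ℝ) → ℝ≥0∞,
      (Measurable fun p : ℝ × (Fin d → ℝ) × (Fin d → ℝ) => h p.1 p.2.1 p.2.2) →
      ∀ s t r : ℝ, 0 ≤ s → s ≤ t → t ≤ r → r ≤ T → ∀ x y,
        ∫⁻ ω, (∫⁻ ω', h r (X t r (X s t x ω) ω') (X t r (X s t y ω) ω') ∂P) ∂P
          = ∫⁻ ω, h r (X s r x ω) (X s r y ω) ∂P)
    (u : ℝ → (Fin d → ℝ) → ℝ)
    (hu_meas : Measurable fun p : ℝ × (Fin d → ℝ) => u p.1 p.2)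
    (hu_growth : ∃ C : ℝ, ∀ r ∈ Set.Icc (0:ℝ) T, ∀ ξ, |u r ξ| ≤ C * V r ξ)
    (hu_sfpe : ∀ t ∈ Set.Icc (0:ℝ) T, ∀ x,
      (∫⁻ ω, ENNReal.ofReal |g (X t T x ω)| ∂P) ≠ ⊤ ∧
      (∫⁻ r in Set.Ioc t T,
        ∫⁻ ω, ENNReal.ofReal |f r (X t r x ω) (u r (X t r x ω))| ∂P) ≠ ⊤ ∧
      u t x = (∫ ω, g (X t T x ω) ∂P)
        + ∫ r in t..T, ∫ ω, f r (X t r x ω) (u r (X t r x ω)) ∂P) :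
    ∀ s t : ℝ, 0 ≤ s → s ≤ t → t ≤ T → ∀ x y,
      |u s x - u t y| ≤ (Real.sqrt T)⁻¹ * Real.exp (2 * L * T)
        * (V s x + V t y) * (φ s x + φ t y)
        * (ψ s x * |s - t| ^ ((1:ℝ)/2) + nrm (x - y)) := by
  have nz : nrm 0 = 0 := by simpa using hnrm_smul 0 0
  have nneg : ∀ x, nrm (-x) = nrm x := fun x => by simpa using hnrm_smul (-1) x
  have nn : ∀ x, 0 ≤ nrm x := fun x => by
    have := hnrm_tri x (-x)
    rw [add_neg_cancel, nz, nneg] at this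
    linarith
  have nmeas : Measurable nrm := by
    have hconv : ConvexOn ℝ Set.univ nrm := by
      refine ⟨convex_univ, fun x _ y _ a b ha hb _ => ?_⟩
      refine (hnrm_tri _ _).trans ?_
      rw [hnrm_smul, hnrm_smul, abs_of_nonneg ha, abs_of_nonneg hb]
      simp
    exact (continuousOn_univ.1 (hconv.continuousOn isOpen_univ)).measurable
  have hXm : ∀ s t : ℝ, 0 ≤ s → s ≤ t → t ≤ T → ∀ x, Measurable (X s t x) := by
    intro s t hs hst ht x
    exact (hX_meas s ⟨hs, hst.trans ht⟩ x).comp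
      ((measurable_const (a := (⟨t, hst, ht⟩ : Set.Icc s T))).prodMk measurable_id)
  have flow : SFPEFlow P T X := ⟨hXm, hjoint, hH5⟩
  have sol : SFPESol P T X g (fun r ξ => f r ξ (u r ξ)) u := by
    refine ⟨flow, hg_meas, ?_, hu_sfpe⟩
    exact hf_meas.comp (measurable_fst.prodMk (measurable_snd.prodMk hu_meas))
  have hVm : ∀ s t : ℝ, 0 ≤ s → s ≤ t → t ≤ T → ∀ x, Measurable fun ω => V t (X s t x ω) :=
    fun s t hs hst ht x => hV_meas.comp (measurable_const.prodMk (hXm s t hs hst ht x))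
  have hφm : ∀ s t : ℝ, 0 ≤ s → s ≤ t → t ≤ T → ∀ x, Measurable fun ω => φ t (X s t x ω) :=
    fun s t hs hst ht x => hφ_meas.comp (measurable_const.prodMk (hXm s t hs hst ht x))
  have hV0 : ∀ t ∈ Set.Icc (0:ℝ) T, ∀ x, 0 ≤ V t x :=
    fun t ht x => zero_le_one.trans (hV1 t ht x)
  have hφ0 : ∀ t ∈ Set.Icc (0:ℝ) T, ∀ x, 0 ≤ φ t x :=
    fun t ht x => zero_le_one.trans (hφ1 t ht x)
  -- moment bound for `V`
  have hVint : ∀ s t : ℝ, 0 ≤ s → s ≤ t → t ≤ T → ∀ x, ∀ K : ℝ, 0 ≤ K →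
      ∫⁻ ω, ENNReal.ofReal (K * V t (X s t x ω)) ∂P ≤ ENNReal.ofReal (K * V s x) := by
    intro s t hs hst ht x K hK
    have := sfpe_holder hp (hVm s t hs hst ht x) (measurable_const (a := (1:ℝ)))
      (measurable_const (a := (1:ℝ))) (hV0 s ⟨hs, hst.trans ht⟩ x) zero_le_one hK
      (hH1 s t hs hst ht x).2.2.1 (sfpe_eLp_const hp₂ zero_le_one)
      (sfpe_eLp_const hp₃ zero_le_one)
    simpa using this
  -- growth bound
  have key1 : ∀ s : ℝ, 0 ≤ s → ∀ x, ∀ t ∈ Set.Icc s T,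
      ∫⁻ ω, ENNReal.ofReal |u t (X s t x ω)| ∂P
        ≤ ENNReal.ofReal (2 * V s x * Real.exp (L * (T - t))) := by
    intro s hs x t ht
    obtain ⟨C, hC⟩ := hu_growth
    have hsT : s ≤ T := ht.1.trans ht.2
    have hsI : s ∈ Set.Icc 0 T := ⟨hs, hsT⟩
    refine flow.gronwall (D := fun r x _ => ENNReal.ofReal |u r x|)
      (a := fun _ x _ => ENNReal.ofReal |g x|) (b := fun r x _ => ENNReal.ofReal |f r x 0|)
      ?_ ?_ ?_ hL (hV0 s hsI x) (C := |C| * V s x) (mul_nonneg (abs_nonneg _) (hV0 s hsI x)) hT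
      ?_ hs x x ?_ ?_ ?_ t ht
    · exact ENNReal.measurable_ofReal.comp (Measurable.abs (hu_meas.comp
        (measurable_fst.prodMk (measurable_fst.comp measurable_snd))))
    · exact ENNReal.measurable_ofReal.comp (Measurable.abs (hg_meas.comp
        (measurable_fst.comp measurable_snd)))
    · exact ENNReal.measurable_ofReal.comp (Measurable.abs (hf_meas.comp
        (measurable_fst.prodMk ((measurable_fst.comp measurable_snd).prodMk measurable_const))))
    · intro t ht x _
      refine (sol.abs_le ht x).trans (add_le_add le_rfl ?_)
      refine setLIntegral_mono' measurableSet_Ioc fun r hr => lintegral_mono fun ω => ?_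
      rw [← ENNReal.ofReal_mul hL, ← ENNReal.ofReal_add (abs_nonneg _) (by positivity)]
      refine ENNReal.ofReal_le_ofReal ?_
      have h := hH3 r ⟨ht.1.trans hr.1.le, hr.2⟩ (X t r x ω) (X t r x ω) (u r (X t r x ω)) 0
      rw [sub_self, nz, mul_zero, add_zero, sub_zero] at h
      have := abs_sub_abs_le_abs_sub (f r (X t r x ω) (u r (X t r x ω))) (f r (X t r x ω) 0)
      linarith
    · refine le_trans (lintegral_mono fun ω => ENNReal.ofReal_le_ofReal ?_)
        ((hVint s T hs hsT le_rfl x 1 zero_le_one).trans_eq (by rw [one_mul]))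
      have := (hH1 T T hT.le le_rfl le_rfl (X s T x ω)).1
      simpa using this
    · intro r hr
      refine le_trans (lintegral_mono fun ω => ENNReal.ofReal_le_ofReal ?_)
        ((hVint s r hs hr.1 hr.2 x T⁻¹ (by positivity)).trans_eq (by
          rw [div_eq_inv_mul]))
      have := (hH1 r T (hs.trans hr.1) hr.2 le_rfl (X s r x ω)).2.1
      rw [abs_mul, abs_of_pos hT] at this
      rw [inv_mul_eq_div, le_div_iff₀ hT]
      linarith
    · intro r hr
      refine le_trans (lintegral_mono fun ω => ENNReal.ofReal_le_ofReal ?_)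
        (hVint s r hs hr.1 hr.2 x |C| (abs_nonneg _))
      have hrI : r ∈ Set.Icc 0 T := ⟨hs.trans hr.1, hr.2⟩
      exact (hC r hrI _).trans (mul_le_mul_of_nonneg_right (le_abs_self C) (hV0 r hrI _))
  -- spatial regularity
  have key2 : ∀ s ∈ Set.Icc (0:ℝ) T, ∀ x y, |u s x - u s y| ≤
      (2 * Real.sqrt T)⁻¹ * Real.exp (L * T) *
        ((V s x + V s y) * nrm (x - y) * (φ s x + φ s y)) := by
    intro s hsI x y
    obtain ⟨hs, hsT⟩ := hsI
    have hsI : s ∈ Set.Icc 0 T := ⟨hs, hsT⟩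
    have hVV : 0 ≤ V s x + V s y := add_nonneg (hV0 s hsI x) (hV0 s hsI y)
    have hφφ : 0 ≤ φ s x + φ s y := add_nonneg (hφ0 s hsI x) (hφ0 s hsI y)
    have hXn : ∀ r ∈ Set.Icc s T, ∀ K : ℝ, 0 ≤ K →
        ∫⁻ ω, ENNReal.ofReal (K * (V r (X s r x ω) + V r (X s r y ω)) *
          nrm (X s r x ω - X s r y ω)) ∂P ≤ ENNReal.ofReal (K * ((V s x + V s y) *
            (2⁻¹ * (φ s x + φ s y) * nrm (x - y)))) := by
      intro r hr K hK
      have := sfpe_holder hp ((hVm s r hs hr.1 hr.2 x).add (hVm s r hs hr.1 hr.2 y))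
        (nmeas.comp ((hXm s r hs hr.1 hr.2 x).sub (hXm s r hs hr.1 hr.2 y)))
        (measurable_const (a := (1:ℝ))) hVV
        (mul_nonneg (mul_nonneg (by norm_num) hφφ) (nn (x - y))) hK
        (sfpe_eLp_add hp₁ (hVm s r hs hr.1 hr.2 x) (hVm s r hs hr.1 hr.2 y) (hV0 s hsI x)
          (hV0 s hsI y) (hH1 s r hs hr.1 hr.2 x).2.2.1 (hH1 s r hs hr.1 hr.2 y).2.2.1)
        (hH4 s r hs hr.1 hr.2 x y).2 (sfpe_eLp_const hp₃ zero_le_one)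
      simpa [mul_assoc] using this
    have hsq : 0 < Real.sqrt T := Real.sqrt_pos.2 hT
    have hT32 : (2 * T ^ ((3:ℝ)/2))⁻¹ = (2 * Real.sqrt T)⁻¹ / T := by
      have : T ^ ((3:ℝ)/2) = Real.sqrt T * T := by
        rw [Real.sqrt_eq_rpow]
        nth_rewrite 3 [← Real.rpow_one T]
        rw [← Real.rpow_add hT]
        norm_num
      rw [this]
      field_simp
    set α := (2 * Real.sqrt T)⁻¹ * ((V s x + V s y) *
            (2⁻¹ * (φ s x + φ s y) * nrm (x - y))) with hα
    have hα0 : 0 ≤ α := mul_nonneg (by positivity) (mul_nonneg hVV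
      (mul_nonneg (mul_nonneg (by norm_num) hφφ) (nn (x - y))))
    have hum : ∀ r ∈ Set.Icc s T, ∀ z, Measurable fun ω => ENNReal.ofReal |u r (X s r z ω)| :=
      fun r hr z => ENNReal.measurable_ofReal.comp (Measurable.abs
        (hu_meas.comp (measurable_const.prodMk (hXm s r hs hr.1 hr.2 z))))
    have main := flow.gronwall (D := fun r x y => ENNReal.ofReal |u r x - u r y|)
      (a := fun _ x y => ENNReal.ofReal |g x - g y|)
      (b := fun r x y => ENNReal.ofReal ((2 * T ^ ((3:ℝ)/2))⁻¹ * (V r x + V r y) * nrm (x - y)))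
      (ENNReal.measurable_ofReal.comp (Measurable.abs ((hu_meas.comp
        (measurable_fst.prodMk (measurable_fst.comp measurable_snd))).sub (hu_meas.comp
        (measurable_fst.prodMk (measurable_snd.comp measurable_snd))))))
      (ENNReal.measurable_ofReal.comp (Measurable.abs ((hg_meas.comp
        (measurable_fst.comp measurable_snd)).sub (hg_meas.comp
        (measurable_snd.comp measurable_snd)))))
      (ENNReal.measurable_ofReal.comp ((((hV_meas.comp
        (measurable_fst.prodMk (measurable_fst.comp measurable_snd))).add (hV_meas.comp
        (measurable_fst.prodMk (measurable_snd.comp measurable_snd)))).const_mul _).mul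
        (nmeas.comp ((measurable_fst.comp measurable_snd).sub
          (measurable_snd.comp measurable_snd)))))
      hL hα0 (C := 2 * V s x * Real.exp (L * T) + 2 * V s y * Real.exp (L * T))
      (add_nonneg (mul_nonneg (mul_nonneg (by norm_num) (hV0 s hsI x)) (Real.exp_pos _).le)
        (mul_nonneg (mul_nonneg (by norm_num) (hV0 s hsI y)) (Real.exp_pos _).le)) hT
      (by
        intro t ht x y
        refine (sol.diff_le ht x y).trans (add_le_add le_rfl ?_)
        refine setLIntegral_mono' measurableSet_Ioc fun r hr => lintegral_mono fun ω => ?_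
        have hrI : r ∈ Set.Icc 0 T := ⟨ht.1.trans hr.1.le, hr.2⟩
        rw [← ENNReal.ofReal_mul hL, ← ENNReal.ofReal_add (mul_nonneg (mul_nonneg (by positivity)
          (add_nonneg (hV0 r hrI _) (hV0 r hrI _))) (nn _)) (by positivity)]
        refine ENNReal.ofReal_le_ofReal ?_
        have h := hH3 r hrI (X t r x ω) (X t r y ω) (u r (X t r x ω)) (u r (X t r y ω))
        linarith)
      hs x y
      (by
        refine le_trans (lintegral_mono fun ω => ENNReal.ofReal_le_ofReal (hH2 _ _)) ?_
        exact hXn T ⟨hsT, le_rfl⟩ _ (by positivity))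
      (by
        intro r hr
        refine (hXn r hr _ (by positivity)).trans_eq ?_
        rw [hT32, hα]
        congr 1
        ring)
      (by
        intro r hr
        have hexp : ∀ z, 2 * V s z * Real.exp (L * (T - r)) ≤ 2 * V s z * Real.exp (L * T) := by
          intro z
          refine mul_le_mul_of_nonneg_left (Real.exp_le_exp.2 ?_)
            (mul_nonneg (by norm_num) (hV0 s hsI z))
          exact mul_le_mul_of_nonneg_left (by linarith [hr.1]) hL
        calc ∫⁻ ω, ENNReal.ofReal |u r (X s r x ω) - u r (X s r y ω)| ∂P
            ≤ ∫⁻ ω, (ENNReal.ofReal |u r (X s r x ω)| + ENNReal.ofReal |u r (X s r y ω)|) ∂P := by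
              refine lintegral_mono fun ω => ?_
              rw [sub_eq_add_neg, ← abs_neg (u r (X s r y ω))]
              exact sfpe_ofReal_abs_add _ _
          _ ≤ _ := by
              rw [lintegral_add_left (hum r hr x), ENNReal.ofReal_add
                (mul_nonneg (mul_nonneg (by norm_num) (hV0 s hsI x)) (Real.exp_pos _).le)
                (mul_nonneg (mul_nonneg (by norm_num) (hV0 s hsI y)) (Real.exp_pos _).le)]
              exact add_le_add
                ((key1 s hs x r hr).trans (ENNReal.ofReal_le_ofReal (hexp x)))
                ((key1 s hs y r hr).trans (ENNReal.ofReal_le_ofReal (hexp y))))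
      s ⟨le_rfl, hsT⟩
    have hXs : ∀ z, ∀ᵐ ω ∂P, X s s z ω = z := by
      intro z
      have h := (hH4 s s hs le_rfl hsT z z).1
      have hm : Measurable fun ω => nrm (X s s z ω - z) :=
        nmeas.comp ((hXm s s hs le_rfl hsT z).sub measurable_const)
      rw [sub_self, abs_zero, Real.zero_rpow (by norm_num), mul_zero, ENNReal.ofReal_zero,
        nonpos_iff_eq_zero, eLpNorm_eq_zero_iff hm.aestronglyMeasurable
          (zero_lt_one.trans_le hp₂).ne'] at h
      filter_upwards [h] with ω hω
      exact sub_eq_zero.1 (hnrm_def _ hω)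
    have hconst : ∫⁻ ω, ENNReal.ofReal |u s (X s s x ω) - u s (X s s y ω)| ∂P
        = ENNReal.ofReal |u s x - u s y| := by
      rw [lintegral_congr_ae (g := fun _ => ENNReal.ofReal |u s x - u s y|)]
      · simp
      · filter_upwards [hXs x, hXs y] with ω h1 h2
        rw [h1, h2]
    rw [hconst] at main
    rw [ENNReal.ofReal_le_ofReal_iff (mul_nonneg (by positivity) (Real.exp_pos _).le)] at main
    refine main.trans ?_
    calc 2 * α * Real.exp (L * (T - s)) ≤ 2 * α * Real.exp (L * T) := by
          refine mul_le_mul_of_nonneg_left (Real.exp_le_exp.2 ?_) (by positivity)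
          exact mul_le_mul_of_nonneg_left (by linarith) hL
      _ = _ := by rw [hα]; ring
  -- conclusion
  intro s t hs hst htT x y
  have hsT := hst.trans htT
  have hsI : s ∈ Set.Icc 0 T := ⟨hs, hsT⟩
  have htI : t ∈ Set.Icc 0 T := ⟨hs.trans hst, htT⟩
  obtain ⟨hui, hmean⟩ := sol.mean hs hst htT x
  set ρ := |s - t| ^ ((1:ℝ)/2) with hρ
  have hst' : |s - t| = t - s := by rw [abs_sub_comm, abs_of_nonneg (by linarith)]
  have hρ0 : 0 ≤ ρ := by positivity
  have hρs : ρ = Real.sqrt (t - s) := by rw [hρ, hst', Real.sqrt_eq_rpow]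
  have hρ2 : ρ ^ 2 = t - s := by rw [hρs, Real.sq_sqrt (by linarith)]
  have hρT : ρ ≤ Real.sqrt T := by
    rw [hρs]; exact Real.sqrt_le_sqrt (by linarith)
  have hVs := hV1 s hsI x
  have hVt := hV1 t htI y
  have hφs := hφ1 s hsI x
  have hφt := hφ1 t htI y
  have hψs := hψ1 s hsI x
  have hB0 : 0 ≤ V s x / T + L * (2 * V s x * Real.exp (L * T)) := by positivity
  have b1 : |u s x - ∫ ω, u t (X s t x ω) ∂P| ≤
      (V s x / T + L * (2 * V s x * Real.exp (L * T))) * ρ ^ 2 := by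
    rw [hρ2, ← ENNReal.ofReal_le_ofReal_iff (mul_nonneg hB0 (by linarith))]
    refine hmean.trans ?_
    rw [ENNReal.ofReal_mul hB0, ← Real.volume_Ioc, ← setLIntegral_const]
    refine setLIntegral_mono' measurableSet_Ioc fun r hr => ?_
    have hr' : r ∈ Set.Icc s T := ⟨hr.1.le, hr.2.trans htT⟩
    have hrI : r ∈ Set.Icc 0 T := ⟨hs.trans hr'.1, hr'.2⟩
    have hum : Measurable fun ω => ENNReal.ofReal |u r (X s r x ω)| :=
      ENNReal.measurable_ofReal.comp (Measurable.abs
        (hu_meas.comp (measurable_const.prodMk (hXm s r hs hr'.1 hr'.2 x))))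
    calc ∫⁻ ω, ENNReal.ofReal |f r (X s r x ω) (u r (X s r x ω))| ∂P
        ≤ ∫⁻ ω, (ENNReal.ofReal L * ENNReal.ofReal |u r (X s r x ω)|
            + ENNReal.ofReal (T⁻¹ * V r (X s r x ω))) ∂P := by
          refine lintegral_mono fun ω => ?_
          rw [← ENNReal.ofReal_mul hL, ← ENNReal.ofReal_add (by positivity)
            (mul_nonneg (by positivity) (hV0 r hrI _))]
          refine ENNReal.ofReal_le_ofReal ?_
          have h := hH3 r hrI (X s r x ω) (X s r x ω) (u r (X s r x ω)) 0
          rw [sub_self, nz, mul_zero, add_zero, sub_zero] at h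
          have h2 := abs_sub_abs_le_abs_sub (f r (X s r x ω) (u r (X s r x ω)))
            (f r (X s r x ω) 0)
          have h3 := (hH1 r T hrI.1 hrI.2 le_rfl (X s r x ω)).2.1
          rw [abs_mul, abs_of_pos hT] at h3
          have h4 : |f r (X s r x ω) 0| ≤ T⁻¹ * V r (X s r x ω) := by
            rw [inv_mul_eq_div, le_div_iff₀ hT]
            linarith
          linarith
      _ ≤ ENNReal.ofReal L * ENNReal.ofReal (2 * V s x * Real.exp (L * T))
            + ENNReal.ofReal (T⁻¹ * V s x) := by
          rw [lintegral_add_left (hum.const_mul _), lintegral_const_mul _ hum]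
          refine add_le_add ?_ (hVint s r hs hr'.1 hr'.2 x T⁻¹ (by positivity))
          refine mul_le_mul_right ((key1 s hs x r hr').trans (ENNReal.ofReal_le_ofReal ?_)) _
          refine mul_le_mul_of_nonneg_left (Real.exp_le_exp.2 ?_) (by positivity)
          exact mul_le_mul_of_nonneg_left (by linarith [hrI.1]) hL
      _ = _ := by
          rw [← ENNReal.ofReal_mul hL, ← ENNReal.ofReal_add (by positivity) (by positivity)]
          congr 1
          ring
  have b2 : |(∫ ω, u t (X s t x ω) ∂P) - u t y| ≤ (2 * Real.sqrt T)⁻¹ * Real.exp (L * T) *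
      ((V s x + V t y) * (ψ s x * ρ + nrm (x - y)) * (φ s x + φ t y)) := by
    have hn0 := nn (x - y)
    rw [← ENNReal.ofReal_le_ofReal_iff (by positivity)]
    have he : (∫ ω, u t (X s t x ω) ∂P) - u t y = ∫ ω, (u t (X s t x ω) - u t y) ∂P := by
      rw [integral_sub hui (integrable_const _)]
      simp
    rw [he]
    refine (sfpe_ofReal_abs_integral _).trans ?_
    refine (lintegral_mono fun ω => ENNReal.ofReal_le_ofReal
      ((key2 t htI (X s t x ω) y).trans ?_)).trans
      (sfpe_holder hp ((hVm s t hs hst htT x).add (measurable_const (a := V t y)))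
        ((nmeas.comp ((hXm s t hs hst htT x).sub (measurable_const (a := x)))).add
          (measurable_const (a := nrm (x - y))))
        ((hφm s t hs hst htT x).add (measurable_const (a := φ t y)))
        (by positivity) (by positivity) (by positivity)
        (sfpe_eLp_add hp₁ (hVm s t hs hst htT x) measurable_const (by positivity) (by positivity)
          (hH1 s t hs hst htT x).2.2.1 (sfpe_eLp_const hp₁ (by positivity)))
        (sfpe_eLp_add hp₂ (nmeas.comp ((hXm s t hs hst htT x).sub measurable_const))
          measurable_const (by positivity) hn0 (hH4 s t hs hst htT x x).1
          (sfpe_eLp_const hp₂ hn0))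
        (sfpe_eLp_add hp₃ (hφm s t hs hst htT x) measurable_const (by positivity) (by positivity)
          (hH1 s t hs hst htT x).2.2.2 (sfpe_eLp_const hp₃ (by positivity))))
    refine mul_le_mul_of_nonneg_left ?_ (by positivity)
    refine mul_le_mul_of_nonneg_right ?_ (add_nonneg (hφ0 t htI _) (hφ0 t htI _))
    refine mul_le_mul_of_nonneg_left ?_ (add_nonneg (hV0 t htI _) (hV0 t htI _))
    have := hnrm_tri (X s t x ω - x) (x - y)
    rwa [sub_add_sub_cancel] at this
  have b3 := sfpe_arith (W := (V s x + V t y) * (φ s x + φ t y) * (ψ s x * ρ + nrm (x - y)))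
    hT hL hVs (Q := V s x + V t y) (by linarith) (φs := φ s x + φ t y) (by linarith) hψs
    (nn (x - y)) hρ0 hρT rfl
  have b4 := abs_sub_le (u s x) (∫ ω, u t (X s t x ω) ∂P) (u t y)
  calc |u s x - u t y| ≤ _ := b4.trans (add_le_add b1 b2)
    _ ≤ _ := by
      refine le_trans (le_of_eq ?_) (b3.trans (le_of_eq ?_))
      · ring
      · ring
end

section
/- Under the stochastic fixed-point equation (SFPE) setting with hypotheses (H1)–(H5), the unique measurable solution u : [0,T]×ℝ^d → ℝ of the SFPE u(t,x) = E[g(X^x_{t,T})] + ∫_t^T E[f(r, X^x_{t,r}, u(r, X^x_{t,r}))] dr (with sup_{r,ξ} |u(r,ξ)|/V(r,ξ) < ∞) satisfies the flow identity: for all 0 ≤ s ≤ t ≤ T and x ∈ ℝ^d it holds that u(s,x) − E[u(t, X^x_{s,t})] = ∫_s^t E[f(r, X^x_{s,r}, u(r, X^x_{s,r}))] dr. -/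
open MeasureTheory ProbabilityTheory
open scoped ENNReal

/-- Integral against a mixture of measures. -/
theorem aux_bind {E : Type*} [MeasurableSpace E] (μ lam : Measure E)
    (η : Kernel E E)
    (hlam : ∀ A, MeasurableSet A → lam A = ∫⁻ y, η y A ∂μ)
    (F : E → ℝ) (hF : Integrable F lam) :
    Integrable (fun y => ∫ z, F z ∂η y) μ ∧
    ∫ y, ∫ z, F z ∂η y ∂μ = ∫ z, F z ∂lam := by
  have h1 : lam = (η ∘ₖ (Kernel.const Unit μ)) () := by
    ext A hA
    rw [hlam A hA, Kernel.comp_apply' _ _ _ hA, Kernel.const_apply]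
  rw [h1] at hF ⊢
  refine ⟨?_, ?_⟩
  · simpa using hF.integral_comp
  · rw [Kernel.integral_comp hF, Kernel.const_apply]

/-- Fubini for a parametrised mixture of measures. -/
theorem aux_fubini {ι E : Type*} [MeasurableSpace ι] [MeasurableSpace E]
    (ν : Measure ι) [SFinite ν] (μ : Measure E) [SFinite μ]
    (η : Kernel (ι × E) E) [IsSFiniteKernel η] (lam : ι → Measure E)
    (hlam : ∀ r A, MeasurableSet A → lam r A = ∫⁻ y, η (r, y) A ∂μ)
    (F : ι → E → ℝ) (hF : Measurable fun p : ι × E => F p.1 p.2)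
    (hfin : ∫⁻ r, ∫⁻ z, ‖F r z‖ₑ ∂lam r ∂ν ≠ ⊤) :
    Integrable (fun y => ∫ r, ∫ z, F r z ∂η (r, y) ∂ν) μ ∧
    ∫ y, ∫ r, ∫ z, F r z ∂η (r, y) ∂ν ∂μ = ∫ r, ∫ z, F r z ∂lam r ∂ν := by
  let ηr : ι → Kernel E E := fun r => η.comap (fun y => (r, y)) (by fun_prop)
  have hηr : ∀ r, lam r = (ηr r ∘ₖ (Kernel.const Unit μ)) () := by
    intro r
    ext A hA
    rw [hlam r A hA, Kernel.comp_apply' _ _ _ hA, Kernel.const_apply]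
    simp [ηr, Kernel.comap_apply]
  have hF3 : Measurable (fun p : (ι × E) × E => F p.1.1 p.2) :=
    hF.comp (by fun_prop : Measurable fun p : (ι × E) × E => (p.1.1, p.2))
  have hFr : ∀ r, Measurable (F r) := fun r => hF.comp (by fun_prop : Measurable fun z => (r, z))
  have hlin : ∀ r, ∫⁻ z, ‖F r z‖ₑ ∂lam r = ∫⁻ y, ∫⁻ z, ‖F r z‖ₑ ∂η (r, y) ∂μ := by
    intro r
    rw [hηr r, Kernel.lintegral_comp _ _ _ (hFr r).enorm, Kernel.const_apply]
    simp [ηr, Kernel.comap_apply]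
  have hmeasI : Measurable fun p : ι × E => ∫⁻ z, ‖F p.1 z‖ₑ ∂η p :=
    Measurable.lintegral_kernel_prod_right' (κ := η) (f := fun p => ‖F p.1.1 p.2‖ₑ) hF3.enorm
  have hint : Integrable (fun p : (ι × E) × E => F p.1.1 p.2) ((ν.prod μ) ⊗ₘ η) := by
    refine ⟨hF3.aestronglyMeasurable, ?_⟩
    rw [HasFiniteIntegral, Measure.lintegral_compProd hF3.enorm,
      lintegral_prod _ hmeasI.aemeasurable]
    simp_rw [← hlin]
    exact hfin.lt_top
  have hint2 : Integrable (fun p : ι × E => ∫ z, F p.1 z ∂η p) (ν.prod μ) := by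
    have := hint.integral_compProd
    simpa using this
  refine ⟨hint2.integral_prod_right, ?_⟩
  rw [← integral_prod_symm (fun p : ι × E => ∫ z, F p.1 z ∂η p) hint2,
    integral_prod _ hint2]
  have hae : ∀ᵐ r ∂ν, ∫⁻ z, ‖F r z‖ₑ ∂lam r < ⊤ := by
    refine ae_lt_top ?_ hfin
    simp_rw [hlin]
    exact hmeasI.lintegral_prod_right'
  refine integral_congr_ae ?_
  filter_upwards [hae] with r hr
  have hi : Integrable (F r) (lam r) := ⟨(hFr r).aestronglyMeasurable, hr⟩
  have := (aux_bind μ (lam r) (ηr r) (by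
    intro A hA
    rw [hlam r A hA]
    simp [ηr, Kernel.comap_apply]) (F r) hi).2
  rw [← this]
  simp [ηr, Kernel.comap_apply]

/-- Flow identity for SFPE solutions: under the SFPE setting with hypotheses (H1)–(H5),
the measurable solution `u` of the SFPE with at most `V`-growth satisfies
`u(s,x) − E[u(t, X^x_{s,t})] = ∫_s^t E[f(r, X^x_{s,r}, u(r, X^x_{s,r}))] dr`
for all `0 ≤ s ≤ t ≤ T`, `x ∈ ℝ^d`. -/
theorem stmt_7
    {Ω : Type*} [MeasurableSpace Ω] (P : Measure Ω) [IsProbabilityMeasure P]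
    (d : ℕ) (L T : ℝ) (hL : 0 ≤ L) (hT : 0 < T)
    (p₁ p₂ p₃ : ℝ≥0∞) (hp₁ : 1 ≤ p₁) (hp₂ : 1 ≤ p₂) (hp₃ : 1 ≤ p₃)
    (hp : 1 / p₁ + 1 / p₂ + 1 / p₃ ≤ 1)
    (nrm : (Fin d → ℝ) → ℝ)
    (hnrm_tri : ∀ x y, nrm (x + y) ≤ nrm x + nrm y)
    (hnrm_smul : ∀ (a : ℝ) x, nrm (a • x) = |a| * nrm x)
    (hnrm_def : ∀ x, nrm x = 0 → x = 0)
    (f : ℝ → (Fin d → ℝ) → ℝ → ℝ)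
    (hf_meas : Measurable fun p : ℝ × (Fin d → ℝ) × ℝ => f p.1 p.2.1 p.2.2)
    (g : (Fin d → ℝ) → ℝ) (hg_meas : Measurable g)
    (φ V ψ : ℝ → (Fin d → ℝ) → ℝ)
    (hφ_meas : Measurable fun p : ℝ × (Fin d → ℝ) => φ p.1 p.2)
    (hV_meas : Measurable fun p : ℝ × (Fin d → ℝ) => V p.1 p.2)
    (hψ_meas : Measurable fun p : ℝ × (Fin d → ℝ) => ψ p.1 p.2)
    (hφ1 : ∀ t ∈ Set.Icc (0:ℝ) T, ∀ x, 1 ≤ φ t x)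
    (hV1 : ∀ t ∈ Set.Icc (0:ℝ) T, ∀ x, 1 ≤ V t x)
    (hψ1 : ∀ t ∈ Set.Icc (0:ℝ) T, ∀ x, 1 ≤ ψ t x)
    (X : ℝ → ℝ → (Fin d → ℝ) → Ω → (Fin d → ℝ))
    (hX_meas : ∀ s ∈ Set.Icc (0:ℝ) T, ∀ x,
      Measurable fun p : Set.Icc s T × Ω => X s (p.1 : ℝ) x p.2)
    (hjoint : ∀ h : ℝ → (Fin d → ℝ) → (Fin d → ℝ) → ℝ≥0∞,
      (Measurable fun p : ℝ × (Fin d → ℝ) × (Fin d → ℝ) => h p.1 p.2.1 p.2.2) →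
      Measurable fun q : {p : ℝ × ℝ // 0 ≤ p.1 ∧ p.1 ≤ p.2 ∧ p.2 ≤ T}
          × (Fin d → ℝ) × (Fin d → ℝ) =>
        ∫⁻ ω, h (q.1 : ℝ × ℝ).2 (X (q.1 : ℝ × ℝ).1 (q.1 : ℝ × ℝ).2 q.2.1 ω)
          (X (q.1 : ℝ × ℝ).1 (q.1 : ℝ × ℝ).2 q.2.2 ω) ∂P)
    -- (H1)
    (hH1 : ∀ s t : ℝ, 0 ≤ s → s ≤ t → t ≤ T → ∀ x,
      (if s = T then |g x| else 0) ≤ V s x ∧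
      |T * f s x 0| ≤ V s x ∧
      eLpNorm (fun ω => V t (X s t x ω)) p₁ P ≤ ENNReal.ofReal (V s x) ∧
      eLpNorm (fun ω => φ t (X s t x ω)) p₃ P ≤ ENNReal.ofReal (φ s x))
    -- (H2)
    (hH2 : ∀ x y, |g x - g y| ≤ (2 * Real.sqrt T)⁻¹ * (V T x + V T y) * nrm (x - y))
    -- (H3)
    (hH3 : ∀ t ∈ Set.Icc (0:ℝ) T, ∀ x y v w,
      |f t x v - f t y w| ≤ L * |v - w|
        + (2 * T ^ ((3:ℝ)/2))⁻¹ * (V t x + V t y) * nrm (x - y))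
    -- (H4)
    (hH4 : ∀ s t : ℝ, 0 ≤ s → s ≤ t → t ≤ T → ∀ x y,
      eLpNorm (fun ω => nrm (X s t x ω - x)) p₂ P
        ≤ ENNReal.ofReal (ψ s x * |s - t| ^ ((1:ℝ)/2)) ∧
      eLpNorm (fun ω => nrm (X s t x ω - X s t y ω)) p₂ P
        ≤ ENNReal.ofReal (2⁻¹ * (φ s x + φ s y) * nrm (x - y)))
    -- (H5)
    (hH5 : ∀ h : ℝ → (Fin d → ℝ) → (Fin d → ℝ) → ℝ≥0∞,
      (Measurable fun p : ℝ × (Fin d → ℝ) × (Fin d → ℝ) => h p.1 p.2.1 p.2.2) →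
      ∀ s t r : ℝ, 0 ≤ s → s ≤ t → t ≤ r → r ≤ T → ∀ x y,
        ∫⁻ ω, (∫⁻ ω', h r (X t r (X s t x ω) ω') (X t r (X s t y ω) ω') ∂P) ∂P
          = ∫⁻ ω, h r (X s r x ω) (X s r y ω) ∂P)
    (u : ℝ → (Fin d → ℝ) → ℝ)
    (hu_meas : Measurable fun p : ℝ × (Fin d → ℝ) => u p.1 p.2)
    (hu_growth : ∃ C : ℝ, ∀ r ∈ Set.Icc (0:ℝ) T, ∀ ξ, |u r ξ| ≤ C * V r ξ)
    (hu_sfpe : ∀ t ∈ Set.Icc (0:ℝ) T, ∀ x,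
      (∫⁻ ω, ENNReal.ofReal |g (X t T x ω)| ∂P) ≠ ⊤ ∧
      (∫⁻ r in Set.Ioc t T,
        ∫⁻ ω, ENNReal.ofReal |f r (X t r x ω) (u r (X t r x ω))| ∂P) ≠ ⊤ ∧
      u t x = (∫ ω, g (X t T x ω) ∂P)
        + ∫ r in t..T, ∫ ω, f r (X t r x ω) (u r (X t r x ω)) ∂P) :
    ∀ s t : ℝ, 0 ≤ s → s ≤ t → t ≤ T → ∀ x,
      u s x - (∫ ω, u t (X s t x ω) ∂P)
        = ∫ r in s..t, ∫ ω, f r (X s r x ω) (u r (X s r x ω)) ∂P := by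
  intro s t hs hst htT x
  have ht0 : 0 ≤ t := hs.trans hst
  have hsT : s ≤ T := hst.trans htT
  -- measurability of each X s r x
  have hX : ∀ a r : ℝ, 0 ≤ a → a ≤ r → r ≤ T → ∀ y, Measurable (X a r y) := by
    intro a r ha har hr y
    exact (hX_meas a ⟨ha, har.trans hr⟩ y).comp
      (by fun_prop : Measurable fun ω : Ω => ((⟨r, har, hr⟩ : Set.Icc a T), ω))
  have hY : Measurable (X s t x) := hX s t hs hst htT x
  let F : ℝ → (Fin d → ℝ) → ℝ := fun r z => f r z (u r z)
  have hF : Measurable fun p : ℝ × (Fin d → ℝ) => F p.1 p.2 :=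
    hf_meas.comp (measurable_fst.prodMk (measurable_snd.prodMk hu_meas))
  have hFr : ∀ r, Measurable (F r) := fun r => hF.comp (by fun_prop : Measurable fun z => (r, z))
  -- the transition kernel
  let η : Kernel (Set.Icc t T × (Fin d → ℝ)) (Fin d → ℝ) :=
    { toFun := fun p => P.map (X t p.1 p.2)
      measurable' := by
        refine Measure.measurable_of_measurable_coe _ fun A hA => ?_
        have h1 := hjoint (fun _ z _ => A.indicator 1 z)
          ((measurable_one.indicator hA).comp
            (by fun_prop : Measurable fun p : ℝ × (Fin d → ℝ) × (Fin d → ℝ) => p.2.1))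
        have h2 : Measurable fun p : Set.Icc t T × (Fin d → ℝ) =>
            (((⟨(t, (p.1 : ℝ)), ht0, p.1.2.1, p.1.2.2⟩ :
              {p : ℝ × ℝ // 0 ≤ p.1 ∧ p.1 ≤ p.2 ∧ p.2 ≤ T}), p.2, p.2) :
              {p : ℝ × ℝ // 0 ≤ p.1 ∧ p.1 ≤ p.2 ∧ p.2 ≤ T} × (Fin d → ℝ) × (Fin d → ℝ)) := by
          refine Measurable.prodMk ?_ (by fun_prop)
          exact Measurable.subtype_mk (by fun_prop)
        convert h1.comp h2 using 1
        funext p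
        have hm := hX t p.1 ht0 p.1.2.1 p.1.2.2 p.2
        rw [Measure.map_apply hm hA, ← lintegral_indicator_one (hm hA)]
        rfl }
  have hη : ∀ r y, η (r, y) = P.map (X t r y) := fun r y => rfl
  have : IsMarkovKernel η := ⟨fun p => by
    rw [show η p = P.map (X t p.1 p.2) from rfl]
    exact Measure.isProbabilityMeasure_map (hX t p.1 ht0 p.1.2.1 p.1.2.2 p.2).aemeasurable⟩
  have : IsProbabilityMeasure (P.map (X s t x)) :=
    Measure.isProbabilityMeasure_map hY.aemeasurable
  have hlam : ∀ (r : Set.Icc t T) (A : Set (Fin d → ℝ)), MeasurableSet A →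
      P.map (X s r x) A = ∫⁻ y, η (r, y) A ∂(P.map (X s t x)) := by
    intro r A hA
    have hm := hX s r hs (hst.trans r.2.1) r.2.2 x
    have hk : Measurable fun y => η (r, y) A :=
      (Kernel.measurable_coe η hA).comp (by fun_prop : Measurable fun y => (r, y))
    rw [lintegral_map hk hY]
    have h5 := hH5 (fun _ z _ => A.indicator 1 z)
      ((measurable_one.indicator hA).comp
        (by fun_prop : Measurable fun p : ℝ × (Fin d → ℝ) × (Fin d → ℝ) => p.2.1))
      s t r hs hst r.2.1 r.2.2 x x
    rw [Measure.map_apply hm hA, ← lintegral_indicator_one (hm hA)]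
    refine Eq.trans h5.symm (lintegral_congr fun ω => ?_)
    have hm' := hX t r ht0 r.2.1 r.2.2 (X s t x ω)
    rw [hη, Measure.map_apply hm' hA, ← lintegral_indicator_one (hm' hA)]
    rfl
  let ν : Measure (Set.Icc t T) := (volume : Measure ℝ).comap (↑)
  have : SFinite ν := by
    have : IsFiniteMeasure ν := ⟨by
      rw [(MeasurableEmbedding.subtype_coe measurableSet_Icc).comap_apply, Set.image_univ, Subtype.range_coe]
      exact measure_Icc_lt_top⟩
    infer_instance
  obtain ⟨hg1, hf1, hus⟩ := hu_sfpe s ⟨hs, hsT⟩ x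
  -- the set integrals
  have hfin : ∫⁻ r : Set.Icc t T, ∫⁻ z, ‖F r z‖ₑ ∂(P.map (X s r x)) ∂ν ≠ ⊤ := by
    have e1 : ∀ r : Set.Icc t T, ∫⁻ z, ‖F r z‖ₑ ∂(P.map (X s r x))
        = ∫⁻ ω, ENNReal.ofReal |f r (X s r x ω) (u r (X s r x ω))| ∂P := by
      intro r
      rw [lintegral_map (hFr r).enorm (hX s r hs (hst.trans r.2.1) r.2.2 x)]
      simp [F, Real.enorm_eq_ofReal_abs]
    simp_rw [e1]
    rw [lintegral_subtype_comap measurableSet_Icc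
      (fun r : ℝ => ∫⁻ ω, ENNReal.ofReal |f r (X s r x ω) (u r (X s r x ω))| ∂P),
      setLIntegral_congr Ioc_ae_eq_Icc.symm]
    exact ne_top_of_le_ne_top hf1 (lintegral_mono_set (Set.Ioc_subset_Ioc_left hst))
  have key := aux_fubini ν (P.map (X s t x)) η (fun r => P.map (X s r x)) hlam
    (fun r z => F r z) (hF.comp (by fun_prop :
      Measurable fun p : Set.Icc t T × (Fin d → ℝ) => ((p.1 : ℝ), p.2))) hfin
  have hTm : T ∈ Set.Icc t T := ⟨htT, le_rfl⟩
  have hgint : Integrable g (P.map (X s T x)) := by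
    refine ⟨hg_meas.aestronglyMeasurable, ?_⟩
    rw [HasFiniteIntegral, lintegral_map hg_meas.enorm (hX s T hs hsT le_rfl x)]
    simp_rw [Real.enorm_eq_ofReal_abs]
    exact hg1.lt_top
  have keyg := aux_bind (P.map (X s t x)) (P.map (X s T x))
    (η.comap (fun y => (⟨T, hTm⟩, y)) (by fun_prop)) (by
      intro A hA
      have := hlam ⟨T, hTm⟩ A hA
      simpa [Kernel.comap_apply] using this) g hgint
  simp only [Kernel.comap_apply] at keyg
  -- u t in terms of the kernel
  have hut : ∀ y, u t y = (∫ z, g z ∂η (⟨T, hTm⟩, y))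
      + ∫ r : Set.Icc t T, ∫ z, F r z ∂η (r, y) ∂ν := by
    intro y
    rw [(hu_sfpe t ⟨ht0, htT⟩ y).2.2, hη, integral_map (hX t T ht0 htT le_rfl y).aemeasurable
      hg_meas.aestronglyMeasurable]
    congr 1
    have e1 : ∀ r : Set.Icc t T, ∫ z, F r z ∂η (r, y)
        = ∫ ω, f r (X t r y ω) (u r (X t r y ω)) ∂P := by
      intro r
      rw [hη, integral_map (hX t r ht0 r.2.1 r.2.2 y).aemeasurable (hFr r).aestronglyMeasurable]
    simp_rw [e1]
    rw [integral_subtype_comap measurableSet_Icc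
      (fun r : ℝ => ∫ ω, f r (X t r y ω) (u r (X t r y ω)) ∂P),
      integral_Icc_eq_integral_Ioc, intervalIntegral.integral_of_le htT]
  have hutm : Measurable (u t) := hu_meas.comp (by fun_prop : Measurable fun z => (t, z))
  have hEu : ∫ ω, u t (X s t x ω) ∂P = (∫ ω, g (X s T x ω) ∂P)
      + ∫ r in t..T, ∫ ω, f r (X s r x ω) (u r (X s r x ω)) ∂P := by
    rw [← integral_map hY.aemeasurable hutm.aestronglyMeasurable]
    simp_rw [hut]
    rw [integral_add keyg.1 key.1, keyg.2, key.2,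
      integral_map (hX s T hs hsT le_rfl x).aemeasurable hg_meas.aestronglyMeasurable]
    congr 1
    have e1 : ∀ r : Set.Icc t T, ∫ z, F r z ∂(P.map (X s r x))
        = ∫ ω, f r (X s r x ω) (u r (X s r x ω)) ∂P := by
      intro r
      rw [integral_map (hX s r hs (hst.trans r.2.1) r.2.2 x).aemeasurable
        (hFr r).aestronglyMeasurable]
    simp_rw [e1]
    rw [integral_subtype_comap measurableSet_Icc
      (fun r : ℝ => ∫ ω, f r (X s r x ω) (u r (X s r x ω)) ∂P),
      integral_Icc_eq_integral_Ioc, intervalIntegral.integral_of_le htT]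
  -- integrability in time
  have hII : IntegrableOn (fun r : ℝ => ∫ ω, f r (X s r x ω) (u r (X s r x ω)) ∂P)
      (Set.Ioc s T) := by
    have hsm : StronglyMeasurable fun r : Set.Icc s T =>
        ∫ ω, f r (X s r x ω) (u r (X s r x ω)) ∂P := by
      have : Measurable fun p : Set.Icc s T × Ω => F p.1 (X s p.1 x p.2) :=
        hF.comp ((by fun_prop : Measurable fun p : Set.Icc s T × Ω => (p.1 : ℝ)).prodMk
          (hX_meas s ⟨hs, hsT⟩ x))
      exact this.stronglyMeasurable.integral_prod_right
    have hae : AEStronglyMeasurable (fun r : ℝ => ∫ ω, f r (X s r x ω) (u r (X s r x ω)) ∂P)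
        (volume.restrict (Set.Icc s T)) := by
      rw [← map_comap_subtype_coe measurableSet_Icc,
        (MeasurableEmbedding.subtype_coe measurableSet_Icc).aestronglyMeasurable_map_iff]
      exact hsm.aestronglyMeasurable
    refine ⟨hae.mono_measure (Measure.restrict_mono_set _ Set.Ioc_subset_Icc_self), ?_⟩
    refine lt_of_le_of_lt (lintegral_mono fun r => ?_) hf1.lt_top
    refine (enorm_integral_le_lintegral_enorm _).trans ?_
    simp_rw [Real.enorm_eq_ofReal_abs]
    exact le_rfl
  rw [hus, hEu]
  have i1 : IntervalIntegrable (fun r : ℝ => ∫ ω, f r (X s r x ω) (u r (X s r x ω)) ∂P)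
      volume s t := by
    rw [intervalIntegrable_iff_integrableOn_Ioc_of_le hst]
    exact hII.mono_set (Set.Ioc_subset_Ioc_right htT)
  have i2 : IntervalIntegrable (fun r : ℝ => ∫ ω, f r (X s r x ω) (u r (X s r x ω)) ∂P)
      volume t T := by
    rw [intervalIntegrable_iff_integrableOn_Ioc_of_le htT]
    exact hII.mono_set (Set.Ioc_subset_Ioc_left hst)
  rw [← intervalIntegral.integral_add_adjacent_intervals i1 i2]
  ring
end
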